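/- Let (R,𝔪) be a complete Noetherian local domain of mixed characteristic. Then there exists a balanced big Cohen-Macaulay R-algebra, i.e., an R-algebra B with 𝔪B ≠ B such that every system of parameters of R is a regular sequence on B. -/

import Mathlib

/-- A list of elements of a Noetherian local ring is a system of parameters if it consists of
elements of the maximal ideal, has length equal to the Krull dimension, and the radical of the
ideal it generates is the maximal ideal. -/
def IsSOP (R : Type*) [CommRing R] [IsLocalRing R] (xs : List R) : Prop :=
  (∀ x ∈ xs, x ∈ IsLocalRing.maximalIdeal R) ∧
    (xs.length : WithBot ℕ∞) = ringKrullDim R ∧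
    (Ideal.span {x | x ∈ xs}).radical = IsLocalRing.maximalIdeal R

/-- An `R`-algebra `B` is a balanced big Cohen-Macaulay algebra for the local ring `(R, 𝔪)` if
`𝔪 B ≠ B` and every system of parameters of `R` is a regular sequence on `B`, i.e. each
parameter is a nonzerodivisor modulo the previous ones. -/
def IsBalancedBigCM (R B : Type*) [CommRing R] [IsLocalRing R] [CommRing B] [Algebra R B] :
    Prop :=
  (IsLocalRing.maximalIdeal R).map (algebraMap R B) ≠ ⊤ ∧
    ∀ xs : List R, IsSOP R xs → RingTheory.Sequence.IsWeaklyRegular B xs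

/-- A local ring has mixed characteristic if it has characteristic zero and its residue field
has characteristic `p > 0`. -/
def MixedCharLocal (R : Type*) [CommRing R] [IsLocalRing R] : Prop :=
  CharZero R ∧ ∃ p : ℕ, 0 < p ∧ CharP (IsLocalRing.ResidueField R) p

universe u

namespace BigCM

section DerivedComplete

open scoped Pointwise

variable {A : Type*} [CommRing A] {M N : Type*} [AddCommGroup M] [Module A M]
  [AddCommGroup N] [Module A N]

/-- The endomorphism `u ↦ (u i - a • u (i + 1))` of the module of sequences. -/
def shiftMap (a : A) (M : Type*) [AddCommGroup M] [Module A M] : (ℕ → M) →ₗ[A] (ℕ → M) where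
  toFun u i := u i - a • u (i + 1)
  map_add' u v := by ext i; simp only [Pi.add_apply, smul_add]; abel
  map_smul' c u := by
    ext i; simp only [Pi.smul_apply, RingHom.id_apply, smul_sub, smul_comm c a]

@[simp] lemma shiftMap_apply (a : A) (u : ℕ → M) (i : ℕ) :
    shiftMap a M u i = u i - a • u (i + 1) := rfl

/-- `M` is derived complete with respect to `a`. -/
def IsDC (a : A) (M : Type*) [AddCommGroup M] [Module A M] : Prop :=
  Function.Bijective (shiftMap a M)

lemma shiftMap_map (a : A) (f : M →ₗ[A] N) (u : ℕ → M) :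
    shiftMap a N (fun i => f (u i)) = fun i => f (shiftMap a M u i) := by
  ext i; simp

lemma IsDC.eq_zero {a : A} (h : IsDC a M) {u : ℕ → M} (hu : ∀ i, u i = a • u (i + 1)) :
    ∀ i, u i = 0 := by
  have : u = 0 := h.1 (by ext i; simp [hu i])
  intro i; rw [this]; rfl

/-- A derived complete module on which `a` is surjective vanishes. -/
lemma IsDC.eq_zero_of_surjective {a : A} (h : IsDC a M) (hs : ∀ x : M, ∃ y, x = a • y) (x : M) :
    x = 0 := by
  choose g hg using hs
  have := h.eq_zero (u := fun i => g^[i] x) (fun i => by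
    rw [Function.iterate_succ_apply']; exact hg _) 0
  simpa using this

lemma IsDC.of_linearEquiv {a : A} (h : IsDC a M) (e : M ≃ₗ[A] N) : IsDC a N := by
  constructor
  · rw [injective_iff_map_eq_zero]
    intro u hu
    have := h.eq_zero (u := fun i => e.symm (u i)) (fun i => by
      have := congrFun hu i
      simp only [shiftMap_apply, Pi.zero_apply, sub_eq_zero] at this
      rw [this]; simp)
    ext i; simpa using this i
  · intro v
    obtain ⟨u, hu⟩ := h.2 (fun i => e.symm (v i))
    refine ⟨fun i => e (u i), ?_⟩
    have := shiftMap_map a e.toLinearMap u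
    simp only [LinearEquiv.coe_coe] at this
    rw [this, hu]; simp

lemma IsDC.pi {ι : Type*} {a : A} (h : IsDC a M) : IsDC a (ι → M) := by
  constructor
  · rw [injective_iff_map_eq_zero]
    intro u hu
    ext i j
    refine h.eq_zero (u := fun i => u i j) (fun i => ?_) i
    have := congrFun (congrFun hu i) j
    simpa [sub_eq_zero] using this
  · intro v
    choose u hu using fun j => h.2 (fun i => v i j)
    refine ⟨fun i j => u j i, ?_⟩
    ext i j
    exact congrFun (hu j) i

lemma IsDC.range {a : A} (hM : IsDC a M) (hN : IsDC a N) (f : M →ₗ[A] N) :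
    IsDC a (LinearMap.range f) := by
  constructor
  · rw [injective_iff_map_eq_zero]
    intro u hu
    have := hN.eq_zero (u := fun i => (u i : N)) (fun i => by
      have := congrArg Subtype.val (congrFun hu i)
      simpa [sub_eq_zero] using this)
    ext i; exact this i
  · intro v
    choose w hw using fun i => (v i).2
    obtain ⟨u, hu⟩ := hM.2 w
    refine ⟨fun i => ⟨f (u i), u i, rfl⟩, ?_⟩
    ext i
    have := congrFun (shiftMap_map a f u) i
    simp only [shiftMap_apply] at this
    simp only [shiftMap_apply, AddSubgroupClass.coe_sub, SetLike.val_smul, this]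
    rw [← hw i, ← congrFun hu i]; rfl

lemma IsDC.ker {a : A} (hM : IsDC a M) (hN : IsDC a N) (f : M →ₗ[A] N) :
    IsDC a (LinearMap.ker f) := by
  constructor
  · rw [injective_iff_map_eq_zero]
    intro u hu
    have := hM.eq_zero (u := fun i => (u i : M)) (fun i => by
      have := congrArg Subtype.val (congrFun hu i)
      simpa [sub_eq_zero] using this)
    ext i; exact this i
  · intro v
    obtain ⟨u, hu⟩ := hM.2 (fun i => (v i : M))
    have hk := hN.eq_zero (u := fun i => f (u i)) (fun i => by
      have := congrArg f (congrFun hu i)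
      simp only [shiftMap_apply, map_sub, map_smul, LinearMap.map_coe_ker, sub_eq_zero] at this
      exact this)
    refine ⟨fun i => ⟨u i, hk i⟩, ?_⟩
    ext i
    exact congrFun hu i

lemma IsDC.quotient_range {a : A} (hM : IsDC a M) (hN : IsDC a N) (f : M →ₗ[A] N) :
    IsDC a (N ⧸ LinearMap.range f) := by
  constructor
  · rw [injective_iff_map_eq_zero]
    intro u hu
    choose w hw using fun i => Submodule.Quotient.mk_surjective _ (u i)
    have hr : ∀ i, shiftMap a N w i ∈ LinearMap.range f := fun i => by
      rw [← Submodule.Quotient.mk_eq_zero]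
      have := congrFun hu i
      simpa [← hw] using this
    obtain ⟨r, hr'⟩ := (hM.range hN f).2 (fun i => ⟨_, hr i⟩)
    have : w = fun i => (r i : N) := hN.1 (by
      ext i
      have := congrArg Subtype.val (congrFun hr' i)
      simpa using this.symm)
    ext i
    rw [← hw i, this, Pi.zero_apply, Submodule.Quotient.mk_eq_zero]
    exact (r i).2
  · intro v
    choose w hw using fun i => Submodule.Quotient.mk_surjective _ (v i)
    obtain ⟨u, hu⟩ := hN.2 w
    refine ⟨fun i => Submodule.Quotient.mk (u i), ?_⟩
    ext i
    rw [← hw i, ← congrFun hu i]; rfl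

lemma IsDC.quotSMulTop {a : A} (h : IsDC a M) (b : A) : IsDC a (QuotSMulTop b M) :=
  (h.quotient_range h (LinearMap.lsmul A M b)).of_linearEquiv
    (Submodule.quotEquivOfEq _ _ (by
      ext x
      simp [Submodule.mem_smul_pointwise_iff_exists]))

lemma IsDC.quot_ofList {a : A} (h : IsDC a M) (rs : List A) :
    IsDC a (M ⧸ (Ideal.ofList rs • ⊤ : Submodule A M)) := by
  induction rs generalizing M with
  | nil =>
    exact h.of_linearEquiv (Submodule.quotEquivOfEqBot _ (by simp)).symm
  | cons b rs ih =>
    exact (ih (h.quotSMulTop b)).of_linearEquiv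
      (Submodule.quotOfListConsSMulTopEquivQuotSMulTopInner M b rs).symm

/-- Nakayama's lemma for derived complete modules. -/
lemma subsingleton_of_ofList_smul_top_eq (rs : List A) (h : ∀ a ∈ rs, IsDC a M)
    (ht : (⊤ : Submodule A M) = Ideal.ofList rs • ⊤) : Subsingleton M := by
  induction rs generalizing M with
  | nil =>
    rw [Ideal.ofList_nil, Submodule.bot_smul] at ht
    exact (Submodule.subsingleton_iff A).1 (subsingleton_of_bot_eq_top ht.symm)
  | cons b rs ih =>
    have := ih (M := QuotSMulTop b M) (fun a ha => (h a (by simp [ha])).quotSMulTop b)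
      ((Submodule.top_eq_ofList_cons_smul_iff b rs).1 ht)
    refine ⟨fun x y => ?_⟩
    have key := (h b (by simp)).eq_zero_of_surjective (fun x => by
      have : (Submodule.Quotient.mk x : QuotSMulTop b M) = 0 := Subsingleton.elim _ _
      rw [Submodule.Quotient.mk_eq_zero, Submodule.mem_smul_pointwise_iff_exists] at this
      obtain ⟨y, _, hy⟩ := this
      exact ⟨y, hy.symm⟩)
    rw [key x, key y]

lemma top_eq_smul_top_of_surjective {a : A} (hs : ∀ x : M, ∃ y, x = a • y) (I : Ideal A)
    (ha : a ∈ I.radical) : (⊤ : Submodule A M) = I • ⊤ := by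
  obtain ⟨n, hn⟩ := ha
  have : ∀ n, ∀ x : M, ∃ y, x = a ^ n • y := by
    intro n
    induction n with
    | zero => intro x; exact ⟨x, by simp⟩
    | succ n ih =>
      intro x
      obtain ⟨y, rfl⟩ := ih x
      obtain ⟨z, rfl⟩ := hs y
      exact ⟨z, by rw [smul_smul, pow_succ]⟩
  refine le_antisymm (fun x _ => ?_) le_top
  obtain ⟨y, rfl⟩ := this n x
  exact Submodule.smul_mem_smul hn trivial

/-- Derived completeness with respect to generators implies derived completeness with respect to
every element of the radical of the ideal they generate. -/
lemma isDC_of_mem_radical (rs : List A) (h : ∀ a ∈ rs, IsDC a M) {y : A}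
    (hy : y ∈ (Ideal.ofList rs).radical) : IsDC y M := by
  have hp : ∀ a ∈ rs, IsDC a (ℕ → M) := fun a ha => (h a ha).pi
  constructor
  · rw [← LinearMap.ker_eq_bot, ← Submodule.subsingleton_iff_eq_bot]
    refine subsingleton_of_ofList_smul_top_eq rs
      (fun a ha => (hp a ha).ker (hp a ha) _) (top_eq_smul_top_of_surjective (a := y) ?_ _ hy)
    rintro ⟨u, hu⟩
    have hu' : ∀ i, u i = y • u (i + 1) := fun i => by
      have := congrFun hu i
      simpa [sub_eq_zero] using this
    refine ⟨⟨fun i => u (i + 1), ?_⟩, ?_⟩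
    · ext i
      simp [← hu' (i + 1)]
    · ext i
      simpa using hu' i
  · rw [← LinearMap.range_eq_top, ← Submodule.Quotient.subsingleton_iff]
    refine subsingleton_of_ofList_smul_top_eq rs
      (fun a ha => (hp a ha).quotient_range (hp a ha) _)
      (top_eq_smul_top_of_surjective (a := y) ?_ _ hy)
    intro x
    obtain ⟨v, rfl⟩ := Submodule.Quotient.mk_surjective _ x
    refine ⟨Submodule.Quotient.mk (fun i => v (i + 1)), ?_⟩
    rw [← Submodule.Quotient.mk_smul, Submodule.Quotient.eq]
    exact ⟨v, by ext i; simp⟩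

/-- On a derived complete module regular sequences can be permuted. -/
lemma isWeaklyRegular_perm {rs rs' : List A} (h : ∀ a ∈ rs, IsDC a M)
    (hr : RingTheory.Sequence.IsWeaklyRegular M rs) (hp : rs.Perm rs') :
    RingTheory.Sequence.IsWeaklyRegular M rs' := by
  refine hr.prototype_perm hp ?_
  intro a b l hl K hK
  have ha : a ∈ rs := hl.subset (by simp)
  have h1 : IsDC a (M ⧸ (Ideal.ofList l • ⊤ : Submodule A M)) := (h a ha).quot_ofList l
  have hK' : K = LinearMap.ker (LinearMap.lsmul A (M ⧸ (Ideal.ofList l • ⊤ : Submodule A M)) b) :=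
    rfl
  have h2 : IsDC a K := by rw [hK']; exact h1.ker h1 _
  rw [eq_bot_iff]
  intro x hx
  have := h2.eq_zero_of_surjective (fun z => by
    have hz : (z : M ⧸ (Ideal.ofList l • ⊤ : Submodule A M)) ∈ a • K := by rw [← hK]; exact z.2
    rw [Submodule.mem_smul_pointwise_iff_exists] at hz
    obtain ⟨w, hw, hwz⟩ := hz
    exact ⟨⟨w, hw⟩, by ext; exact hwz.symm⟩) ⟨x, hx⟩
  simpa using congrArg Subtype.val this

end DerivedComplete

end BigCM

namespace BigCM

open RingTheory.Sequence IsLocalRing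

lemma isWeaklyRegular_exchange {A M : Type*} [CommRing A] [AddCommGroup M] [Module A M]
    {xs : List A} {a z : A} (h : IsWeaklyRegular M (xs ++ [a]))
    (ha : a ∈ (Ideal.ofList (xs ++ [z])).radical) : IsWeaklyRegular M (xs ++ [z]) := by
  rw [isWeaklyRegular_append_iff, isWeaklyRegular_singleton_iff] at h ⊢
  refine ⟨h.1, ?_⟩
  obtain ⟨n, hn⟩ := ha
  rw [Ideal.ofList_append, Ideal.ofList_singleton, Submodule.mem_sup] at hn
  obtain ⟨u, hu, v, hv, huv⟩ := hn
  obtain ⟨c, rfl⟩ := Ideal.mem_span_singleton'.1 hv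
  have hreg := h.2.pow n
  rw [isSMulRegular_iff_right_eq_zero_of_smul] at hreg ⊢
  intro m hm
  apply hreg
  obtain ⟨m, rfl⟩ := Submodule.Quotient.mk_surjective _ m
  rw [← huv, add_smul, mul_smul, hm, smul_zero, add_zero, ← Submodule.Quotient.mk_smul,
    Submodule.Quotient.mk_eq_zero]
  exact Submodule.smul_mem_smul hu trivial

lemma ofList_append_singleton_eq_span {A : Type*} [CommRing A] (xs : List A) (a : A) :
    Ideal.ofList (xs ++ [a]) = Ideal.span (insert a {x | x ∈ xs}) := by
  unfold Ideal.ofList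
  congr 1
  ext x
  simp [or_comm]

section

variable {R : Type*} [CommRing R] [IsNoetherianRing R]

lemma height_le_length {q : Ideal R} {xs : List R} (h : q ∈ (Ideal.ofList xs).minimalPrimes) :
    q.height ≤ xs.length := by
  classical
  have : Ideal.ofList xs = Ideal.span (xs.toFinset : Set R) := by
    unfold Ideal.ofList; congr 1; ext; simp
  rw [this] at h
  refine (Ideal.height_le_card_of_mem_minimalPrimes_span_finset h).trans ?_
  exact_mod_cast xs.toFinset_card_le

variable [IsLocalRing R]

lemma radical_exchange {xs : List R} {a z : R}
    (ha : (Ideal.ofList (xs ++ [a])).radical = maximalIdeal R) (hz : z ∈ maximalIdeal R)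
    (hmin : ∀ q ∈ (Ideal.ofList xs).minimalPrimes, z ∉ q) :
    (Ideal.ofList (xs ++ [z])).radical = maximalIdeal R := by
  have hle : Ideal.ofList (xs ++ [a]) ≤ maximalIdeal R := ha ▸ Ideal.le_radical
  rw [Ideal.ofList_append, Ideal.ofList_singleton] at hle
  apply le_antisymm
  · rw [(maximalIdeal.isMaximal R).isPrime.radical_le_iff, Ideal.ofList_append,
      Ideal.ofList_singleton]
    refine sup_le (le_sup_left.trans hle) ?_
    rwa [Ideal.span_singleton_le_iff_mem]
  · rw [Ideal.radical_eq_sInf]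
    refine le_sInf ?_
    rintro q ⟨hq, hqp⟩
    by_contra hne
    have hlt : q < maximalIdeal R :=
      lt_of_le_of_ne (le_maximalIdeal hqp.ne_top) (fun h => hne (h ▸ le_rfl))
    rw [Ideal.ofList_append, Ideal.ofList_singleton, sup_le_iff,
      Ideal.span_singleton_le_iff_mem] at hq
    have hmem : maximalIdeal R ∈ (Ideal.span (insert a {x | x ∈ xs})).minimalPrimes := by
      rw [← ofList_append_singleton_eq_span, ← Ideal.radical_minimalPrimes, ha,
        Ideal.minimalPrimes_eq_subsingleton_self]
      rfl
    refine hmin q ?_ hq.2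
    refine Ideal.mem_minimalPrimes_span_of_mem_minimalPrimes_span_insert hlt a _ hmem
      {x | x ∈ xs} ?_ ?_
    · intro x hx
      exact hq.1 (Ideal.subset_span hx)
    · intro x hx
      exact Ideal.le_radical (Ideal.subset_span (Set.mem_insert_of_mem _ hx))

lemma exists_common_parameter {xs ys : List R} (hx : (xs.length : ℕ∞) < (maximalIdeal R).height)
    (hy : (ys.length : ℕ∞) < (maximalIdeal R).height) :
    ∃ z ∈ maximalIdeal R, (∀ q ∈ (Ideal.ofList xs).minimalPrimes, z ∉ q) ∧
      ∀ q ∈ (Ideal.ofList ys).minimalPrimes, z ∉ q := by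
  classical
  have hf : ((Ideal.ofList xs).minimalPrimes ∪ (Ideal.ofList ys).minimalPrimes).Finite :=
    (Ideal.finite_minimalPrimes_of_isNoetherianRing R _).union
      (Ideal.finite_minimalPrimes_of_isNoetherianRing R _)
  by_contra! hcon
  have hsub : ((maximalIdeal R : Ideal R) : Set R) ⊆
      ⋃ q ∈ (hf.toFinset : Set (Ideal R)), ((id q : Ideal R) : Set R) := by
    intro z hz
    simp only [Set.mem_iUnion]
    by_cases h : ∀ q ∈ (Ideal.ofList xs).minimalPrimes, z ∉ q
    · obtain ⟨q, hq, hzq⟩ := hcon z hz h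
      exact ⟨q, by simp [hq], hzq⟩
    · push Not at h
      obtain ⟨q, hq, hzq⟩ := h
      exact ⟨q, by simp [hq], hzq⟩
  rw [Ideal.subset_union_prime ⊥ ⊥ (fun q hq _ _ => by
    rw [Set.Finite.mem_toFinset] at hq
    exact hq.elim (fun h => h.1.1) (fun h => h.1.1))] at hsub
  obtain ⟨q, hq, hle⟩ := hsub
  rw [Set.Finite.mem_toFinset] at hq
  have hqp : q.IsPrime := hq.elim (fun h => h.1.1) (fun h => h.1.1)
  have hqe : maximalIdeal R = q := le_antisymm hle (le_maximalIdeal hqp.ne_top)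
  rw [← hqe] at hq
  rcases hq with hq | hq
  · exact absurd (height_le_length hq) (not_le.2 hx)
  · exact absurd (height_le_length hq) (not_le.2 hy)

end

lemma radical_map_quotient {R : Type*} [CommRing R] [IsLocalRing R] {z : R} {xs : List R}
    [IsLocalRing (R ⧸ Ideal.span {z})]
    (h : (Ideal.ofList (z :: xs)).radical = maximalIdeal R) :
    (Ideal.ofList (xs.map (Ideal.Quotient.mk (Ideal.span {z})))).radical =
      maximalIdeal (R ⧸ Ideal.span {z}) := by
  have hloc : IsLocalHom (Ideal.Quotient.mk (Ideal.span {z})) :=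
    .of_surjective _ Ideal.Quotient.mk_surjective
  have hinj := Ideal.comap_injective_of_surjective (Ideal.Quotient.mk (Ideal.span {z}))
    Ideal.Quotient.mk_surjective
  apply hinj
  have h2 : (maximalIdeal (R ⧸ Ideal.span {z})).comap (Ideal.Quotient.mk (Ideal.span {z})) =
      maximalIdeal R := ((local_hom_TFAE (Ideal.Quotient.mk (Ideal.span {z}))).out 0 4).1 hloc
  rw [h2, ← h, Ideal.comap_radical, ← Ideal.map_ofList,
    Ideal.comap_map_of_surjective _ Ideal.Quotient.mk_surjective, ← RingHom.ker_eq_comap_bot,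
    Ideal.mk_ker, Ideal.ofList_cons, sup_comm]

/-- On a derived complete module over a Noetherian local ring, if one system of parameters is
weakly regular then all of them are. -/
theorem isWeaklyRegular_of_isSOP (n : ℕ) {R : Type*} [CommRing R] [IsNoetherianRing R]
    [IsLocalRing R] {M : Type*} [AddCommGroup M] [Module R M]
    (hM : ∀ a ∈ maximalIdeal R, IsDC a M) (hn : (n : ℕ∞) ≤ (maximalIdeal R).height)
    {xs ys : List R} (hxl : xs.length = n) (hyl : ys.length = n)
    (hx : (Ideal.ofList xs).radical = maximalIdeal R)
    (hy : (Ideal.ofList ys).radical = maximalIdeal R)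
    (hreg : IsWeaklyRegular M xs) : IsWeaklyRegular M ys := by
  induction n generalizing R M with
  | zero =>
    rw [List.length_eq_zero_iff] at hxl hyl
    rw [hyl]; exact .nil R M
  | succ n ih =>
    obtain ⟨xs, a, rfl⟩ : ∃ l a, xs = l ++ [a] := by
      rcases List.eq_nil_or_concat xs with rfl | ⟨l, a, rfl⟩
      · simp at hxl
      · exact ⟨l, a, by simp⟩
    obtain ⟨ys, b, rfl⟩ : ∃ l a, ys = l ++ [a] := by
      rcases List.eq_nil_or_concat ys with rfl | ⟨l, a, rfl⟩
      · simp at hyl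
      · exact ⟨l, a, by simp⟩
    have hxl' : xs.length = n := by simpa using hxl
    have hyl' : ys.length = n := by simpa using hyl
    have hlt : (n : ℕ∞) < (maximalIdeal R).height :=
      lt_of_lt_of_le (by exact_mod_cast Nat.lt_succ_self n) hn
    obtain ⟨z, hz, hzx, hzy⟩ := exists_common_parameter (xs := xs) (ys := ys)
      (by rwa [hxl']) (by rwa [hyl'])
    have hx' := radical_exchange hx hz hzx
    have hy' := radical_exchange hy hz hzy
    have hsub : ∀ l : List R, (Ideal.ofList l).radical = maximalIdeal R →
        ∀ c ∈ l, IsDC c M := fun l hl c hc =>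
      hM c (hl ▸ Ideal.le_radical (Ideal.subset_span hc))
    have hax : a ∈ maximalIdeal R := hx ▸ Ideal.le_radical (Ideal.subset_span (by simp))
    have hby : b ∈ maximalIdeal R := hy ▸ Ideal.le_radical (Ideal.subset_span (by simp))
    have hx1 : IsWeaklyRegular M (xs ++ [z]) := isWeaklyRegular_exchange hreg (by rwa [hx'])
    have hpx : (xs ++ [z]).Perm (z :: xs) := List.perm_append_singleton z xs
    have hpy : (ys ++ [z]).Perm (z :: ys) := List.perm_append_singleton z ys
    have hperm : ∀ l l' : List R, l.Perm l' → Ideal.ofList l = Ideal.ofList l' := fun l l' h => by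
      unfold Ideal.ofList; congr 1; ext x; exact h.mem_iff
    have hx2 : IsWeaklyRegular M (z :: xs) := isWeaklyRegular_perm (hsub _ hx') hx1 hpx
    rw [hperm _ _ hpx] at hx'
    rw [hperm _ _ hpy] at hy'
    rw [isWeaklyRegular_cons_iff'] at hx2
    have : Nontrivial (R ⧸ Ideal.span {z}) := Ideal.Quotient.nontrivial_iff.2 (by
      rwa [Ne, Ideal.span_singleton_eq_top])
    have : IsLocalRing (R ⧸ Ideal.span {z}) :=
      .of_surjective' (Ideal.Quotient.mk _) Ideal.Quotient.mk_surjective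
    have hloc : IsLocalHom (Ideal.Quotient.mk (Ideal.span {z})) :=
      .of_surjective _ Ideal.Quotient.mk_surjective
    have hmap : (maximalIdeal R).map (Ideal.Quotient.mk (Ideal.span {z})) =
        maximalIdeal (R ⧸ Ideal.span {z}) := by
      have h2 : (maximalIdeal (R ⧸ Ideal.span {z})).comap (Ideal.Quotient.mk (Ideal.span {z})) =
        maximalIdeal R := ((local_hom_TFAE (Ideal.Quotient.mk (Ideal.span {z}))).out 0 4).1 hloc
      rw [← h2, Ideal.map_comap_of_surjective _ Ideal.Quotient.mk_surjective]
    have hy2 : IsWeaklyRegular (QuotSMulTop z M) (ys.map (Ideal.Quotient.mk (Ideal.span {z}))) := by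
      refine ih (R := R ⧸ Ideal.span {z}) (M := QuotSMulTop z M) ?_ ?_ (by simpa using hxl')
        (by simpa using hyl') (radical_map_quotient hx') (radical_map_quotient hy') hx2.2
      · intro a ha
        obtain ⟨a, rfl⟩ := Ideal.Quotient.mk_surjective a
        have ha' : a ∈ maximalIdeal R := by
          by_contra hu
          rw [notMem_maximalIdeal] at hu
          exact (mem_maximalIdeal _).1 ha (hu.map _)
        have := (hM a ha').quotSMulTop z
        constructor
        · intro u v huv
          exact this.1 huv
        · intro u
          exact this.2 u
      · have := Ideal.height_le_height_add_one_of_mem hz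
        rw [hmap] at this
        have h3 := hn.trans this
        push_cast at h3
        exact (ENat.add_le_add_iff_right (by simp)).1 h3
    have hy3 : IsWeaklyRegular M (z :: ys) := by
      rw [isWeaklyRegular_cons_iff']
      exact ⟨hx2.1, hy2⟩
    have hy4 : IsWeaklyRegular M (ys ++ [z]) := isWeaklyRegular_perm (hsub _ hy') hy3 hpy.symm
    exact isWeaklyRegular_exchange hy4 (by rwa [hy])

end BigCM

namespace BigCM

section WR

variable {S : Type*} [CommRing S]

/-- `IsRegMod I a`: the element `a` is a nonzerodivisor modulo the ideal `I`. -/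
def IsRegMod (I : Ideal S) (a : S) : Prop := ∀ z, a * z ∈ I → z ∈ I

/-- `WR I l`: the list `l` is weakly regular modulo the ideal `I`. -/
def WR : Ideal S → List S → Prop
  | _, [] => True
  | I, a :: l => IsRegMod I a ∧ WR (I ⊔ Ideal.span {a}) l

lemma mem_sup_span {I : Ideal S} {a z : S} :
    z ∈ I ⊔ Ideal.span {a} ↔ ∃ c, z - a * c ∈ I := by
  rw [sup_comm, Submodule.mem_sup]
  constructor
  · rintro ⟨y, hy, w, hw, rfl⟩
    obtain ⟨c, rfl⟩ := Ideal.mem_span_singleton'.1 hy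
    exact ⟨c, by simpa [mul_comm] using hw⟩
  · rintro ⟨c, hc⟩
    exact ⟨a * c, Ideal.mem_span_singleton'.2 ⟨c, mul_comm _ _⟩, _, hc, by ring⟩

lemma IsRegMod.iff_isSMulRegular {I : Ideal S} {a : S} :
    IsRegMod I a ↔ IsSMulRegular (S ⧸ I) a := by
  rw [isSMulRegular_quotient_iff_mem_of_smul_mem]
  rfl

lemma WR.iff_isWeaklyRegular {I : Ideal S} {l : List S} :
    WR I l ↔ RingTheory.Sequence.IsWeaklyRegular (S ⧸ I) l := by
  induction l generalizing I with
  | nil => simp [WR]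
  | cons a l ih =>
    rw [RingTheory.Sequence.isWeaklyRegular_cons_iff, WR, ih, IsRegMod.iff_isSMulRegular]
    refine and_congr_right fun _ => ?_
    let e : QuotSMulTop a (S ⧸ I) ≃ₗ[S] S ⧸ (I ⊔ Ideal.span {a}) :=
      (Submodule.quotEquivOfEq _ _ (by
        ext x
        rw [Submodule.mem_smul_pointwise_iff_exists, Submodule.mem_map]
        constructor
        · rintro ⟨y, _, rfl⟩
          obtain ⟨y, rfl⟩ := Submodule.Quotient.mk_surjective _ y
          exact ⟨a * y, Ideal.mem_span_singleton'.2 ⟨y, mul_comm _ _⟩, rfl⟩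
        · rintro ⟨y, hy, rfl⟩
          obtain ⟨c, rfl⟩ := Ideal.mem_span_singleton'.1 hy
          exact ⟨Submodule.Quotient.mk c, trivial, by
            rw [mul_comm, ← smul_eq_mul]; rfl⟩)).trans
        (Submodule.quotientQuotientEquivQuotientSup I (Ideal.span {a}))
    exact (e.isWeaklyRegular_congr l).symm

lemma WR.bot_iff_isWeaklyRegular {l : List S} :
    WR (⊥ : Ideal S) l ↔ RingTheory.Sequence.IsWeaklyRegular S l :=
  WR.iff_isWeaklyRegular.trans
    ((Submodule.quotEquivOfEqBot (⊥ : Ideal S) rfl).isWeaklyRegular_congr l)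

lemma WR.append_iff {I : Ideal S} {l₁ l₂ : List S} :
    WR I (l₁ ++ l₂) ↔ WR I l₁ ∧ WR (I ⊔ Ideal.ofList l₁) l₂ := by
  induction l₁ generalizing I with
  | nil => simp [WR]
  | cons a l ih => rw [List.cons_append, WR, ih, WR, Ideal.ofList_cons, and_assoc, sup_assoc]

lemma WR.comap_iff {T : Type*} [CommRing T] {π : S →+* T} (hπ : Function.Surjective π)
    {I : Ideal T} {l : List S} : WR (I.comap π) l ↔ WR I (l.map π) := by
  induction l generalizing I with
  | nil => simp [WR]
  | cons a l ih =>
    rw [List.map_cons, WR, WR, ← ih]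
    refine and_congr ?_ ?_
    · constructor
      · intro h z hz
        obtain ⟨z, rfl⟩ := hπ z
        exact h z (by simpa using hz)
      · intro h z hz
        exact h (π z) (by simpa using hz)
    · have : I.comap π ⊔ Ideal.span {a} = (I ⊔ Ideal.span {π a}).comap π := by
        ext z
        rw [mem_sup_span, Ideal.mem_comap, mem_sup_span]
        constructor
        · rintro ⟨c, hc⟩
          exact ⟨π c, by simpa using hc⟩
        · rintro ⟨c, hc⟩
          obtain ⟨c, rfl⟩ := hπ c
          exact ⟨c, by simpa using hc⟩
      rw [this]

/-- The first element of a weakly regular sequence is regular modulo the others. -/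
lemma WR.swap {I : Ideal S} {a c : S} {l : List S} (h : WR I (a :: c :: l)) :
    WR (I ⊔ Ideal.span {c}) (a :: l) := by
  obtain ⟨h1, h2, h3⟩ := h
  refine ⟨fun z hz => ?_, ?_⟩
  · obtain ⟨y, hy⟩ := mem_sup_span.1 hz
    have h4 : c * y ∈ I ⊔ Ideal.span {a} := mem_sup_span.2 ⟨z, by
      have := I.neg_mem hy; ring_nf at this ⊢; exact this⟩
    obtain ⟨w, hw⟩ := mem_sup_span.1 (h2 y h4)
    refine mem_sup_span.2 ⟨w, h1 _ ?_⟩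
    have : a * (z - c * w) = (a * z - c * y) + c * (y - a * w) := by ring
    rw [this]
    exact I.add_mem hy (I.mul_mem_left _ hw)
  · rw [sup_right_comm]; exact h3

lemma WR.isRegMod_sup_ofList {I : Ideal S} {a : S} {l : List S} (h : WR I (a :: l)) :
    IsRegMod (I ⊔ Ideal.ofList l) a := by
  induction l generalizing I with
  | nil => simpa using h.1
  | cons c l ih => rw [Ideal.ofList_cons, ← sup_assoc]; exact ih h.swap

lemma IsRegMod.pow {I : Ideal S} {a : S} (h : IsRegMod I a) (n : ℕ) : IsRegMod I (a ^ n) := by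
  induction n with
  | zero => intro z hz; simpa using hz
  | succ n ih =>
    intro z hz
    exact h _ (ih _ (by rwa [pow_succ, mul_assoc] at hz))

lemma isRegMod_sup_span_pow {I : Ideal S} {a c : S} (ha : IsRegMod I a)
    (hc : IsRegMod (I ⊔ Ideal.span {a}) c) (n : ℕ) : IsRegMod (I ⊔ Ideal.span {a ^ n}) c := by
  induction n with
  | zero => intro z _; simp
  | succ n ih =>
    intro z hz
    obtain ⟨w, hw⟩ := mem_sup_span.1 hz
    obtain ⟨y, hy⟩ := mem_sup_span.1 (hc z (mem_sup_span.2 ⟨a ^ n * w, by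
      rwa [← mul_assoc, ← pow_succ']⟩))
    have h1 : a * (c * y - a ^ n * w) ∈ I := by
      have : a * (c * y - a ^ n * w) = (c * z - a ^ (n + 1) * w) - c * (z - a * y) := by ring
      rw [this]
      exact I.sub_mem hw (I.mul_mem_left _ hy)
    obtain ⟨v, hv⟩ := mem_sup_span.1 (ih y (mem_sup_span.2 ⟨w, ha _ h1⟩))
    refine mem_sup_span.2 ⟨v, ?_⟩
    have : z - a ^ (n + 1) * v = (z - a * y) + a * (y - a ^ n * v) := by ring
    rw [this]
    exact I.add_mem hy (I.mul_mem_left _ hv)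

lemma WR.tail_sup_span_pow {I : Ideal S} {a : S} {l : List S} (h : WR I (a :: l)) (n : ℕ) :
    WR (I ⊔ Ideal.span {a ^ n}) l := by
  induction l generalizing I with
  | nil => trivial
  | cons c l ih =>
    refine ⟨isRegMod_sup_span_pow h.1 h.2.1 n, ?_⟩
    rw [sup_right_comm]
    exact ih h.swap

lemma WR.pow {I : Ideal S} {l : List S} (h : WR I l) (n : ℕ) : WR I (l.map (· ^ n)) := by
  induction l generalizing I with
  | nil => trivial
  | cons a l ih => exact ⟨h.1.pow n, ih (h.tail_sup_span_pow n)⟩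

/-- If `A/(l) → B/(l)` is injective and `l` is weakly regular on `B`, then
`A/(lⁿ) → B/(lⁿ)` is injective. -/
lemma mem_of_map_mem_pow {A B : Type*} [CommRing A] [CommRing B] (φ : A →+* B) {I : Ideal B}
    {J : Ideal A} {l : List A} (hJ : J.map φ ≤ I) (hl : WR I (l.map φ))
    (h : ∀ c, φ c ∈ I ⊔ Ideal.ofList (l.map φ) → c ∈ J ⊔ Ideal.ofList l) (n : ℕ) {c : A}
    (hc : φ c ∈ I ⊔ Ideal.ofList ((l.map φ).map (· ^ n))) :
    c ∈ J ⊔ Ideal.ofList (l.map (· ^ n)) := by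
  induction l generalizing I J with
  | nil => exact h c hc
  | cons a l ih =>
    simp only [List.map_cons, Ideal.ofList_cons, ← sup_assoc] at *
    have hJl : (J ⊔ Ideal.ofList l).map φ ≤ I ⊔ Ideal.ofList (l.map φ) := by
      rw [Ideal.map_sup, Ideal.map_ofList]
      exact sup_le_sup_right hJ _
    have key : ∀ n c, φ c ∈ (I ⊔ Ideal.ofList (l.map φ)) ⊔ Ideal.span {φ a ^ n} →
        c ∈ (J ⊔ Ideal.ofList l) ⊔ Ideal.span {a ^ n} := by
      intro n
      induction n with
      | zero => intro c _; simp
      | succ n ihn =>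
        intro c hc
        obtain ⟨w, hw⟩ := mem_sup_span.1 hc
        have h1 : φ c ∈ (I ⊔ Ideal.ofList (l.map φ)) ⊔ Ideal.span {φ a} :=
          mem_sup_span.2 ⟨φ a ^ n * w, by rwa [← mul_assoc, ← pow_succ']⟩
        rw [sup_right_comm] at h1
        have h2 := h c h1
        rw [sup_right_comm] at h2
        obtain ⟨x, hx⟩ := mem_sup_span.1 h2
        have hx' : φ (c - a * x) ∈ I ⊔ Ideal.ofList (l.map φ) := hJl (Ideal.mem_map_of_mem φ hx)
        have h3 : φ a * (φ x - φ a ^ n * w) ∈ I ⊔ Ideal.ofList (l.map φ) := by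
          have : φ a * (φ x - φ a ^ n * w) = (φ c - φ a ^ (n + 1) * w) - φ (c - a * x) := by
            simp only [map_sub, map_mul]; ring
          rw [this]
          exact Ideal.sub_mem _ hw hx'
        obtain ⟨v, hv⟩ := mem_sup_span.1
          (ihn x (mem_sup_span.2 ⟨w, hl.isRegMod_sup_ofList _ h3⟩))
        refine mem_sup_span.2 ⟨v, ?_⟩
        have : c - a ^ (n + 1) * v = (c - a * x) + a * (x - a ^ n * v) := by ring
        rw [this]
        exact Ideal.add_mem _ hx (Ideal.mul_mem_left _ _ hv)
    refine ih (I := I ⊔ Ideal.span {φ a ^ n}) (J := J ⊔ Ideal.span {a ^ n}) ?_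
      (hl.tail_sup_span_pow n) ?_ hc
    · rw [Ideal.map_sup, Ideal.map_span, Set.image_singleton, map_pow]
      exact sup_le_sup_right hJ _
    · intro c hc
      rw [sup_right_comm] at hc ⊢
      exact key n c hc

end WR

end BigCM

namespace BigCM

section

variable {S : Type*} [CommRing S]

lemma WR.iff_forall {I : Ideal S} {l : List S} :
    WR I l ↔ ∀ l₁ a l₂, l = l₁ ++ a :: l₂ → IsRegMod (I ⊔ Ideal.ofList l₁) a := by
  constructor
  · rintro h l₁ a l₂ rfl
    exact (WR.append_iff.1 h).2.1
  · intro h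
    induction l generalizing I with
    | nil => trivial
    | cons b l ih =>
      refine ⟨by simpa using h [] b l rfl, ih fun l₁ a l₂ hl => ?_⟩
      have := h (b :: l₁) a l₂ (by rw [hl]; rfl)
      rwa [Ideal.ofList_cons, ← sup_assoc] at this

/-- Weak regularity of finite initial segments of a sequence implies, by exchanging the order,
that an element is regular modulo the whole sequence. -/
lemma isRegMod_sup_span_range {I : Ideal S} {a : S} {ρ : ℕ → S}
    (h : ∀ n, WR I (a :: (List.range n).map ρ)) :
    IsRegMod (I ⊔ Ideal.span (Set.range ρ)) a := by
  have hmono : Monotone fun n => I ⊔ Ideal.ofList ((List.range n).map ρ) := by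
    refine monotone_nat_of_le_succ fun n => sup_le_sup_left ?_ _
    rw [List.range_succ, List.map_append, Ideal.ofList_append]
    exact le_sup_left
  have hsup : I ⊔ Ideal.span (Set.range ρ) =
      ⨆ n, (I ⊔ Ideal.ofList ((List.range n).map ρ)) := by
    apply le_antisymm
    · refine sup_le (le_iSup_of_le 0 le_sup_left) (Ideal.span_le.2 ?_)
      rintro _ ⟨n, rfl⟩
      refine (le_iSup (fun n => I ⊔ Ideal.ofList ((List.range n).map ρ)) (n + 1)) ?_
      exact Ideal.mem_sup_right (Ideal.subset_span (List.mem_map.2 ⟨n, by simp, rfl⟩))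
    · refine iSup_le fun n => sup_le_sup_left (Ideal.span_mono ?_) _
      intro x hx
      obtain ⟨m, -, rfl⟩ := List.mem_map.1 hx
      exact ⟨m, rfl⟩
  intro z hz
  rw [hsup, Submodule.mem_iSup_of_directed _ hmono.directed_le] at hz ⊢
  obtain ⟨n, hn⟩ := hz
  exact ⟨n, (h n).isRegMod_sup_ofList z hn⟩

end

section PRadical

variable {E Q : Type*} [CommRing E] [CommRing Q] (p : ℕ) [Fact p.Prime] [CharP E p] [CharP Q p]
  (ι : E →+* Q)

lemma pow_mem_ofList_map_pow {l : List E} {N k : ℕ} {e : E}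
    (he : e ∈ Ideal.ofList (l.map (· ^ p ^ N))) :
    e ^ p ^ k ∈ Ideal.ofList (l.map (· ^ p ^ (N + k))) := by
  have := Ideal.mem_map_of_mem (iterateFrobenius E p k) he
  rw [Ideal.map_ofList, List.map_map] at this
  have h2 : l.map (iterateFrobenius E p k ∘ (· ^ p ^ N)) = l.map (· ^ p ^ (N + k)) :=
    List.map_congr_left fun x _ => by simp [iterateFrobenius_def, pow_add, pow_mul]
  rwa [h2, iterateFrobenius_def] at this

variable [PerfectRing Q p] [IsPRadical ι p]

lemma mem_ofList_map_iff {l : List E} {z : Q} :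
    z ∈ Ideal.ofList (l.map ι) ↔
      ∃ N e, ι e = z ^ p ^ N ∧ e ∈ Ideal.ofList (l.map (· ^ p ^ N)) := by
  constructor
  · induction l generalizing z with
    | nil => intro hz; exact ⟨0, 0, by simpa [eq_comm] using hz, by simp⟩
    | cons a l ih =>
      intro hz
      rw [List.map_cons, Ideal.ofList_cons, sup_comm] at hz
      obtain ⟨c, hc⟩ := mem_sup_span.1 hz
      obtain ⟨N, e, he, hel⟩ := ih hc
      obtain ⟨N', e', he'⟩ := IsPRadical.pow_mem ι p c
      refine ⟨N + N', e ^ p ^ N' + a ^ p ^ (N + N') * e' ^ p ^ N, ?_, ?_⟩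
      · have h1 : (z - ι a * c) ^ p ^ (N + N') = z ^ p ^ (N + N') - (ι a * c) ^ p ^ (N + N') :=
          sub_pow_char_pow _ _ _
        rw [map_add, map_pow, he, map_mul, map_pow, map_pow, he', ← pow_mul, ← pow_mul, ← pow_add,
          ← pow_add, h1, add_comm N' N, mul_pow]
        ring
      · rw [List.map_cons, Ideal.ofList_cons, sup_comm]
        refine mem_sup_span.2 ⟨e' ^ p ^ N, ?_⟩
        rw [add_sub_cancel_right]
        exact pow_mem_ofList_map_pow p hel
  · rintro ⟨N, e, he, hel⟩
    have h1 := Ideal.mem_map_of_mem ι hel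
    rw [he, Ideal.map_ofList, List.map_map] at h1
    have h2 : Ideal.ofList (l.map (ι ∘ (· ^ p ^ N))) =
        (Ideal.ofList (l.map ι)).map (iterateFrobeniusEquiv Q p N).toRingHom := by
      rw [Ideal.map_ofList, List.map_map]
      congr 1
      refine List.map_congr_left fun x _ => ?_
      simp [iterateFrobenius_def]
    rw [h2] at h1
    have h3 := Ideal.mem_map_of_mem (iterateFrobeniusEquiv Q p N).symm.toRingHom h1
    rw [Ideal.map_map] at h3
    have h4 : (iterateFrobeniusEquiv Q p N).symm.toRingHom.comp
        (iterateFrobeniusEquiv Q p N).toRingHom = RingHom.id Q := by ext; simp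
    rw [h4, Ideal.map_id] at h3
    convert h3
    exact ((iterateFrobeniusEquiv Q p N).symm_apply_apply z).symm

end PRadical

lemma WR.map_isPRadical {E Q : Type*} [CommRing E] [CommRing Q] (p : ℕ) [Fact p.Prime]
    [CharP E p] [CharP Q p] (ι : E →+* Q) [PerfectRing Q p] [IsPRadical ι p]
    {l : List E} (h : WR ⊥ l) : WR ⊥ (l.map ι) := by
  rw [WR.iff_forall] 
  intro l₁' a' l₂' hl
  obtain ⟨l₁, l₂', rfl, rfl, hl₂⟩ := List.map_eq_append_iff.1 hl
  obtain ⟨a, l₂, rfl, rfl, rfl⟩ := List.map_eq_cons_iff.1 hl₂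
  intro z hz
  rw [bot_sup_eq, mem_ofList_map_iff p] at hz ⊢
  obtain ⟨N, e, he, hel⟩ := hz
  obtain ⟨N', e', he'⟩ := IsPRadical.pow_mem ι p z
  have h0 : ι (a ^ p ^ (N + N') * e' ^ p ^ N - e ^ p ^ N') = 0 := by
    rw [map_sub, map_mul, map_pow, map_pow, map_pow, he, he', ← pow_mul, ← pow_mul, ← pow_add,
      ← pow_add, mul_pow, add_comm N' N, sub_self]
  obtain ⟨k, hk⟩ := (mem_pNilradical.1 (IsPRadical.ker_le ι p h0))
  rw [sub_pow_char_pow, sub_eq_zero, mul_pow, ← pow_mul, ← pow_mul, ← pow_mul, ← pow_add, ← pow_add,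
    ← pow_add] at hk
  refine ⟨N' + N + k, e' ^ p ^ (N + k), ?_, ?_⟩
  · rw [map_pow, he', ← pow_mul, ← pow_add, add_assoc]
  · have h1 := WR.iff_forall.1 (h.pow (p ^ (N + N' + k))) (l₁.map (· ^ p ^ (N + N' + k)))
      (a ^ p ^ (N + N' + k)) (l₂.map (· ^ p ^ (N + N' + k))) (by simp)
    have h2 := h1 (e' ^ p ^ (N + k)) (by
      rw [hk, bot_sup_eq, add_assoc]
      exact pow_mem_ofList_map_pow p hel)
    rwa [bot_sup_eq, add_comm N N'] at h2

lemma ofList_map_of_ne_top {p : ℕ} [Fact p.Prime] {E K : Type*} [CommRing E] [CharP E p]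
    [CommRing K] [Nontrivial K] [CharP K p] [PerfectRing K p] {l : List E} (χ : E →+* K)
    (hχ : ∀ a ∈ l, χ a = 0) : Ideal.ofList (l.map (PerfectClosure.of E p)) ≠ ⊤ := by
  intro h
  have h1 : Ideal.ofList (l.map (PerfectClosure.of E p)) ≤
      RingHom.ker (PerfectClosure.lift E p K χ) := by
    refine Ideal.span_le.2 fun x hx => ?_
    obtain ⟨a, ha, rfl⟩ := List.mem_map.1 hx
    rw [SetLike.mem_coe, RingHom.mem_ker, ← hχ a ha]
    exact RingHom.congr_fun ((PerfectClosure.lift E p K).symm_apply_apply χ) a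
  rw [h, top_le_iff] at h1
  exact RingHom.ker_ne_top _ h1

end BigCM

namespace BigCM

open WittVector

/-- `PerfdGood p B L`: the ring `B` is of the form `WittVector p P ⧸ (p - [t])` for a perfect ring
`P` of characteristic `p`, and `p, L` come from Teichmüller lifts of a weakly regular sequence
`t, xs` on `P` generating a proper ideal. -/
def PerfdGood (p : ℕ) [Fact p.Prime] (B : Type u) [CommRing B] (L : List B) : Prop :=
  ∃ (P : Type u) (_ : CommRing P) (_ : CharP P p) (_ : PerfectRing P p) (t : P) (xs : List P)
    (π : WittVector p P →+* B), Function.Surjective π ∧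
      RingHom.ker π = Ideal.span {(p : WittVector p P) - teichmuller p t} ∧
      L = xs.map (fun x => π (teichmuller p x)) ∧ WR ⊥ (t :: xs) ∧ Ideal.ofList (t :: xs) ≠ ⊤

section Witt

variable {p : ℕ} [Fact p.Prime] {P : Type*} [CommRing P] [CharP P p] [PerfectRing P p]

lemma constantCoeff_teichmuller {P : Type*} [CommRing P] (a : P) :
    (constantCoeff : WittVector p P →+* P) (teichmuller p a) = a :=
  teichmuller_coeff_zero p a

lemma mem_span_p_iff (z : WittVector p P) :
    z ∈ Ideal.span {(p : WittVector p P)} ↔ (constantCoeff : WittVector p P →+* P) z = 0 :=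
  mem_span_p_iff_coeff_zero_eq_zero z

lemma span_sup_span_p (t : P) :
    Ideal.span {(p : WittVector p P) - teichmuller p t} ⊔ Ideal.span {(p : WittVector p P)} =
      (Ideal.span {t}).comap (constantCoeff : WittVector p P →+* P) := by
  ext z
  rw [mem_sup_span, Ideal.mem_comap, Ideal.mem_span_singleton']
  constructor
  · rintro ⟨c, hc⟩
    obtain ⟨d, hd⟩ := Ideal.mem_span_singleton'.1 hc
    refine ⟨-constantCoeff d, ?_⟩
    have := congrArg (constantCoeff : WittVector p P →+* P) hd
    simp only [map_mul, map_sub, map_natCast, CharP.cast_eq_zero] at this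
    rw [constantCoeff_teichmuller] at this
    linear_combination this
  · rintro ⟨a, ha⟩
    have : z + ((p : WittVector p P) - teichmuller p t) * teichmuller p a ∈
        Ideal.span {(p : WittVector p P)} := by
      rw [mem_span_p_iff]
      simp only [map_add, map_mul, map_sub, map_natCast, CharP.cast_eq_zero,
        constantCoeff_teichmuller, ← ha]
      ring
    obtain ⟨c, hc⟩ := Ideal.mem_span_singleton'.1 this
    refine ⟨c, Ideal.mem_span_singleton'.2 ⟨-teichmuller p a, ?_⟩⟩
    linear_combination hc

lemma isRegMod_p (t : P) (ht : IsRegMod ⊥ t) :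
    IsRegMod (Ideal.span {(p : WittVector p P) - teichmuller p t}) (p : WittVector p P) := by
  intro z hz
  obtain ⟨w, hw⟩ := Ideal.mem_span_singleton'.1 hz
  have h0 : w ∈ Ideal.span {(p : WittVector p P)} := by
    rw [mem_span_p_iff]
    refine ht _ ?_
    have := congrArg (constantCoeff : WittVector p P →+* P) hw
    simp only [map_mul, map_sub, map_natCast, CharP.cast_eq_zero, constantCoeff_teichmuller] at this
    change t * constantCoeff w = 0
    linear_combination -this
  obtain ⟨v, rfl⟩ := Ideal.mem_span_singleton'.1 h0
  refine Ideal.mem_span_singleton'.2 ⟨v, ?_⟩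
  rw [← sub_eq_zero]
  apply eq_zero_of_p_mul_eq_zero
  linear_combination hw

end Witt

section PerfdGood

variable {p : ℕ} [Fact p.Prime] {B : Type u} [CommRing B] {L : List B}

lemma constantCoeff_map_teichmuller {P : Type*} [CommRing P] (xs : List P) :
    (xs.map (teichmuller p)).map (constantCoeff : WittVector p P →+* P) = xs := by
  rw [List.map_map]
  conv_rhs => rw [← List.map_id xs]
  exact List.map_congr_left fun a _ => teichmuller_coeff_zero p a

lemma PerfdGood.wr (h : PerfdGood p B L) : WR ⊥ ((p : B) :: L) := by
  obtain ⟨P, _, _, _, t, xs, π, hπ, hker, rfl, hwr, -⟩ := h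
  have : (p : B) :: xs.map (fun x => π (teichmuller p x)) =
      ((p : WittVector p P) :: xs.map (teichmuller p)).map π := by simp
  rw [this, ← WR.comap_iff hπ, ← RingHom.ker_eq_comap_bot, hker]
  refine ⟨isRegMod_p t hwr.1, ?_⟩
  rw [span_sup_span_p, WR.comap_iff (constantCoeff_surjective p), constantCoeff_map_teichmuller]
  simpa using hwr.2

lemma PerfdGood.ne_top (h : PerfdGood p B L) : Ideal.ofList ((p : B) :: L) ≠ ⊤ := by
  obtain ⟨P, _, _, _, t, xs, π, hπ, hker, rfl, -, hne⟩ := h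
  have : (p : B) :: xs.map (fun x => π (teichmuller p x)) =
      ((p : WittVector p P) :: xs.map (teichmuller p)).map π := by simp
  rw [this, ← Ideal.map_ofList]
  intro htop
  have h1 := congrArg (Ideal.comap π) htop
  rw [Ideal.comap_map_of_surjective _ hπ, ← RingHom.ker_eq_comap_bot, hker, Ideal.comap_top,
    Ideal.ofList_cons, sup_right_comm, sup_comm (Ideal.span _) (Ideal.span _),
    span_sup_span_p] at h1
  have h2 := congrArg (Ideal.map (constantCoeff : WittVector p P →+* P)) h1
  rw [Ideal.map_sup, Ideal.map_comap_of_surjective _ (constantCoeff_surjective p), Ideal.map_ofList,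
    constantCoeff_map_teichmuller, Ideal.map_top] at h2
  exact hne (by rw [Ideal.ofList_cons, h2])

lemma PerfdGood.exists_root (h : PerfdGood p B L) :
    ∃ ϖ : B, ϖ ^ p = p ∧ ∀ z : B, (p : B) ∣ z ^ p → ϖ ∣ z := by
  obtain ⟨P, _, _, _, t, xs, π, hπ, hker, rfl, -, -⟩ := h
  have hpt : (p : B) = π (teichmuller p t) := by
    rw [← map_natCast π, ← sub_eq_zero, ← map_sub, ← RingHom.mem_ker, hker]
    exact Ideal.mem_span_singleton_self _
  obtain ⟨s, rfl⟩ : ∃ s, s ^ p = t := (PerfectRing.bijective_frobenius (R := P) (p := p)).2 t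
  refine ⟨π (teichmuller p s), by rw [hpt, map_pow, map_pow], fun z ⟨c, hc⟩ => ?_⟩
  obtain ⟨z, rfl⟩ := hπ z
  obtain ⟨c, rfl⟩ := hπ c
  have h1 : z ^ p - p * c ∈ RingHom.ker π := by
    rw [RingHom.mem_ker, map_sub, map_pow, hc, map_mul, map_natCast, sub_self]
  rw [hker] at h1
  obtain ⟨d, hd⟩ := Ideal.mem_span_singleton'.1 h1
  have h3 := congrArg (constantCoeff : WittVector p P →+* P) hd
  simp only [map_mul, map_sub, map_natCast, CharP.cast_eq_zero, constantCoeff_teichmuller, zero_sub,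
    zero_mul, sub_zero,
    map_pow] at h3
  obtain ⟨e, he⟩ : ∃ e, e ^ p = -constantCoeff d :=
    (PerfectRing.bijective_frobenius (R := P) (p := p)).2 _
  have h4 : constantCoeff z = e * s := by
    apply (PerfectRing.bijective_frobenius (R := P) (p := p)).1
    simp only [mul_pow, he]
    linear_combination -h3
  have h5 : z - teichmuller p e * teichmuller p s ∈ Ideal.span {(p : WittVector p P)} := by
    rw [mem_span_p_iff]
    rw [map_sub, map_mul, constantCoeff_teichmuller, constantCoeff_teichmuller, h4, sub_self]
  obtain ⟨f, hf⟩ := Ideal.mem_span_singleton'.1 h5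
  have h6 : π z = π (teichmuller p e) * π (teichmuller p s) + π f * (p : B) := by
    rw [← map_natCast π, ← map_mul π f, ← map_mul π, ← map_add, hf]; congr 1; ring
  rw [h6, hpt, map_pow, map_pow]
  exact dvd_add (dvd_mul_left _ _) ((dvd_pow_self _ (Fact.out : p.Prime).ne_zero).mul_left _)

lemma PerfdGood.pow_dvd_of_isNilpotent (h : PerfdGood p B L) {z : B} (hz : IsNilpotent z) (n : ℕ) :
    (p : B) ^ n ∣ z := by
  obtain ⟨ϖ, hϖ, hdvd⟩ := h.exists_root
  have hp0 : p ≠ 0 := (Fact.out : p.Prime).ne_zero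
  have hreg : ∀ z : B, (p : B) * z = 0 → z = 0 := h.wr.1
  have key : ∀ n (z : B), (∀ n, (p : B) ^ n ∣ z ^ p) → ϖ ^ n ∣ z := by
    intro n
    induction n with
    | zero => intro z _; simp
    | succ n ih =>
      intro z hz
      obtain ⟨w, rfl⟩ := hdvd z (by simpa using hz 1)
      rw [pow_succ']
      refine mul_dvd_mul_left _ (ih w fun n => ?_)
      obtain ⟨c, hc⟩ := hz (n + 1)
      refine ⟨c, sub_eq_zero.1 (hreg _ ?_)⟩
      rw [mul_pow, hϖ] at hc
      linear_combination hc
  have key2 : ∀ k (z : B), z ^ p ^ k = 0 → ∀ n, (p : B) ^ n ∣ z := by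
    intro k
    induction k with
    | zero => intro z hz n; simp at hz; simp [hz]
    | succ k ih =>
      intro z hz n
      rw [← hϖ, ← pow_mul]
      exact key _ z (ih _ (by rw [← pow_mul, ← pow_succ', hz]))
  obtain ⟨e, he⟩ := hz
  exact key2 e z (pow_eq_zero_of_le (Nat.lt_pow_self (Fact.out : p.Prime).one_lt).le he) n

end PerfdGood

end BigCM

namespace BigCM

open MvPolynomial

section

variable {S : Type*} [CommRing S]

lemma IsRegMod.congr {I : Ideal S} {a b : S} (h : IsRegMod I a) (hab : a - b ∈ I) :
    IsRegMod I b := fun z hz => h z <| by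
  have : a * z = z * (a - b) + b * z := by ring
  rw [this]
  exact I.add_mem (I.mul_mem_left _ hab) hz

lemma IsRegMod.of_map_ringEquiv {T : Type*} [CommRing T] (e : S ≃+* T) {I : Ideal S} {a : S}
    (h : IsRegMod (I.map e) (e a)) : IsRegMod I a := fun z hz => by
  have := h (e z) (by rw [← map_mul]; exact Ideal.mem_map_of_mem _ hz)
  obtain ⟨x, hx, hxz⟩ := (Ideal.mem_map_of_equiv e _).1 this
  rwa [← e.injective hxz]

lemma isRegMod_of_monic {f : Polynomial S} (hf : f.Monic) {J : Ideal (Polynomial S)}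
    {s : Set (Polynomial S)} (hJ : J = Ideal.span s) (hs : ∀ q ∈ s, ∃ c, Polynomial.C c = q) :
    IsRegMod J f := by
  have h1 : J = (J.comap Polynomial.C).map Polynomial.C := by
    refine le_antisymm ?_ Ideal.map_comap_le
    conv_lhs => rw [hJ]
    refine Ideal.span_le.2 fun q hq => ?_
    obtain ⟨c, rfl⟩ := hs q hq
    exact Ideal.mem_map_of_mem _ (by rw [Ideal.mem_comap, hJ]; exact Ideal.subset_span hq)
  set I := J.comap Polynomial.C
  have hker (q : Polynomial S) : q ∈ J ↔ q.map (Ideal.Quotient.mk I) = 0 := by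
    rw [h1, ← Polynomial.coe_mapRingHom, ← RingHom.mem_ker, Polynomial.ker_mapRingHom,
      Ideal.mk_ker]
  intro z hz
  rw [hker] at hz ⊢
  rw [Polynomial.map_mul] at hz
  exact ((hf.map _).mul_right_eq_zero_iff).1 hz

end

section

variable {P : Type*} [CommRing P] {σ : Type*} [DecidableEq σ] (v : σ)

/-- Multivariate polynomials as univariate polynomials in the variable `v`. -/
noncomputable def isolateVar :
    MvPolynomial σ P ≃ₐ[P] Polynomial (MvPolynomial {w // w ≠ v} P) :=
  (renameEquiv P (Equiv.optionSubtypeNe v).symm).trans (optionEquivLeft P _)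

lemma isolateVar_X_self : isolateVar (P := P) v (X v) = Polynomial.X := by
  simp [isolateVar]

lemma isolateVar_of_mem_supported {q : MvPolynomial σ P} (hq : q ∈ supported P {v}ᶜ) :
    ∃ c, Polynomial.C c = isolateVar v q := by
  have : supported P {v}ᶜ ≤
      (Polynomial.CAlgHom (R := P) (A := MvPolynomial {w // w ≠ v} P)).range.comap
        (isolateVar v).toAlgHom := by
    refine Algebra.adjoin_le ?_
    rintro _ ⟨w, hw, rfl⟩
    refine ⟨X ⟨w, hw⟩, ?_⟩
    have hw' : w ≠ v := hw
    simp [isolateVar, hw']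
  exact this hq

lemma isRegMod_of_isolateVar {s : Set (MvPolynomial σ P)} (hs : ∀ q ∈ s, q ∈ supported P {v}ᶜ)
    {f : MvPolynomial σ P} (hf : (isolateVar v f).Monic) : IsRegMod (Ideal.span s) f := by
  refine IsRegMod.of_map_ringEquiv (isolateVar v).toRingEquiv ?_
  refine isRegMod_of_monic hf (Ideal.map_span _ _) ?_
  rintro _ ⟨q, hq, rfl⟩
  exact isolateVar_of_mem_supported v (hs q hq)

lemma monic_isolateVar_aeval {g : Polynomial P} (hg : g.Monic) :
    (isolateVar v (Polynomial.aeval (X v : MvPolynomial σ P) g)).Monic := by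
  have : isolateVar v (Polynomial.aeval (X v : MvPolynomial σ P) g) =
      g.map (algebraMap P (MvPolynomial {w // w ≠ v} P)) := by
    rw [← Polynomial.aeval_algHom_apply (isolateVar v), isolateVar_X_self]
    rfl
  rw [this]
  exact hg.map _

lemma monic_isolateVar_X_pow_sub {c : MvPolynomial σ P} (hc : c ∈ supported P {v}ᶜ) {n : ℕ}
    (hn : n ≠ 0) : (isolateVar v (X v ^ n - c)).Monic := by
  obtain ⟨d, hd⟩ := isolateVar_of_mem_supported v hc
  rw [map_sub, map_pow, isolateVar_X_self, ← hd]
  exact Polynomial.monic_X_pow_sub_C _ hn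

end

lemma isRegMod_C {P : Type*} [CommRing P] {σ : Type*} {I : Ideal P} {a : P} (h : IsRegMod I a) :
    IsRegMod (I.map (C : P →+* MvPolynomial σ P)) (C a) := by
  intro z hz
  rw [mem_map_C_iff] at hz ⊢
  exact fun m => h _ (by simpa using hz m)

section Relations

variable {P : Type*} [CommRing P]

lemma wr_range_map_iff {S : Type*} [CommRing S] {I : Ideal S} {ρ : ℕ → S} {n : ℕ} :
    WR I ((List.range n).map ρ) ↔
      ∀ k < n, IsRegMod (I ⊔ Ideal.ofList ((List.range k).map ρ)) (ρ k) := by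
  induction n with
  | zero => simp [WR]
  | succ n ih =>
    rw [List.range_succ, List.map_append, WR.append_iff, ih, Nat.forall_lt_succ_right]
    simp [WR]

lemma wr_relations {𝔞 : Ideal P} {g : Polynomial P} (hg : g.Monic) {c : ℕ → Polynomial P}
    {ρ : ℕ → MvPolynomial ℕ P} {n : ℕ} (hn : n ≠ 0)
    (h0 : ρ 0 - Polynomial.aeval (X 0) g ∈ 𝔞.map C)
    (hρ : ∀ j, ρ (j + 1) - (X (j + 1) ^ n - Polynomial.aeval (X 0) (c j)) ∈ 𝔞.map C) (m : ℕ) :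
    WR (𝔞.map C) ((List.range m).map ρ) := by
  obtain ⟨ρ', hρ'0, hρ'⟩ : ∃ ρ' : ℕ → MvPolynomial ℕ P, ρ' 0 = Polynomial.aeval (X 0) g ∧
      ∀ j, ρ' (j + 1) = X (j + 1) ^ n - Polynomial.aeval (X 0) (c j) :=
    ⟨fun i => i.casesOn (Polynomial.aeval (X 0) g)
      fun j => X (j + 1) ^ n - Polynomial.aeval (X 0) (c j), rfl, fun _ => rfl⟩
  have hsub (j : ℕ) : ρ j - ρ' j ∈ 𝔞.map C := by
    cases j with
    | zero => rw [hρ'0]; exact h0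
    | succ j => rw [hρ']; exact hρ j
  have hX (i j : ℕ) (h : i ≠ j) : X i ∈ supported P ({j}ᶜ : Set ℕ) :=
    Algebra.subset_adjoin (Set.mem_image_of_mem _ (Set.mem_compl_singleton_iff.2 h))
  have haux (i j : ℕ) (h : i ≠ j) (f : Polynomial P) :
      Polynomial.aeval (X i) f ∈ supported P ({j}ᶜ : Set ℕ) :=
    Algebra.adjoin_le (Set.singleton_subset_iff.2 (hX i j h))
      (Polynomial.aeval_mem_adjoin_singleton P (X i))
  have hsupp (k j : ℕ) (h : j < k) : ρ' j ∈ supported P ({k}ᶜ : Set ℕ) := by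
    cases j with
    | zero => rw [hρ'0]; exact haux _ _ h.ne _
    | succ j =>
      rw [hρ']
      exact sub_mem (pow_mem (hX _ _ h.ne) _) (haux _ _ (by omega) _)
  rw [wr_range_map_iff]
  intro k _
  have heq : 𝔞.map C ⊔ Ideal.ofList ((List.range k).map ρ) =
      Ideal.span ((C '' (𝔞 : Set P)) ∪ {x | ∃ j < k, x = ρ' j}) := by
    rw [Ideal.span_union]
    apply le_antisymm
    · refine sup_le le_sup_left (Ideal.span_le.2 fun x hx => ?_)
      obtain ⟨j, hj, rfl⟩ := List.mem_map.1 hx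
      rw [← sub_add_cancel (ρ j) (ρ' j)]
      exact add_mem (Ideal.mem_sup_left (hsub j))
        (Ideal.mem_sup_right (Ideal.subset_span ⟨j, List.mem_range.1 hj, rfl⟩))
    · refine sup_le le_sup_left (Ideal.span_le.2 ?_)
      rintro _ ⟨j, hj, rfl⟩
      rw [← sub_sub_cancel (ρ j) (ρ' j)]
      exact sub_mem (Ideal.mem_sup_right (Ideal.subset_span
        (List.mem_map.2 ⟨j, List.mem_range.2 hj, rfl⟩))) (Ideal.mem_sup_left (hsub j))
  have hkey : IsRegMod (𝔞.map C ⊔ Ideal.ofList ((List.range k).map ρ)) (ρ' k) := by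
    rw [heq]
    refine isRegMod_of_isolateVar k ?_ ?_
    · rintro _ (⟨a, -, rfl⟩ | ⟨j, hj, rfl⟩)
      · exact (supported P _).algebraMap_mem a
      · exact hsupp _ _ hj
    · cases k with
      | zero => rw [hρ'0]; exact monic_isolateVar_aeval _ hg
      | succ k => rw [hρ']; exact monic_isolateVar_X_pow_sub _ (haux _ _ (by omega) _) hn
  refine hkey.congr (Ideal.mem_sup_left ?_)
  rw [← neg_sub]
  exact neg_mem (hsub k)

lemma wr_map_C_of_relations {t : P} {xs : List P} (ht : WR ⊥ (t :: xs)) {g : Polynomial P}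
    (hg : g.Monic) {c : ℕ → Polynomial P} {ρ : ℕ → MvPolynomial ℕ P} {n : ℕ} (hn : n ≠ 0)
    (h0 : ρ 0 - Polynomial.aeval (X 0) g ∈ (Ideal.span {t}).map C)
    (hρ : ∀ j, ρ (j + 1) - (X (j + 1) ^ n - Polynomial.aeval (X 0) (c j)) ∈
      (Ideal.span {t}).map C) :
    WR (Ideal.span (Set.range ρ)) ((t :: xs).map C) := by
  rw [WR.iff_forall]
  intro l₁' a' l₂' hl
  obtain ⟨l₁, l₂', h, rfl, hl₂⟩ := List.map_eq_append_iff.1 hl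
  obtain ⟨a, l₂, rfl, rfl, rfl⟩ := List.map_eq_cons_iff.1 hl₂
  rw [sup_comm, ← Ideal.map_ofList]
  refine isRegMod_sup_span_range fun m => ⟨?_, ?_⟩
  · have := WR.iff_forall.1 ht _ _ _ h
    rw [bot_sup_eq] at this
    exact isRegMod_C this
  · have : (Ideal.ofList l₁).map C ⊔ Ideal.span {(C a : MvPolynomial ℕ P)} =
        (Ideal.ofList (l₁ ++ [a])).map C := by
      rw [Ideal.ofList_append, Ideal.map_sup, Ideal.ofList_singleton, Ideal.map_span C {a},
        Set.image_singleton]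
    rw [this]
    have hle : (Ideal.span {t}).map C ≤
        (Ideal.ofList (l₁ ++ [a])).map (C : P →+* MvPolynomial ℕ P) := by
      refine Ideal.map_mono ((Ideal.span_singleton_le_iff_mem _).2 (Ideal.subset_span ?_))
      cases l₁ with
      | nil => simp at h; simp [h.1]
      | cons b l₁ => simp at h; simp [h.1]
    exact wr_relations hg hn (hle h0) (fun j => hle (hρ j)) m

end Relations

end BigCM

namespace BigCM

open WittVector MvPolynomial

lemma charP_of_natCast_eq_zero {p : ℕ} [hp : Fact p.Prime] {E : Type*} [CommRing E] [Nontrivial E]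
    (h : (p : E) = 0) : CharP E p :=
  (CharP.charP_iff_prime_eq_zero hp.out).2 h

lemma natCast_eq_zero_of_hom {p : ℕ} {P E : Type*} [CommRing P] [CharP P p] [CommRing E]
    (f : P →+* E) : (p : E) = 0 := by
  rw [← map_natCast f, CharP.cast_eq_zero, map_zero]

section

variable {p : ℕ} [Fact p.Prime] {P : Type u} [CommRing P]

/-- The value of a polynomial over `W(P)` at the Teichmüller lift of an indeterminate. -/
noncomputable def evalTeich (g : Polynomial (WittVector p P)) {Q : Type*} [CommRing Q] (f : P →+* Q)
    (x : Q) : WittVector p Q :=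
  g.eval₂ (WittVector.map f) (teichmuller p x)

lemma map_evalTeich (g : Polynomial (WittVector p P)) {Q R : Type*} [CommRing Q] [CommRing R]
    (f : P →+* Q) (h : Q →+* R) (x : Q) :
    WittVector.map h (evalTeich g f x) = evalTeich g (h.comp f) (h x) := by
  rw [evalTeich, Polynomial.hom_eval₂, evalTeich, map_teichmuller]
  congr 1

lemma constantCoeff_evalTeich (g : Polynomial (WittVector p P)) {Q : Type*} [CommRing Q]
    (f : P →+* Q) (x : Q) :
    (evalTeich g f x).coeff 0 = (g.map WittVector.constantCoeff).eval₂ f x := by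
  change (constantCoeff : WittVector p Q →+* Q) _ = _
  rw [evalTeich, Polynomial.hom_eval₂, constantCoeff_teichmuller, Polynomial.eval₂_map]
  congr 1

variable (g : Polynomial (WittVector p P)) (t : P)

/-- The generic Witt vector. -/
noncomputable def genericWitt (p : ℕ) (P : Type u) [CommRing P] : WittVector p (MvPolynomial ℕ P) :=
  WittVector.mk p fun j => X (j + 1)

/-- The Witt vector `g([X₀]) + [t] w`, with `w` the generic Witt vector. -/
noncomputable def genericRel : WittVector p (MvPolynomial ℕ P) :=
  evalTeich g C (X 0) + teichmuller p (C t) * genericWitt p P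

/-- The relations expressing that `g([X₀]) + [t] w = p w`. -/
noncomputable def rootRel : ℕ → MvPolynomial ℕ P
  | 0 => (genericRel g t).coeff 0
  | j + 1 => X (j + 1) ^ p - (genericRel g t).coeff (j + 1)

lemma map_genericRel {R : Type*} [CommRing R] (f : MvPolynomial ℕ P →+* R) (hf : f (C t) = 0)
    (j : ℕ) : f ((genericRel g t).coeff j) = (evalTeich g (f.comp C) (f (X 0))).coeff j := by
  rw [← map_evalTeich, ← WittVector.map_coeff, genericRel, map_add, map_mul, map_teichmuller, hf,
    teichmuller_zero, zero_mul, add_zero]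

lemma genericRel_sub_mem (j : ℕ) :
    (genericRel g t).coeff j -
      Polynomial.aeval (X 0) ((evalTeich g Polynomial.C Polynomial.X).coeff j) ∈
      (Ideal.span {t}).map C := by
  rw [← Ideal.Quotient.eq]
  have h0 : Ideal.Quotient.mk ((Ideal.span {t}).map (C : P →+* MvPolynomial ℕ P)) (C t) = 0 :=
    Ideal.Quotient.eq_zero_iff_mem.2 (Ideal.mem_map_of_mem _ (Ideal.mem_span_singleton_self t))
  rw [map_genericRel _ _ _ h0, ← map_evalTeich, WittVector.map_coeff]
  congr 1
  have := map_evalTeich g Polynomial.C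
    (Polynomial.aeval (X 0 : MvPolynomial ℕ P) : Polynomial P →ₐ[P] _).toRingHom Polynomial.X
  have h2 := congrArg (fun v => WittVector.coeff v j) this
  simp only [WittVector.map_coeff] at h2
  refine Eq.trans ?_ h2.symm
  congr 2
  · ext; simp
  · simp

lemma wr_rootRel [CharP P p] {t : P} {xs : List P} (ht : WR ⊥ (t :: xs))
    {g : Polynomial (WittVector p P)} (hg : g.Monic) :
    WR (Ideal.span (Set.range (rootRel g t))) ((t :: xs).map C) := by
  refine wr_map_C_of_relations ht (g := (evalTeich g Polynomial.C Polynomial.X).coeff 0)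
    (c := fun j => (evalTeich g Polynomial.C Polynomial.X).coeff (j + 1)) ?_
    (Fact.out : p.Prime).ne_zero (genericRel_sub_mem g t 0) fun j => ?_
  · rw [constantCoeff_evalTeich, Polynomial.eval₂_C_X]
    exact hg.map _
  · have := neg_mem (genericRel_sub_mem g t (j + 1))
    convert this using 1
    simp only [rootRel]
    ring

lemma exists_hom_rootRel {K : Type*} [Field K] [IsAlgClosed K] [CharP K p] (κ : P →+* K)
    {t : P} (ht : κ t = 0) {g : Polynomial (WittVector p P)} (hg : g.Monic)
    (hdeg : g.natDegree ≠ 0) :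
    ∃ ev : MvPolynomial ℕ P →+* K, ev.comp C = κ ∧ ∀ j, ev (rootRel g t j) = 0 := by
  have hP : Nontrivial P := κ.domain_nontrivial
  have hW : Nontrivial (WittVector p P) := inferInstance
  obtain ⟨α, hα⟩ := IsAlgClosed.exists_root ((g.map WittVector.constantCoeff).map κ) (by
    rw [(hg.map _).degree_map, hg.degree_map, Polynomial.degree_eq_natDegree hg.ne_zero]
    exact_mod_cast hdeg)
  have hroot (a : K) : ∃ b, b ^ p = a := IsAlgClosed.exists_pow_nat_eq a (Fact.out : p.Prime).pos
  choose r hr using hroot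
  let ev : MvPolynomial ℕ P →+* K := eval₂Hom κ fun i =>
    i.casesOn α fun j => r ((evalTeich g κ α).coeff (j + 1))
  have h1 : ev.comp C = κ := by ext a; simp [ev]
  have h2 : ev (X 0) = α := by simp [ev]
  have h3 (j : ℕ) : ev (X (j + 1)) = r ((evalTeich g κ α).coeff (j + 1)) := by simp [ev]
  have h4 : ev (C t) = 0 := by rw [← ht, ← h1]; rfl
  refine ⟨ev, h1, fun j => ?_⟩
  cases j with
  | zero =>
    rw [rootRel, map_genericRel _ _ _ h4, h1, h2, constantCoeff_evalTeich]
    rwa [Polynomial.IsRoot, Polynomial.eval_map] at hα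
  | succ j =>
    rw [rootRel, map_sub, map_pow, map_genericRel _ _ _ h4, h1, h2, h3, hr, sub_self]

end

theorem PerfdGood.exists_rootSystem {p : ℕ} [Fact p.Prime] {B : Type u} [CommRing B] {L : List B}
    (hB : PerfdGood p B L) {h : Polynomial B} (hm : h.Monic) (hd : h.natDegree ≠ 0) :
    ∃ (B' : Type u) (_ : CommRing B') (ψ : B →+* B'), PerfdGood p B' (L.map ψ) ∧
      ∃ s : ℕ → B', (h.map ψ).IsRoot (s 0) ∧ ∀ i, s (i + 1) ^ p = s i := by
  obtain ⟨P, _, _, _, t, xs, π, hπ, hker, rfl, hwr, hne⟩ := hB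
  have hlift : h ∈ Polynomial.lifts π := by
    rw [Polynomial.mem_lifts]
    exact Polynomial.map_surjective π hπ h
  obtain ⟨g, rfl, hgd, hg⟩ := Polynomial.lifts_and_natDegree_eq_and_monic hlift hm
  rw [← hgd] at hd
  obtain ⟨m, hmax, hm⟩ := Ideal.exists_le_maximal _ hne
  let _ : Field (P ⧸ m) := Ideal.Quotient.field m
  let K := AlgebraicClosure (P ⧸ m)
  let κ : P →+* K := (algebraMap (P ⧸ m) K).comp (Ideal.Quotient.mk m)
  have hκ : ∀ a ∈ t :: xs, κ a = 0 := fun a ha => by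
    have : Ideal.Quotient.mk m a = 0 :=
      Ideal.Quotient.eq_zero_iff_mem.2 (hm (Ideal.subset_span ha))
    simp [κ, this]
  have : CharP K p := charP_of_natCast_eq_zero (natCast_eq_zero_of_hom κ)
  have : PerfectRing K p := inferInstance
  obtain ⟨ev, hev, hevρ⟩ := exists_hom_rootRel κ (hκ t (by simp)) hg hd
  let J := Ideal.span (Set.range (rootRel g t))
  let χ : MvPolynomial ℕ P ⧸ J →+* K := Ideal.Quotient.lift J ev fun a ha => by
    have : J ≤ RingHom.ker ev := by
      refine Ideal.span_le.2 ?_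
      rintro _ ⟨j, rfl⟩
      exact hevρ j
    exact this ha
  have : Nontrivial (MvPolynomial ℕ P ⧸ J) := χ.domain_nontrivial
  have : CharP (MvPolynomial ℕ P ⧸ J) p :=
    charP_of_natCast_eq_zero (natCast_eq_zero_of_hom ((Ideal.Quotient.mk J).comp C))
  let PE := PerfectClosure (MvPolynomial ℕ P ⧸ J) p
  let ι : MvPolynomial ℕ P →+* PE := (PerfectClosure.of _ p).comp (Ideal.Quotient.mk J)
  let π' := Ideal.Quotient.mk (Ideal.span {(p : WittVector p PE) - teichmuller p (ι (C t))})
  let Φ := π'.comp (WittVector.map (ι.comp C))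
  have hΦ : RingHom.ker π ≤ RingHom.ker Φ := by
    rw [hker, Ideal.span_singleton_le_iff_mem, RingHom.mem_ker]
    change π' (WittVector.map (ι.comp C) _) = 0
    rw [map_sub, map_natCast, map_teichmuller]
    exact Ideal.Quotient.eq_zero_iff_mem.2 (Ideal.mem_span_singleton_self _)
  let ψ : B →+* _ := RingHom.liftOfSurjective π hπ ⟨Φ, hΦ⟩
  have hψ (a) : ψ (π a) = Φ a := RingHom.liftOfRightInverse_comp_apply _ _ _ ⟨Φ, hΦ⟩ a
  have hψ' : ψ.comp π = Φ := RingHom.ext hψ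
  have hwr' : WR ⊥ ((t :: xs).map (ι.comp C)) := by
    have h1 : WR ⊥ (((t :: xs).map C).map (Ideal.Quotient.mk J)) := by
      rw [← WR.comap_iff Ideal.Quotient.mk_surjective, ← RingHom.ker_eq_comap_bot, Ideal.mk_ker]
      exact wr_rootRel hwr hg
    have h2 := WR.map_isPRadical p (PerfectClosure.of _ p) h1
    rw [List.map_map, List.map_map] at h2
    exact h2
  have hne' : Ideal.ofList ((t :: xs).map (ι.comp C)) ≠ ⊤ := by
    have h1 := ofList_map_of_ne_top (p := p) (l := (t :: xs).map ((Ideal.Quotient.mk J).comp C)) χ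
      (fun a ha => by
        obtain ⟨b, hb, rfl⟩ := List.mem_map.1 ha
        rw [← hκ b hb, ← hev]
        rfl)
    rw [List.map_map] at h1
    exact h1
  refine ⟨_, inferInstance, ψ, ⟨PE, inferInstance, inferInstance, inferInstance, ι (C t),
    xs.map (ι.comp C), π', Ideal.Quotient.mk_surjective, Ideal.mk_ker, ?_, hwr', hne'⟩,
    fun i => π' (teichmuller p ((frobeniusEquiv PE p).symm^[i] (ι (X 0)))), ?_, fun i => ?_⟩
  · rw [List.map_map, List.map_map]
    refine List.map_congr_left fun x _ => ?_
    simp only [Function.comp_apply, hψ]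
    simp only [Φ, RingHom.comp_apply, map_teichmuller]
  · rw [Polynomial.map_map, hψ', Polynomial.IsRoot, Polynomial.eval_map]
    have h1 : g.eval₂ Φ (π' (teichmuller p (ι (X 0)))) =
        π' (WittVector.map ι (evalTeich g C (X 0))) := by
      rw [map_evalTeich, evalTeich, Polynomial.hom_eval₂]
    have h2 : WittVector.map ι (genericRel g t) = WittVector.map ι (genericWitt p P) * p := by
      ext i
      have h0 (j) : ι (rootRel g t j) = 0 := by
        have : Ideal.Quotient.mk J (rootRel g t j) = 0 :=
          Ideal.Quotient.eq_zero_iff_mem.2 (Ideal.subset_span ⟨j, rfl⟩)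
        simp only [ι, RingHom.comp_apply, this, map_zero]
      cases i with
      | zero => rw [mul_charP_coeff_zero, WittVector.map_coeff]; exact h0 0
      | succ i =>
        rw [mul_charP_coeff_succ, WittVector.map_coeff, WittVector.map_coeff, ← map_pow,
          ← sub_eq_zero, ← map_sub, ← neg_sub, map_neg, neg_eq_zero]
        exact h0 (i + 1)
    simp only [Function.iterate_zero, id]
    rw [h1, Ideal.Quotient.eq_zero_iff_mem, Ideal.mem_span_singleton']
    refine ⟨WittVector.map ι (genericWitt p P), ?_⟩
    rw [genericRel, map_add, map_mul, map_teichmuller] at h2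
    linear_combination -h2
  · rw [← map_pow, ← map_pow, Function.iterate_succ_apply']
    simp

end BigCM

namespace BigCM

open MvPowerSeries

section

variable {σ R S T : Type*} [Finite σ] [CommRing R] [CommRing S] [CommRing T]

lemma hasEval_of_isNilpotent [TopologicalSpace S] {a : σ → S} (ha : ∀ i, IsNilpotent (a i)) :
    HasEval a where
  hpow i := by
    obtain ⟨n, hn⟩ := ha i
    refine tendsto_atTop_of_eventually_const (i₀ := n) fun m hm => pow_eq_zero_of_le hm hn
  tendsto_zero := by simp

/-- Evaluation of power series at nilpotent elements. -/
noncomputable def evalNilp (f : R →+* S) (a : σ → S) (ha : ∀ i, IsNilpotent (a i)) :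
    MvPowerSeries σ R →+* S :=
  let _ : UniformSpace R := ⊥
  let _ : UniformSpace S := ⊥
  have : DiscreteUniformity R := ⟨rfl⟩
  have : DiscreteUniformity S := ⟨rfl⟩
  eval₂Hom (φ := f) continuous_of_discreteTopology (hasEval_of_isNilpotent ha)

variable (f : R →+* S) (a : σ → S) (ha : ∀ i, IsNilpotent (a i))

lemma evalNilp_C (r : R) : evalNilp f a ha (C r) = f r := by
  let _ : UniformSpace R := ⊥
  let _ : UniformSpace S := ⊥
  have : DiscreteUniformity R := ⟨rfl⟩
  have : DiscreteUniformity S := ⟨rfl⟩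
  exact (congrFun (coe_eval₂Hom (φ := f) continuous_of_discreteTopology
    (hasEval_of_isNilpotent ha)) _).trans (eval₂_C f a r)

lemma evalNilp_X (i : σ) : evalNilp f a ha (X i) = a i := by
  let _ : UniformSpace R := ⊥
  let _ : UniformSpace S := ⊥
  have : DiscreteUniformity R := ⟨rfl⟩
  have : DiscreteUniformity S := ⟨rfl⟩
  exact (congrFun (coe_eval₂Hom (φ := f) continuous_of_discreteTopology
    (hasEval_of_isNilpotent ha)) _).trans (eval₂_X f a i)

lemma map_evalNilp (h : S →+* T) (x : MvPowerSeries σ R) :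
    h (evalNilp f a ha x) = evalNilp (h.comp f) (h ∘ a) (fun i => (ha i).map h) x := by
  let _ : UniformSpace R := ⊥
  let _ : UniformSpace S := ⊥
  let _ : UniformSpace T := ⊥
  have : DiscreteUniformity R := ⟨rfl⟩
  have : DiscreteUniformity S := ⟨rfl⟩
  have : DiscreteUniformity T := ⟨rfl⟩
  have h1 := congrFun (comp_eval₂ (φ := f) (a := a) continuous_of_discreteTopology
    (hasEval_of_isNilpotent ha) (ε := h) continuous_of_discreteTopology) x
  have h2 := congrFun (coe_eval₂Hom (φ := f) continuous_of_discreteTopology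
    (hasEval_of_isNilpotent ha)) x
  have h3 := congrFun (coe_eval₂Hom (φ := h.comp f) continuous_of_discreteTopology
    (hasEval_of_isNilpotent (a := h ∘ a) fun i => (ha i).map h)) x
  exact (congrArg h h2).trans (h1.trans h3.symm)

end

end BigCM

namespace BigCM

open WittVector

lemma exists_wittVector_lift {p : ℕ} [Fact p.Prime] {A S : Type*} [CommRing A] [CommRing S]
    {T : ℕ → Type*} [∀ N, CommRing (T N)] (q : ∀ N, S →+* T N)
    (hq : ∀ x y, (∀ N, q N x = q N y) → x = y) (G : ∀ N, A →+* WittVector p (T N))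
    (hl : ∀ a j, ∃ x, ∀ N, q N x = (G N a).coeff j) :
    ∃ g : A →+* WittVector p S, ∀ N a, WittVector.map (q N) (g a) = G N a := by
  choose c hc using hl
  have hinj : ∀ x y : WittVector p S,
      (∀ N, WittVector.map (q N) x = WittVector.map (q N) y) → x = y := fun x y h => by
    ext j
    refine hq _ _ fun N => ?_
    simpa [map_coeff] using congrArg (fun z => z.coeff j) (h N)
  have hg : ∀ N a, WittVector.map (q N) (WittVector.mk p (c a)) = G N a := fun N a => by
    ext j
    simp [map_coeff, hc]
  refine ⟨⟨⟨⟨fun a => WittVector.mk p (c a), ?_⟩, ?_⟩, ?_, ?_⟩, hg⟩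
  · exact hinj _ _ fun N => by rw [hg, map_one, map_one]
  · exact fun a b => hinj _ _ fun N => by rw [map_mul, hg, hg, hg, map_mul]
  · exact hinj _ _ fun N => by simp only [hg, map_zero]
  · exact fun a b => hinj _ _ fun N => by simp only [map_add, hg]

lemma wr_map_X {k σ : Type*} [CommRing k] [DecidableEq σ] (l : List σ) (hl : l.Nodup) :
    WR ⊥ (l.map (MvPolynomial.X (R := k))) := by
  induction l using List.reverseRecOn with
  | nil => simp [WR]
  | append_singleton l v ih =>
    rw [List.nodup_append] at hl
    rw [List.map_append, WR.append_iff]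
    refine ⟨ih hl.1, ?_, trivial⟩
    rw [bot_sup_eq]
    refine isRegMod_of_isolateVar v ?_ ?_
    · intro q hq
      obtain ⟨w, hw, rfl⟩ := List.mem_map.1 hq
      refine Algebra.subset_adjoin ⟨w, ?_, rfl⟩
      exact fun h => hl.2.2 w hw v (by simp) h
    · rw [isolateVar_X_self]
      exact Polynomial.monic_X

lemma wr_of_flat {S T : Type*} [CommRing S] [CommRing T] [Algebra S T] [Module.Flat S T]
    {l : List S} (h : WR ⊥ l) : WR ⊥ (l.map (algebraMap S T)) :=
  WR.bot_iff_isWeaklyRegular.2 (WR.bot_iff_isWeaklyRegular.1 h).of_flat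

lemma exists_adicCompletion_eval {S : Type*} [CommRing S] (I : Ideal S) (y : ∀ n, S ⧸ I ^ n)
    (hy : ∀ n, Ideal.Quotient.factorPow I (Nat.le_succ n) (y (n + 1)) = y n) :
    ∃ x : AdicCompletion I S, ∀ n, AdicCompletion.evalₐ I n x = y n := by
  choose r hr using fun n => Ideal.Quotient.mk_surjective (y n)
  refine ⟨AdicCompletion.mk I S (AdicCompletion.AdicCauchySequence.mk I S r fun n => ?_),
    fun n => ?_⟩
  · rw [SModEq.sub_mem, smul_eq_mul, Ideal.mul_top, ← Ideal.Quotient.eq, hr, ← hy n, ← hr (n + 1)]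
    rfl
  · rw [AdicCompletion.evalₐ_mk, ← hr n]
    rfl

lemma exists_perfdGood_base {p : ℕ} [Fact p.Prime] (k : Type u) [Field k] [CharP k p]
    [PerfectRing k p] (m : ℕ) :
    ∃ (B : Type u) (_ : CommRing B) (φ : MvPowerSeries (Fin m) (WittVector p k) →+* B),
      PerfdGood p B (List.ofFn fun i => φ (MvPowerSeries.X i)) := by
  classical
  let S₀ := MvPolynomial (Option (Fin m)) k
  let x : Fin m → S₀ := fun i => MvPolynomial.X (some i)
  let I : Ideal S₀ := Ideal.span (Set.range x)
  let S := AdicCompletion I S₀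
  have hx : ∀ i, x i ∈ I := fun i => Ideal.subset_span ⟨i, rfl⟩
  let c : ∀ N, k →+* S₀ ⧸ I ^ N := fun N => (Ideal.Quotient.mk (I ^ N)).comp MvPolynomial.C
  let a : ∀ N, Fin m → WittVector p (S₀ ⧸ I ^ N) := fun N i =>
    teichmuller p (Ideal.Quotient.mk (I ^ N) (x i))
  have ha : ∀ N i, IsNilpotent (a N i) := fun N i => ⟨N, by
    rw [← map_pow, ← map_pow, Ideal.Quotient.eq_zero_iff_mem.2 (Ideal.pow_mem_pow (hx i) N),
      teichmuller_zero]⟩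
  let G : ∀ N, MvPowerSeries (Fin m) (WittVector p k) →+* WittVector p (S₀ ⧸ I ^ N) := fun N =>
    evalNilp (WittVector.map (c N)) (a N) (ha N)
  have hGX : ∀ N i, G N (MvPowerSeries.X i) = a N i := fun N i => evalNilp_X _ _ _ i
  have hG : ∀ N z, WittVector.map (Ideal.Quotient.factorPow I (Nat.le_succ N)) (G (N + 1) z) =
      G N z := fun N z => by
    simp only [G]
    rw [map_evalNilp]
    congr 2
    ext i : 1
    exact map_teichmuller (p := p) _ _
  obtain ⟨g, hg⟩ := exists_wittVector_lift (p := p)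
    (fun N => (AdicCompletion.evalₐ I N : S →ₐ[S₀] S₀ ⧸ I ^ N).toRingHom)
    (fun x y h => AdicCompletion.ext_evalₐ h) G (fun z j =>
      exists_adicCompletion_eval I (fun N => (G N z).coeff j) fun N => by
        rw [← hG N z, map_coeff])
  have hgX : ∀ i, g (MvPowerSeries.X i) = teichmuller p (algebraMap S₀ S (x i)) := fun i => by
    refine WittVector.ext fun j => ?_
    refine AdicCompletion.ext_evalₐ (I := I) fun N => ?_
    have h1 := congrArg (fun z => z.coeff j) ((hg N (MvPowerSeries.X i)).trans (hGX N i))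
    have h2 := congrArg (fun z => z.coeff j) (map_teichmuller (p := p)
      (AdicCompletion.evalₐ I N : S →ₐ[S₀] S₀ ⧸ I ^ N).toRingHom (algebraMap S₀ S (x i)))
    simp only [map_coeff] at h1 h2
    refine h1.trans (Eq.trans ?_ h2.symm)
    exact congrArg (fun z => (teichmuller p z).coeff j) (AdicCompletion.evalₐ_of I N (x i)).symm
  let χ : S →+* k := (Ideal.Quotient.lift I
    (MvPolynomial.aeval (R := k) (0 : Option (Fin m) → k)).toRingHom
    (by
      intro z hz
      have : I ≤ RingHom.ker (MvPolynomial.aeval (R := k) (0 : Option (Fin m) → k)).toRingHom := by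
        refine Ideal.span_le.2 ?_
        rintro _ ⟨i, rfl⟩
        exact MvPolynomial.aeval_X (R := k) (0 : Option (Fin m) → k) (some i)
      exact this hz)).comp (AdicCompletion.evalOneₐ I).toRingHom
  have hχ : ∀ v : Option (Fin m), χ (algebraMap S₀ S (MvPolynomial.X v)) = 0 := fun v => by
    exact MvPolynomial.aeval_X (R := k) (0 : Option (Fin m) → k) v
  have : Nontrivial S := χ.domain_nontrivial
  have : CharP S p := charP_of_natCast_eq_zero
    (natCast_eq_zero_of_hom ((algebraMap S₀ S).comp MvPolynomial.C))
  let l : List (Option (Fin m)) := none :: (List.finRange m).map some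
  have hl : l.Nodup := by
    simp only [l, List.nodup_cons]
    refine ⟨by simp, (List.nodup_finRange m).map (Option.some_injective _)⟩
  have hw := wr_of_flat (T := S) (wr_map_X (k := k) l hl)
  have hw2 := WR.map_isPRadical p (PerfectClosure.of S p) hw
  have hne := ofList_map_of_ne_top (p := p) (l := (l.map MvPolynomial.X).map (algebraMap S₀ S)) χ
    (by
      intro a ha
      simp only [List.mem_map] at ha
      obtain ⟨_, ⟨v, -, rfl⟩, rfl⟩ := ha
      exact hχ v)
  let P := PerfectClosure S p
  let t : P := PerfectClosure.of S p (algebraMap S₀ S (MvPolynomial.X none))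
  let B := WittVector p P ⧸ Ideal.span {(p : WittVector p P) - teichmuller p t}
  refine ⟨B, inferInstance, (Ideal.Quotient.mk _).comp
    ((WittVector.map (PerfectClosure.of S p)).comp g), P, inferInstance, inferInstance,
    inferInstance, t, (List.finRange m).map fun i => PerfectClosure.of S p (algebraMap S₀ S (x i)),
    Ideal.Quotient.mk _, Ideal.Quotient.mk_surjective, Ideal.mk_ker, ?_, ?_, ?_⟩
  · rw [List.map_map, List.ofFn_eq_map]
    refine List.map_congr_left fun i _ => ?_
    simp [hgX, map_teichmuller]
  · simpa [l, t, x, Function.comp_def] using hw2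
  · simpa [l, t, x, Function.comp_def] using hne

end BigCM

namespace BigCM

lemma IsDC.congr {A A' M : Type*} [CommRing A] [CommRing A'] [AddCommGroup M] [Module A M]
    [Module A' M] {a : A} {a' : A'} (h : IsDC a M) (haa' : ∀ x : M, a • x = a' • x) :
    IsDC a' M := by
  have : (shiftMap a' M : (ℕ → M) → (ℕ → M)) = shiftMap a M := by
    ext u i
    simp [haa']
  rw [IsDC, this]
  exact h

section

variable {S : Type*} [CommRing S]

lemma IsDC.sup_span {I : Ideal S} {a : S} (h : IsDC a (S ⧸ I)) (c : S) :
    IsDC a (S ⧸ (I ⊔ Ideal.span {c})) := by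
  refine (h.quotient_range h (LinearMap.lsmul S (S ⧸ I) c)).of_linearEquiv
    ((Submodule.quotEquivOfEq _ _ ?_).trans
      (Submodule.quotientQuotientEquivQuotientSup I (Ideal.span {c})))
  ext x
  simp only [LinearMap.mem_range, Submodule.mem_map]
  constructor
  · rintro ⟨y, rfl⟩
    obtain ⟨y, rfl⟩ := Submodule.Quotient.mk_surjective _ y
    exact ⟨c * y, Ideal.mul_mem_right _ _ (Ideal.mem_span_singleton_self c), rfl⟩
  · rintro ⟨y, hy, rfl⟩
    obtain ⟨z, rfl⟩ := Ideal.mem_span_singleton'.1 hy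
    exact ⟨Submodule.Quotient.mk z, by rw [mul_comm]; rfl⟩

lemma IsRegMod.of_isDC {I : Ideal S} {a c : S} (h : IsDC a (S ⧸ I)) (ha : IsRegMod I a)
    (hc : IsRegMod (I ⊔ Ideal.span {a}) c) : IsRegMod I c := by
  intro z hz
  have hk := h.ker h (LinearMap.lsmul S (S ⧸ I) c)
  have hmem : ∀ z, (Submodule.Quotient.mk z : S ⧸ I) ∈ LinearMap.ker (LinearMap.lsmul S (S ⧸ I) c) ↔
      c * z ∈ I := fun z => by
    rw [LinearMap.mem_ker, ← Submodule.Quotient.mk_eq_zero]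
    rfl
  have := hk.eq_zero_of_surjective (fun ⟨x, hx⟩ => by
    obtain ⟨x, rfl⟩ := Submodule.Quotient.mk_surjective _ x
    rw [hmem] at hx
    obtain ⟨y, hy⟩ := mem_sup_span.1 (hc x (Ideal.mem_sup_left hx))
    refine ⟨⟨Submodule.Quotient.mk y, (hmem y).2 (ha _ ?_)⟩, Subtype.ext ?_⟩
    · have : a * (c * y) = c * x - c * (x - a * y) := by ring
      rw [this]
      exact I.sub_mem hx (I.mul_mem_left _ hy)
    · exact (Submodule.Quotient.eq I).2 hy) ⟨Submodule.Quotient.mk z, (hmem z).2 hz⟩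
  exact (Submodule.Quotient.mk_eq_zero I).1 (congrArg Subtype.val this)

lemma WR.rotate {I : Ideal S} {a : S} {l : List S} (h : WR I (a :: l)) (ha : IsDC a (S ⧸ I)) :
    WR I (l ++ [a]) := by
  induction l generalizing I with
  | nil => exact h
  | cons c l ih => exact ⟨.of_isDC ha h.1 h.2.1, ih h.swap (ha.sup_span c)⟩

lemma isDC_mk {I : Ideal S} {a : S} (h : IsDC a (S ⧸ I)) :
    IsDC (Ideal.Quotient.mk I a) (S ⧸ I) := h.congr fun x => by
  obtain ⟨x, rfl⟩ := Ideal.Quotient.mk_surjective x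
  rfl

lemma IsDC.quotient_ideal {a : S} (h : IsDC a S) (c : S) : IsDC a (S ⧸ Ideal.span {c}) := by
  have := (h.of_linearEquiv (Submodule.quotEquivOfEqBot (⊥ : Ideal S) rfl).symm).sup_span c
  rwa [bot_sup_eq] at this

end

section PowerSeries

variable {S : Type*} [CommRing S]

open PowerSeries

lemma isDC_C {a : S} (h : IsDC a S) : IsDC (C a : S⟦X⟧) S⟦X⟧ := by
  have h1 : IsDC a S⟦X⟧ := (h.pi (ι := Unit →₀ ℕ)).of_linearEquiv (LinearEquiv.refl S _)
  exact h1.congr fun x => by rw [smul_eq_C_mul, smul_eq_mul]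

lemma isDC_X : IsDC (X : S⟦X⟧) S⟦X⟧ := by
  constructor
  · rw [injective_iff_map_eq_zero]
    intro u hu
    have hu' : ∀ i, u i = X * u (i + 1) := fun i => by
      simpa [sub_eq_zero] using congrFun hu i
    have : ∀ n i, coeff n (u i) = 0 := by
      intro n
      induction n with
      | zero => intro i; rw [hu']; simp
      | succ n ih => intro i; rw [hu', coeff_succ_X_mul]; exact ih _
    ext i n
    exact this n i
  · intro v
    refine ⟨fun i => PowerSeries.mk fun n =>
      ∑ j ∈ Finset.range (n + 1), coeff (n - j) (v (i + j)), ?_⟩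
    ext i n
    rw [shiftMap_apply, smul_eq_mul, map_sub, coeff_mk]
    cases n with
    | zero => simp
    | succ n =>
      rw [coeff_succ_X_mul, coeff_mk, Finset.sum_range_succ', sub_eq_iff_eq_add, add_comm]
      congr 1
      refine Finset.sum_congr rfl fun j _ => ?_
      rw [Nat.add_sub_add_right, add_assoc, add_comm 1 j]

lemma wr_X_sub_C {b : S} {l : List S} (h : WR ⊥ (b :: l)) :
    WR (Ideal.span {(X - C b : S⟦X⟧)}) ((b :: l).map C) := by
  obtain ⟨hb, hl⟩ := h
  rw [bot_sup_eq] at hl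
  refine ⟨fun z hz => ?_, ?_⟩
  · obtain ⟨w, hw⟩ := Ideal.mem_span_singleton'.1 hz
    have h1 : C b * (z + w) = X * w := by linear_combination -hw
    have h0 : constantCoeff (z + w) = 0 := hb _ (by
      have := congrArg constantCoeff h1
      simpa using this)
    obtain ⟨y, hy⟩ := X_dvd_iff.2 h0
    have h2 : C b * y = w := by
      rw [hy] at h1
      have h3 : X * (C b * y) = X * w := by linear_combination h1
      ext n
      simpa using congrArg (coeff (n + 1)) h3
    refine Ideal.mem_span_singleton'.2 ⟨y, ?_⟩
    linear_combination -hy - h2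
  · have : Ideal.span {(X - C b : S⟦X⟧)} ⊔ Ideal.span {C b} =
        (Ideal.span {b}).comap (constantCoeff : S⟦X⟧ →+* S) := by
      ext z
      rw [mem_sup_span, Ideal.mem_comap, Ideal.mem_span_singleton']
      constructor
      · rintro ⟨c, hc⟩
        obtain ⟨d, hd⟩ := Ideal.mem_span_singleton'.1 hc
        have := congrArg constantCoeff hd
        simp only [map_mul, map_sub, constantCoeff_X, constantCoeff_C] at this
        exact ⟨-constantCoeff d + constantCoeff c, by linear_combination this⟩
      · rintro ⟨a, ha⟩
        obtain ⟨y, hy⟩ := X_dvd_iff.2 (show constantCoeff (z - C b * C a) = 0 by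
          simp [← ha, mul_comm])
        refine ⟨C a + y, Ideal.mem_span_singleton'.2 ⟨y, ?_⟩⟩
        linear_combination -hy
    change WR (_ ⊔ _) _
    rw [this, WR.comap_iff constantCoeff_surj]
    simpa [Function.comp_def] using hl

end PowerSeries

lemma WR.map_mk {S : Type*} [CommRing S] {I : Ideal S} {l : List S} (h : WR I l) :
    WR ⊥ (l.map (Ideal.Quotient.mk I)) := by
  rw [← WR.comap_iff Ideal.Quotient.mk_surjective, ← RingHom.ker_eq_comap_bot, Ideal.mk_ker]
  exact h

lemma ofList_ne_top_of_hom {S T : Type*} [CommRing S] [CommRing T] [Nontrivial T] (χ : S →+* T)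
    {l : List S} (h : ∀ a ∈ l, χ a = 0) : Ideal.ofList l ≠ ⊤ := by
  intro ht
  have : Ideal.ofList l ≤ RingHom.ker χ := Ideal.span_le.2 h
  rw [ht] at this
  exact RingHom.ker_ne_top χ (top_le_iff.1 this)

open PowerSeries in
lemma exists_isDC_step {N : Type u} [CommRing N] {b : N} {l : List N} (h : WR ⊥ (b :: l))
    (hne : Ideal.ofList (b :: l) ≠ ⊤) :
    ∃ (N' : Type u) (_ : CommRing N') (ψ : N →+* N'), WR ⊥ ((b :: l).map ψ) ∧
      Ideal.ofList ((b :: l).map ψ) ≠ ⊤ ∧ IsDC (ψ b) N' ∧ ∀ a, IsDC a N → IsDC (ψ a) N' := by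
  let ψ : N →+* N⟦X⟧ ⧸ Ideal.span {(X - C b : N⟦X⟧)} := (Ideal.Quotient.mk _).comp C
  refine ⟨_, inferInstance, ψ, ?_, ?_, ?_, ?_⟩
  · have := (wr_X_sub_C h).map_mk
    rwa [List.map_map] at this
  · have : Nontrivial (N ⧸ Ideal.ofList (b :: l)) := Ideal.Quotient.nontrivial_iff.2 hne
    have hz : ∀ a ∈ b :: l, Ideal.Quotient.mk (Ideal.ofList (b :: l)) a = 0 := fun a ha =>
      Ideal.Quotient.eq_zero_iff_mem.2 (Ideal.subset_span ha)
    refine ofList_ne_top_of_hom (Ideal.Quotient.lift _ ((Ideal.Quotient.mk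
      (Ideal.ofList (b :: l))).comp constantCoeff) fun a ha => ?_) fun a ha => ?_
    · obtain ⟨c, rfl⟩ := Ideal.mem_span_singleton'.1 ha
      simp [hz b (by simp)]
    · obtain ⟨a, ha', rfl⟩ := List.mem_map.1 ha
      simpa [ψ] using hz a ha'
  · have h1 := isDC_mk (isDC_X.quotient_ideal (X - C b : N⟦X⟧))
    have h2 : Ideal.Quotient.mk (Ideal.span {(X - C b : N⟦X⟧)}) X = ψ b :=
      Ideal.Quotient.eq.2 (Ideal.mem_span_singleton_self _)
    rwa [h2] at h1
  · exact fun a ha => isDC_mk ((isDC_C ha).quotient_ideal _)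

lemma exists_isDC_aux {N : Type u} [CommRing N] (l₁ l₂ : List N) (h : WR ⊥ (l₁ ++ l₂))
    (hne : Ideal.ofList (l₁ ++ l₂) ≠ ⊤) (h₂ : ∀ a ∈ l₂, IsDC a N) :
    ∃ (M : Type u) (_ : CommRing M) (ψ : N →+* M), WR ⊥ ((l₂ ++ l₁).map ψ) ∧
      Ideal.ofList ((l₂ ++ l₁).map ψ) ≠ ⊤ ∧ ∀ a ∈ l₂ ++ l₁, IsDC (ψ a) M := by
  induction hn : l₁.length generalizing N l₁ l₂ with
  | zero =>
    rw [List.length_eq_zero_iff] at hn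
    subst hn
    exact ⟨N, inferInstance, RingHom.id N, by simpa using h, by simpa using hne, by simpa using h₂⟩
  | succ n ih =>
    obtain _ | ⟨b, l⟩ := l₁
    · simp at hn
    obtain ⟨N', _, ψ, h1, h2, h3, h4⟩ := exists_isDC_step (b := b) (l := l ++ l₂) h hne
    rw [List.map_cons] at h1
    have h5 := h1.rotate (h3.of_linearEquiv (Submodule.quotEquivOfEqBot (⊥ : Ideal N') rfl).symm)
    obtain ⟨M, _, ψ', k1, k2, k3⟩ := ih (l.map ψ) (l₂.map ψ ++ [ψ b]) (by simpa using h5)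
      (by
        intro ht
        apply h2
        rw [← ht]
        simp only [Ideal.ofList]
        congr 1
        ext x
        simp only [List.map_append, List.map_cons, List.mem_append, List.mem_cons,
          List.not_mem_nil, Set.mem_ofPred_eq]
        tauto)
      (by
        intro a ha
        obtain ha | ha := List.mem_append.1 ha
        · obtain ⟨a, ha', rfl⟩ := List.mem_map.1 ha
          exact h4 a (h₂ a ha')
        · rw [List.mem_singleton.1 ha]
          exact h3)
      (by simpa using hn)
    refine ⟨M, inferInstance, ψ'.comp ψ, by simpa using k1, by simpa using k2, fun a ha => ?_⟩
    refine k3 (ψ a) ?_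
    simp only [List.mem_append, List.mem_cons] at ha
    simp only [List.mem_append, List.mem_singleton, List.mem_map]
    rcases ha with ha | rfl | ha
    · exact Or.inl (Or.inl ⟨a, ha, rfl⟩)
    · exact Or.inl (Or.inr rfl)
    · exact Or.inr ⟨a, ha, rfl⟩

/-- A weakly regular sequence generating a proper ideal stays so after passing to a suitable
algebra which is derived complete with respect to its members. -/
lemma exists_isDC {N : Type u} [CommRing N] {l : List N} (h : WR ⊥ l) (hne : Ideal.ofList l ≠ ⊤) :
    ∃ (M : Type u) (_ : CommRing M) (ψ : N →+* M), WR ⊥ (l.map ψ) ∧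
      Ideal.ofList (l.map ψ) ≠ ⊤ ∧ ∀ a ∈ l, IsDC (ψ a) M := by
  simpa using exists_isDC_aux l [] (by simpa using h) (by simpa using hne) (by simp)

end BigCM

namespace BigCM

open Polynomial

section

variable {p : ℕ} [Fact p.Prime] {B : Type u} [CommRing B] {L : List B}

lemma PerfdGood.exists_splits (hB : PerfdGood p B L) {h : B[X]} (hm : h.Monic) :
    ∃ (B' : Type u) (_ : CommRing B') (ψ : B →+* B'), PerfdGood p B' (L.map ψ) ∧
      ∃ ts : List B', h.map ψ = (ts.map fun t => X - C t).prod := by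
  induction hn : h.natDegree generalizing B with
  | zero =>
    refine ⟨B, inferInstance, RingHom.id B, by simpa using hB, [], ?_⟩
    rw [hm.natDegree_eq_zero.1 hn]
    simp
  | succ n ih =>
    obtain ⟨B₁, _, ψ, hB₁, s, hs, -⟩ := hB.exists_rootSystem hm (by omega)
    have hm₁ := hm.map ψ
    set g := h.map ψ /ₘ (X - C (s 0)) with hg
    have hgm : (X - C (s 0)) * g = h.map ψ := mul_divByMonic_eq_iff_isRoot.2 hs
    have hnt : Nontrivial B₁ := by
      have := hB₁.ne_top
      by_contra hc
      rw [not_nontrivial_iff_subsingleton] at hc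
      exact this (Subsingleton.elim _ _)
    have hmon : g.Monic := (monic_X_sub_C (s 0)).of_mul_monic_left (hgm ▸ hm₁)
    obtain ⟨B', _, ψ', hB', ts, hts⟩ := ih hB₁ hmon (by
      rw [hg, natDegree_divByMonic _ (monic_X_sub_C _), hm.natDegree_map, hn, natDegree_X_sub_C]
      rfl)
    refine ⟨B', inferInstance, ψ'.comp ψ, by simpa using hB', ψ' (s 0) :: ts, ?_⟩
    rw [← Polynomial.map_map, ← hgm, Polynomial.map_mul, hts]
    simp

lemma PerfdGood.exists_rootSystems (hB : PerfdGood p B L) (ds : List B) :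
    ∃ (B' : Type u) (_ : CommRing B') (ψ : B →+* B'), PerfdGood p B' (L.map ψ) ∧
      ∀ d ∈ ds, ∃ s : ℕ → B', s 0 = ψ d ∧ ∀ i, s (i + 1) ^ p = s i := by
  induction hn : ds.length generalizing B with
  | zero =>
    rw [List.length_eq_zero_iff] at hn
    exact ⟨B, inferInstance, RingHom.id B, by simpa using hB, by simp [hn]⟩
  | succ n ih =>
    obtain _ | ⟨d, ds⟩ := ds
    · simp at hn
    have hnt : Nontrivial B := by
      have := hB.ne_top
      by_contra hc
      rw [not_nontrivial_iff_subsingleton] at hc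
      exact this (Subsingleton.elim _ _)
    obtain ⟨B₁, _, ψ, hB₁, s, hs, hs'⟩ := hB.exists_rootSystem (monic_X_sub_C d) (by simp)
    obtain ⟨B', _, ψ', hB', h⟩ := ih hB₁ (ds.map ψ) (by simpa using hn)
    refine ⟨B', inferInstance, ψ'.comp ψ, by simpa using hB', ?_⟩
    intro c hc
    obtain rfl | hc := List.mem_cons.1 hc
    · refine ⟨fun i => ψ' (s i), ?_, fun i => by rw [← map_pow, hs']⟩
      have : s 0 = ψ c := by simpa [sub_eq_zero] using hs
      simp [this]
    · exact h (ψ c) (List.mem_map_of_mem hc)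

end

section Pi

variable {S : Type*} [CommRing S] {ι : Type*}

lemma pi_sup_span (I : Ideal S) (a : S) :
    (Ideal.pi fun _ : ι => I) ⊔ Ideal.span {Pi.constRingHom ι S a} =
      Ideal.pi fun _ : ι => I ⊔ Ideal.span {a} := by
  ext z
  simp only [mem_sup_span, Ideal.mem_pi]
  exact (Classical.skolem (p := fun i c => z i - a * c ∈ I)).symm

lemma WR.pi {I : Ideal S} {l : List S} (h : WR I l) :
    WR (Ideal.pi fun _ : ι => I) (l.map (Pi.constRingHom ι S)) := by
  induction l generalizing I with
  | nil => trivial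
  | cons a l ih =>
    refine ⟨fun z hz i => h.1 _ (hz i), ?_⟩
    rw [pi_sup_span]
    exact ih h.2

lemma pi_bot : (Ideal.pi fun _ : ι => (⊥ : Ideal S)) = ⊥ := by
  ext z
  simp [Ideal.mem_pi, funext_iff]

lemma ofList_map_constRingHom_le (l : List S) :
    Ideal.ofList (l.map (Pi.constRingHom ι S)) ≤ Ideal.pi fun _ : ι => Ideal.ofList l := by
  refine Ideal.span_le.2 fun z hz => ?_
  obtain ⟨a, ha, rfl⟩ := List.mem_map.1 hz
  exact fun _ => Ideal.subset_span ha

end Pi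

/-- Given a compatible system `s` of `p`-power roots of an element outside of the radical of
`⨅ n, (l) ^ n`, there is a localization of a power of `B` where `s` is invertible and which is
derived complete. -/
lemma exists_away {p : ℕ} [Fact p.Prime] {B : Type u} [CommRing B] {l : List B} (hl : WR ⊥ l)
    {s : ℕ → B} (hs : ∀ i, s (i + 1) ^ p = s i)
    (hs0 : s 0 ∉ (⨅ n, Ideal.ofList l ^ n : Ideal B).radical) :
    ∃ (M : Type u) (_ : CommRing M) (θ : (ℕ → B) →+* M), IsUnit (θ s) ∧
      WR ⊥ (l.map (θ.comp (Pi.constRingHom ℕ B))) ∧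
      Ideal.ofList (l.map (θ.comp (Pi.constRingHom ℕ B))) ≠ ⊤ ∧
      ∀ a ∈ l, IsDC (θ (Pi.constRingHom ℕ B a)) M := by
  let N := Localization.Away s
  have hN : WR (⊥ : Ideal N) ((l.map (Pi.constRingHom ℕ B)).map (algebraMap (ℕ → B) N)) := by
    have := hl.pi (ι := ℕ)
    rw [pi_bot] at this
    have : Module.Flat (ℕ → B) N := IsLocalization.flat N (Submonoid.powers s)
    exact wr_of_flat ‹_›
  have hsi : ∀ i, s i ^ p ^ i = s 0 := fun i => by
    induction i with
    | zero => simp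
    | succ i ih => rw [pow_succ', pow_mul, hs, ih]
  have hne : Ideal.ofList ((l.map (Pi.constRingHom ℕ B)).map (algebraMap (ℕ → B) N)) ≠ ⊤ := by
    intro ht
    rw [← Ideal.map_ofList] at ht
    have h1 := (Ideal.eq_top_iff_one _).1 ht
    obtain ⟨⟨⟨x, hx⟩, ⟨_, e, rfl⟩⟩, h2⟩ :=
      (IsLocalization.mem_map_algebraMap_iff (Submonoid.powers s) N).1 h1
    rw [one_mul] at h2
    obtain ⟨⟨_, e', rfl⟩, h3⟩ := (IsLocalization.eq_iff_exists (Submonoid.powers s) N).1 h2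
    have h4 : s ^ (e' + e) ∈ Ideal.pi fun _ : ℕ => Ideal.ofList l := by
      rw [pow_add]
      have h5 : s ^ e' * s ^ e = s ^ e' * x := h3
      rw [h5]
      exact Ideal.mul_mem_left _ _ (ofList_map_constRingHom_le _ hx)
    refine hs0 ⟨e' + e, (Ideal.mem_iInf).2 fun n => ?_⟩
    have h5 : (s n ^ (e' + e)) ^ p ^ n ∈ Ideal.ofList l ^ p ^ n := Ideal.pow_mem_pow (h4 n) _
    rw [← pow_mul, mul_comm, pow_mul, hsi] at h5
    exact Ideal.pow_le_pow_right (Nat.lt_pow_self (Fact.out : p.Prime).one_lt).le h5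
  obtain ⟨M, _, ψ, h1, h2, h3⟩ := exists_isDC hN hne
  refine ⟨M, inferInstance, ψ.comp (algebraMap (ℕ → B) N), ?_,
    by simpa [Function.comp_assoc] using h1,
    by simpa [Function.comp_assoc] using h2, fun a ha => ?_⟩
  · exact (IsLocalization.map_units N (⟨s, 1, pow_one s⟩ : Submonoid.powers s)).map ψ
  · exact h3 _ (List.mem_map_of_mem (List.mem_map_of_mem ha))

lemma exists_mem_of_minimalPrimes {D : Type*} [CommRing D] [IsNoetherianRing D] {Q : Ideal D}
    (hQ : Q ∈ minimalPrimes D) : ∃ δ ∉ Q, ∀ q ∈ Q, IsNilpotent (δ * q) := by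
  classical
  have hfin := minimalPrimes.finite_of_isNoetherianRing D
  have hQp : Q.IsPrime := hQ.1.1
  have : ¬ (hfin.toFinset.erase Q).inf id ≤ Q := by
    rw [hQp.inf_le']
    rintro ⟨P, hP, hPQ⟩
    simp only [Finset.mem_erase, Set.Finite.mem_toFinset, id] at hP hPQ
    exact hP.1 (le_antisymm hPQ (hQ.2 hP.2.1 hPQ))
  obtain ⟨δ, hδ, hδQ⟩ := Set.not_subset.1 this
  refine ⟨δ, hδQ, fun q hq => ?_⟩
  rw [nilpotent_iff_mem_prime]
  intro J hJ
  obtain ⟨P, hP, hPJ⟩ := Ideal.exists_minimalPrimes_le (bot_le : ⊥ ≤ J)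
  refine hPJ ?_
  by_cases h : P = Q
  · exact h ▸ Ideal.mul_mem_left _ _ hq
  · refine Ideal.mul_mem_right _ _ ?_
    have h1 : (hfin.toFinset.erase Q).inf id ≤ P :=
      Finset.inf_le (f := id) (by simpa [h] using hP)
    exact h1 hδ

lemma ofList_pow_le {A : Type*} [CommRing A] (l : List A) (n : ℕ) :
    Ideal.ofList l ^ (l.length * n + 1) ≤ Ideal.ofList (l.map (· ^ n)) := by
  induction l with
  | nil => simp
  | cons a l ih =>
    rw [Ideal.ofList_cons, List.map_cons, Ideal.ofList_cons, List.length_cons]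
    have : (l.length + 1) * n + 1 = n + (l.length * n + 1) := by ring
    rw [this]
    refine Ideal.sup_pow_add_le_pow_sup_pow.trans (sup_le_sup ?_ ih)
    rw [Ideal.span_singleton_pow]

lemma ofList_map_pow_le {A : Type*} [CommRing A] (l : List A) (n : ℕ) :
    Ideal.ofList (l.map (· ^ n)) ≤ Ideal.ofList l ^ n := by
  refine Ideal.span_le.2 fun z hz => ?_
  obtain ⟨a, ha, rfl⟩ := List.mem_map.1 hz
  exact Ideal.pow_mem_pow (show a ∈ Ideal.ofList l from Ideal.subset_span ha) n

lemma eq_zero_of_map_mem_iInf {A B : Type*} [CommRing A] [IsDomain A] [IsNoetherianRing A]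
    [CommRing B] (φ : A →+* B) {l : List A} (hmax : (Ideal.ofList l).IsMaximal)
    (hl : WR ⊥ (l.map φ)) (hne : Ideal.ofList (l.map φ) ≠ ⊤) {a : A}
    (ha : φ a ∈ (⨅ n, Ideal.ofList (l.map φ) ^ n : Ideal B).radical) : a = 0 := by
  obtain ⟨e, he⟩ := ha
  rw [← map_pow, Ideal.mem_iInf] at he
  refine eq_zero_of_pow_eq_zero (n := e) ?_
  rw [← Ideal.mem_bot, ← Ideal.iInf_pow_eq_bot_of_isDomain _ hmax.ne_top, Ideal.mem_iInf]
  intro n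
  have h0 : ∀ c, φ c ∈ (⊥ : Ideal B) ⊔ Ideal.ofList (l.map φ) →
      c ∈ (⊥ : Ideal A) ⊔ Ideal.ofList l := by
    intro c hc
    rw [bot_sup_eq] at hc ⊢
    by_contra hcl
    obtain ⟨y, i, hi, hy⟩ := hmax.exists_inv hcl
    refine hne ((Ideal.eq_top_iff_one _).2 ?_)
    rw [← map_one φ, ← hy, map_add, map_mul]
    refine Ideal.add_mem _ (Ideal.mul_mem_left _ _ hc) ?_
    rw [← Ideal.map_ofList]
    exact Ideal.mem_map_of_mem φ hi
  have h1 := mem_of_map_mem_pow φ (J := ⊥) (I := ⊥) (by simp) hl h0 n (c := a ^ e) (by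
    rw [bot_sup_eq]
    exact ofList_pow_le _ n (he _))
  rw [bot_sup_eq] at h1
  exact ofList_map_pow_le l n h1

end BigCM

namespace BigCM

open Polynomial

lemma nonempty_algHom_of_splits {A T E : Type*} [CommRing A] [IsDomain A] [CommRing T] [IsDomain T]
    [CommRing E] [IsDomain E] [Algebra A T] [Algebra A E] [Algebra.IsIntegral A T]
    (hT : Function.Injective (algebraMap A T)) (hE : Function.Injective (algebraMap A E))
    {s : Set T} (hs : Algebra.adjoin A s = ⊤) {f : A[X]} (hf : ∀ g ∈ s, aeval g f = 0)
    {ts : List E} (hts : f.map (algebraMap A E) = (ts.map fun t => X - C t).prod) :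
    Nonempty (T →ₐ[A] E) := by
  let K := AlgebraicClosure (FractionRing E)
  let ι : E →ₐ[A] K := IsScalarTower.toAlgHom A E K
  have hι : Function.Injective ι := by
    change Function.Injective (algebraMap E K)
    rw [IsScalarTower.algebraMap_eq E (FractionRing E) K]
    exact (algebraMap (FractionRing E) K).injective.comp (IsFractionRing.injective E _)
  have hAK : Function.Injective (algebraMap A K) := by
    rw [← ι.comp_algebraMap]
    exact hι.comp hE
  have h1 : Module.IsTorsionFree A T := Module.isTorsionFree_iff_algebraMap_injective.2 hT
  have h2 : Module.IsTorsionFree A K := Module.isTorsionFree_iff_algebraMap_injective.2 hAK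
  have h3 : Algebra.IsAlgebraic A T := Algebra.IsIntegral.isAlgebraic
  let ρ : T →ₐ[A] K := IsAlgClosed.lift
  have hρ : ∀ x, ρ x ∈ ι.range := by
    have : (⊤ : Subalgebra A T) ≤ ι.range.comap ρ := by
      rw [← hs, Algebra.adjoin_le_iff]
      intro g hg
      have h4 : aeval (ρ g) f = 0 := by rw [aeval_algHom_apply, hf g hg, map_zero]
      have h5 : aeval (ρ g) f = (ts.map fun t => ρ g - ι t).prod := by
        have h6 : f.map (algebraMap A K) = (ts.map fun t => X - C (ι t)).prod := by
          rw [← ι.comp_algebraMap, ← Polynomial.map_map, hts, Polynomial.map_list_prod,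
            List.map_map]
          congr 1
          refine List.map_congr_left fun t _ => ?_
          simp
        rw [← eval_map_algebraMap, h6, eval_list_prod, List.map_map]
        congr 1
        refine List.map_congr_left fun t _ => ?_
        simp
      rw [h5, List.prod_eq_zero_iff, List.mem_map] at h4
      obtain ⟨t, -, ht⟩ := h4
      exact ⟨t, (sub_eq_zero.1 ht).symm⟩
    exact fun x => this (Algebra.mem_top (x := x))
  exact ⟨(AlgEquiv.ofInjective ι hι).symm.toAlgHom.comp (ρ.codRestrict ι.range hρ)⟩

lemma IsDC.eq_zero_of_forall_pow_dvd {M : Type*} [CommRing M] {a : M} (h : IsDC a M)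
    (ha : IsRegMod ⊥ a) {y : M} (hy : ∀ n, a ^ n ∣ y) : y = 0 := by
  choose c hc using hy
  have hreg : ∀ n z, a ^ n * z = 0 → z = 0 := fun n z hz => ha.pow n z hz
  have := h.eq_zero (u := c) (fun i => sub_eq_zero.1 (hreg i _ (by
    rw [smul_eq_mul, mul_sub, ← mul_assoc, ← pow_succ, ← hc, ← hc, sub_self]))) 0
  rw [hc 0, this, mul_zero]

theorem exists_isDC_of_finite {p : ℕ} [Fact p.Prime] {A B T : Type u} [CommRing A] [IsDomain A]
    [IsNoetherianRing A] [CommRing B] (φ : A →+* B) {l : List A}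
    (hmax : (Ideal.ofList ((p : A) :: l)).IsMaximal) (hB : PerfdGood p B (l.map φ))
    [CommRing T] [IsDomain T] [Algebra A T] [Module.Finite A T]
    (hinj : Function.Injective (algebraMap A T)) :
    ∃ (M : Type u) (_ : CommRing M) (τ : T →+* M),
      WR ⊥ (((p : A) :: l).map (τ.comp (algebraMap A T))) ∧
      Ideal.ofList (((p : A) :: l).map (τ.comp (algebraMap A T))) ≠ ⊤ ∧
      ∀ a ∈ (p : A) :: l, IsDC (τ (algebraMap A T a)) M := by
  obtain ⟨s, hs⟩ := Algebra.FiniteType.out (R := A) (A := T)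
  have hint : ∀ g : T, IsIntegral A g := Algebra.IsIntegral.isIntegral
  let f : A[X] := ∏ g ∈ s, minpoly A g
  have hfm : f.Monic := monic_prod_of_monic _ _ fun g _ => minpoly.monic (hint g)
  have hf : ∀ g ∈ (s : Set T), aeval g f = 0 := fun g hg => by
    rw [map_prod]
    exact Finset.prod_eq_zero hg (minpoly.aeval A g)
  obtain ⟨B₁, _, ψ₁, hB₁, ts, hts⟩ := hB.exists_splits (hfm.map φ)
  algebraize [ψ₁.comp φ]
  rw [Polynomial.map_map] at hts
  have htint : ∀ t ∈ {t | t ∈ ts}, IsIntegral A t := fun t ht => by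
    refine ⟨f, hfm, ?_⟩
    rw [← eval_map]
    change eval t (f.map (ψ₁.comp φ)) = 0
    rw [hts, eval_list_prod, List.map_map]
    refine List.prod_eq_zero (List.mem_map.2 ⟨t, ht, by simp⟩)
  let D : Subalgebra A B₁ := Algebra.adjoin A {t | t ∈ ts}
  have hDfin : Module.Finite A D :=
    Module.Finite.iff_fg.2 (fg_adjoin_of_finite (List.finite_toSet ts) htint)
  have hDN : IsNoetherianRing D := IsNoetherianRing.of_finite A D
  have hδ : ∀ Q : Ideal D, ∃ δ : D, Q ∈ minimalPrimes D →
      δ ∉ Q ∧ ∀ q ∈ Q, IsNilpotent (δ * q) := fun Q => by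
    by_cases hQ : Q ∈ minimalPrimes D
    · obtain ⟨δ, h1, h2⟩ := exists_mem_of_minimalPrimes hQ
      exact ⟨δ, fun _ => ⟨h1, h2⟩⟩
    · exact ⟨0, fun h => absurd h hQ⟩
  choose δ hδ using hδ
  obtain ⟨B₂, _, ψ₂, hB₂, hroots⟩ := hB₁.exists_rootSystems
    ((minimalPrimes.finite_of_isNoetherianRing D).toFinset.toList.map fun Q => (δ Q : B₁))
  let χ : D →+* B₂ := ψ₂.comp D.val.toRingHom
  have hχ : χ.comp (algebraMap A D) = (ψ₂.comp ψ₁).comp φ := rfl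
  have hl : ((p : A) :: l).map (χ.comp (algebraMap A D)) =
      (p : B₂) :: ((l.map φ).map ψ₁).map ψ₂ := by
    rw [hχ]
    simp [Function.comp_assoc]
  have hwr := hB₂.wr
  have hne := hB₂.ne_top
  rw [← hl] at hwr hne
  let J : Ideal D := (⨅ n, Ideal.ofList (((p : A) :: l).map (χ.comp (algebraMap A D))) ^ n :
    Ideal B₂).radical.comap χ
  have hJ : J.comap (algebraMap A D) ≤ ⊥ := fun a ha =>
    eq_zero_of_map_mem_iInf (χ.comp (algebraMap A D)) hmax hwr hne ha
  obtain ⟨Q, hJQ, hQp, hQA⟩ := Ideal.exists_ideal_over_prime_of_isIntegral ⊥ J hJ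
  obtain ⟨Q', hQ'min, hQ'Q⟩ := Ideal.exists_minimalPrimes_le (bot_le : ⊥ ≤ Q)
  have hQ'p : Q'.IsPrime := hQ'min.1.1
  have hQ : Q' = Q := by
    by_contra hne
    have := Ideal.IsIntegral.comap_lt_comap (R := A) (lt_of_le_of_ne hQ'Q hne)
    rw [hQA] at this
    exact not_lt_bot this
  subst hQ
  obtain ⟨hδQ, hδnil⟩ := hδ Q' hQ'min
  obtain ⟨r, hr0, hr⟩ := hroots (δ Q') (List.mem_map.2 ⟨Q', by simpa using hQ'min, rfl⟩)
  obtain ⟨M, _, θ, hu, hMwr, hMne, hMdc⟩ := exists_away hwr hr (by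
    rw [hr0]
    exact fun h => hδQ (hJQ h))
  let κ : D →+* M := (θ.comp (Pi.constRingHom ℕ B₂)).comp χ
  have hp : (((p : A) :: l).map (χ.comp (algebraMap A D))) =
    (p : B₂) :: l.map (χ.comp (algebraMap A D)) := by simp
  have hκ : ∀ q ∈ Q', κ q = 0 := fun q hq => by
    have hri : ∀ i, r i ^ p ^ i = χ (δ Q') := fun i => by
      induction i with
      | zero =>
        rw [pow_zero, pow_one]
        exact hr0
      | succ i ih => rw [pow_succ', pow_mul, hr, ih]
    obtain ⟨e, he⟩ := hδnil q hq
    have hz : ∀ i, IsNilpotent (r i * χ q) := fun i => ⟨p ^ i * (e + 1), by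
      have h1 : p ^ i * (e + 1) = (e + 1) + (p ^ i * (e + 1) - (e + 1)) :=
        (Nat.add_sub_cancel' (Nat.le_mul_of_pos_left _ (pow_pos (Fact.out : p.Prime).pos i))).symm
      have h2 : (χ (δ Q')) ^ (e + 1) * χ q ^ (e + 1) = 0 := by
        rw [← mul_pow, ← map_mul, ← map_pow, pow_eq_zero_of_le e.le_succ he, map_zero]
      have h3 : χ q ^ (p ^ i * (e + 1)) =
          χ q ^ (e + 1) * χ q ^ (p ^ i * (e + 1) - (e + 1)) := by rw [← pow_add, ← h1]
      rw [mul_pow, pow_mul, hri, h3, ← mul_assoc, h2, zero_mul]⟩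
    have hdvd : ∀ n, (p : M) ^ n ∣ θ r * κ q := fun n => by
      have : ∀ i, (p : B₂) ^ n ∣ r i * χ q := fun i => hB₂.pow_dvd_of_isNilpotent (hz i) n
      choose c hc using this
      refine ⟨θ c, ?_⟩
      have h3 : r * Pi.constRingHom ℕ B₂ (χ q) = (p : ℕ → B₂) ^ n * c := by
        ext i
        simpa using hc i
      calc θ r * κ q = θ (r * Pi.constRingHom ℕ B₂ (χ q)) := by rw [map_mul]; rfl
        _ = _ := by rw [h3, map_mul, map_pow, map_natCast]
    rw [hp] at hMwr hMdc
    have h4 := hMdc p (by simp)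
    have h5 := hMwr.1
    rw [map_natCast, map_natCast] at h4
    rw [map_natCast] at h5
    exact (hu.mul_right_eq_zero).1 (h4.eq_zero_of_forall_pow_dvd h5 hdvd)
  have hinjQ : Function.Injective (algebraMap A (D ⧸ Q')) := by
    rw [injective_iff_map_eq_zero]
    intro a ha
    have : a ∈ Q'.comap (algebraMap A D) :=
      show algebraMap A D a ∈ Q' from Ideal.Quotient.eq_zero_iff_mem.1 ha
    rwa [hQA] at this
  have hdom : IsDomain (D ⧸ Q') := Ideal.Quotient.isDomain Q'
  have htD : f.map (algebraMap A D) =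
      (ts.attach.map fun t => X - C (⟨t.1, Algebra.subset_adjoin t.2⟩ : D)).prod := by
    refine Polynomial.map_injective D.val.toRingHom Subtype.val_injective ?_
    rw [Polynomial.map_map, Polynomial.map_list_prod, List.map_map]
    have : (⇑(mapRingHom D.val.toRingHom) ∘ fun t : {x // x ∈ ts} =>
        X - C (⟨t.1, Algebra.subset_adjoin t.2⟩ : D)) = fun t : {x // x ∈ ts} => X - C t.1 := by
      ext1 t
      simp
    refine Eq.trans (b := (ts.attach.map fun t => X - C t.1).prod) (hts.trans ?_)
      (congrArg List.prod (congrArg (fun g => ts.attach.map g) this.symm))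
    rw [List.attach_map_val (f := fun t => X - C t)]
  obtain ⟨ρ⟩ := nonempty_algHom_of_splits (E := D ⧸ Q') hinj hinjQ hs hf
    (ts := ts.attach.map fun t => Ideal.Quotient.mk Q' ⟨t.1, Algebra.subset_adjoin t.2⟩) (by
      have := congrArg (Polynomial.map (Ideal.Quotient.mk Q')) htD
      rw [Polynomial.map_map, Polynomial.map_list_prod, List.map_map] at this
      refine this.trans ?_
      rw [List.map_map]
      congr 1
      refine List.map_congr_left fun t _ => ?_
      simp)
  let τ : T →+* M := (Ideal.Quotient.lift Q' κ hκ).comp ρ.toRingHom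
  have hτ : τ.comp (algebraMap A T) =
      (θ.comp (Pi.constRingHom ℕ B₂)).comp (χ.comp (algebraMap A D)) := by
    ext a
    have : ρ (algebraMap A T a) = Ideal.Quotient.mk Q' (algebraMap A D a) := ρ.commutes a
    change Ideal.Quotient.lift Q' κ hκ (ρ (algebraMap A T a)) = _
    rw [this]
    rfl
  refine ⟨M, inferInstance, τ, ?_, ?_, fun a ha => ?_⟩
  · rw [hτ]
    rw [List.map_map] at hMwr
    exact hMwr
  · rw [hτ]
    rw [List.map_map] at hMne
    exact hMne
  · have := hMdc _ (List.mem_map_of_mem ha)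
    rw [show τ (algebraMap A T a) = _ from RingHom.congr_fun hτ a]
    exact this

end BigCM

namespace BigCM

open WittVector

/-- A complete ring with perfect residue field receives a map from the Witt vectors. -/
lemma exists_wittVector_hom {p : ℕ} [Fact p.Prime] {S k : Type*} [CommRing S] [Field k]
    [CharP k p] [PerfectRing k p] (π : S →+* k) (hπ : Function.Surjective π)
    [IsAdicComplete (RingHom.ker π) S] :
    ∃ θ : WittVector p k →+* S, ∀ w, π (θ w) = w.coeff 0 := by
  let J := RingHom.ker π
  have hp : (p : S) ∈ J := by simp [J, RingHom.mem_ker]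
  have hker : ∀ n, RingHom.ker (WittVector.map (p := p) π) ≤
      RingHom.ker ((Ideal.Quotient.mk (J ^ (n + 1))).comp (ghostComponent (p := p) n)) := by
    intro n x hx
    have hx' : ∀ i, x.coeff i ∈ J := fun i => by
      have := congrArg (fun z => z.coeff i) (RingHom.mem_ker.1 hx)
      simpa [map_coeff, J, RingHom.mem_ker] using this
    rw [RingHom.mem_ker, RingHom.comp_apply, Ideal.Quotient.eq_zero_iff_mem,
      ghostComponent_apply, wittPolynomial, map_sum]
    refine Ideal.sum_mem _ fun i hi => ?_
    have hi' : i ≤ n := Nat.lt_succ_iff.1 (Finset.mem_range.1 hi)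
    have : (MvPolynomial.aeval x.coeff) ((MvPolynomial.monomial (R := ℤ)
        (Finsupp.single i (p ^ (n - i)))) (p ^ i)) = (p : S) ^ i * x.coeff i ^ p ^ (n - i) := by
      simp [MvPolynomial.aeval_monomial, map_pow]
    rw [this, show n + 1 = i + (n - i + 1) by lia, pow_add]
    refine Ideal.mul_mem_mul (Ideal.pow_mem_pow hp _) ?_
    refine Ideal.pow_le_pow_right ?_ (Ideal.pow_mem_pow (hx' i) _)
    exact (n - i).lt_two_pow_self.succ_le.trans
      (Nat.pow_le_pow_left (Nat.Prime.two_le Fact.out) _)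
  let gh : ∀ n, WittVector p k →+* S ⧸ J ^ (n + 1) := fun n =>
    RingHom.liftOfSurjective (WittVector.map π) (map_surjective _ hπ)
      ⟨(Ideal.Quotient.mk (J ^ (n + 1))).comp (ghostComponent n), hker n⟩
  have hgh : ∀ n x, gh n (WittVector.map π x) = Ideal.Quotient.mk _ (ghostComponent n x) :=
    fun n x => RingHom.liftOfSurjective_comp_apply ..
  let f : ∀ n, WittVector p k →+* S ⧸ J ^ (n + 1) := fun n =>
    (gh n).comp (WittVector.map ((frobeniusEquiv k p).symm ^ n : k ≃+* k).toRingHom)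
  have hft : ∀ n s a, π s ^ p ^ n = a →
      f n (teichmuller p a) = Ideal.Quotient.mk _ (s ^ p ^ n) := fun n s a h => by
    have h1 : ((frobeniusEquiv k p).symm ^ n : k ≃+* k).toRingHom a = π s := by
      change ((frobeniusEquiv k p).symm ^ n : k ≃+* k) a = π s
      rw [← h]
      clear h
      generalize π s = b
      induction n with
      | zero => simp
      | succ n ih =>
        rw [pow_succ, RingAut.mul_apply, pow_succ, pow_mul, frobeniusEquiv_symm_pow, ih]
    change gh n (WittVector.map _ (teichmuller p a)) = _
    rw [map_teichmuller, h1, ← map_teichmuller, hgh, ghostComponent_teichmuller]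
  have hmono : StrictMono fun n : ℕ => n + 1 := Order.succ_strictMono
  have hf : ∀ {n}, (Ideal.Quotient.factorPow J (hmono.monotone n.le_succ)).comp (f (n + 1)) =
      f n := fun {n} => by
    refine eq_of_apply_teichmuller_eq (p := p) _ _ ⟨n + 1, ?_⟩ fun a => ?_
    · rw [← map_natCast (Ideal.Quotient.mk (J ^ (n + 1))), ← map_pow,
        Ideal.Quotient.eq_zero_iff_mem]
      exact Ideal.pow_mem_pow hp _
    · obtain ⟨s, hs⟩ := hπ (((frobeniusEquiv k p).symm)^[n + 1] a)
      have h1 : π s ^ p ^ (n + 1) = a := by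
        rw [hs]
        generalize n + 1 = e
        clear hs
        induction e generalizing a with
        | zero => simp
        | succ e ih =>
          rw [Function.iterate_succ_apply, pow_succ, pow_mul, ih, frobeniusEquiv_symm_pow_p]
      rw [RingHom.comp_apply, hft (n + 1) s a h1,
        hft n (s ^ p) a (by rw [map_pow, ← pow_mul, ← pow_succ', h1]), ← pow_mul, ← pow_succ']
      rfl
  have : IsAdicComplete J S := ‹_›
  refine ⟨IsAdicComplete.StrictMono.liftRingHom J hmono f hf, fun w => ?_⟩
  have h := IsAdicComplete.StrictMono.mk_liftRingHom J hmono f hf (n := 0) w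
  obtain ⟨x, rfl⟩ := map_surjective (p := p) _ hπ w
  have h2 : f 0 (WittVector.map π x) = Ideal.Quotient.mk _ (x.coeff 0) := by
    change gh 0 (WittVector.map (RingHom.id k) (WittVector.map π x)) = _
    rw [WittVector.map_id, RingHom.id_apply, hgh, ghostComponent_apply]
    simp
  rw [h2, Ideal.Quotient.eq, zero_add, pow_one, RingHom.mem_ker, map_sub, sub_eq_zero] at h
  rw [h, map_coeff]

/-- Evaluation of power series over a base mapping to a complete ring. -/
lemma exists_mvPowerSeries_hom {σ W S : Type*} [Finite σ] [CommRing W] [CommRing S] (J : Ideal S)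
    [IsAdicComplete J S] (f : W →+* S) (a : σ → S) (ha : ∀ i, a i ∈ J) :
    ∃ g : MvPowerSeries σ W →+* S, (∀ w, g (MvPowerSeries.C w) = f w) ∧
      ∀ i, g (MvPowerSeries.X i) = a i := by
  have hn : ∀ n i, IsNilpotent (Ideal.Quotient.mk (J ^ n) (a i)) := fun n i => ⟨n, by
    rw [← map_pow, Ideal.Quotient.eq_zero_iff_mem]
    exact Ideal.pow_mem_pow (ha i) n⟩
  let F : ∀ n, MvPowerSeries σ W →+* S ⧸ J ^ n := fun n =>
    evalNilp ((Ideal.Quotient.mk (J ^ n)).comp f) (fun i => Ideal.Quotient.mk _ (a i)) (hn n)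
  have hF : ∀ {m n} (h : m ≤ n), (Ideal.Quotient.factorPow J h).comp (F n) = F m :=
    fun {m n} h => by
      ext x
      exact map_evalNilp _ _ (hn n) (Ideal.Quotient.factorPow J h) x
  have hm := fun n x => IsAdicComplete.mk_liftRingHom J F hF n x
  refine ⟨IsAdicComplete.liftRingHom J F hF, fun w => ?_, fun i => ?_⟩
  · refine IsHausdorff.eq_iff_smodEq (I := J) |>.2 fun n => ?_
    rw [SModEq.sub_mem, smul_eq_mul, Ideal.mul_top, ← Ideal.Quotient.eq, hm]
    exact evalNilp_C ..
  · refine IsHausdorff.eq_iff_smodEq (I := J) |>.2 fun n => ?_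
    rw [SModEq.sub_mem, smul_eq_mul, Ideal.mul_top, ← Ideal.Quotient.eq, hm]
    exact evalNilp_X ..

end BigCM

namespace BigCM

lemma isPrecomplete_iff_exists {A : Type*} [CommRing A] (I : Ideal A) :
    IsPrecomplete I A ↔ ∀ f : ℕ → A, (∀ n, f (n + 1) - f n ∈ I ^ n) →
      ∃ L, ∀ n, L - f n ∈ I ^ n := by
  constructor
  · intro h f hf
    obtain ⟨L, hL⟩ := h.prec' f fun {m n} hmn => by
      rw [SModEq.sub_mem, smul_eq_mul, Ideal.mul_top]
      induction n, hmn using Nat.le_induction with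
      | base => simp
      | succ n hmn ih =>
        rw [show f m - f (n + 1) = (f m - f n) - (f (n + 1) - f n) by ring]
        exact sub_mem ih (Ideal.pow_le_pow_right hmn (hf n))
    refine ⟨L, fun n => ?_⟩
    have := (hL n).symm
    rwa [SModEq.sub_mem, smul_eq_mul, Ideal.mul_top] at this
  · intro h
    refine ⟨fun f hf => ?_⟩
    obtain ⟨L, hL⟩ := h f fun n => by
      have := (hf n.le_succ).symm
      rwa [SModEq.sub_mem, smul_eq_mul, Ideal.mul_top] at this
    refine ⟨L, fun n => SModEq.symm ?_⟩
    rw [SModEq.sub_mem, smul_eq_mul, Ideal.mul_top]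
    exact hL n

lemma isPrecomplete_sup {A : Type*} [CommRing A] {I J : Ideal A} (hI : IsPrecomplete I A)
    (hJ : IsPrecomplete J A) : IsPrecomplete (I ⊔ J) A := by
  rw [isPrecomplete_iff_exists] at hI hJ ⊢
  intro f hf
  have hcauchy : ∀ n m, n ≤ m → f m - f n ∈ (I ⊔ J) ^ n := fun n m hnm => by
    induction m, hnm using Nat.le_induction with
    | base => simp
    | succ m hnm ih =>
      rw [show f (m + 1) - f n = (f (m + 1) - f m) + (f m - f n) by ring]
      exact add_mem (Ideal.pow_le_pow_right hnm (hf m)) ih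
  have hsplit : ∀ n, ∃ a ∈ I ^ n, ∃ b ∈ J ^ n, a + b = f (2 * (n + 1)) - f (2 * n) := fun n =>
    Submodule.mem_sup.1 (Ideal.sup_pow_add_le_pow_sup_pow (two_mul n ▸ hcauchy _ _ (by lia)))
  choose a ha b hb hab using hsplit
  obtain ⟨La, hLa⟩ := hI (fun n => ∑ i ∈ Finset.range n, a i) fun n => by
    simpa [Finset.sum_range_succ] using ha n
  obtain ⟨Lb, hLb⟩ := hJ (fun n => ∑ i ∈ Finset.range n, b i) fun n => by
    simpa [Finset.sum_range_succ] using hb n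
  refine ⟨f 0 + La + Lb, fun n => ?_⟩
  have h1 : f (2 * n) = f 0 + ∑ i ∈ Finset.range n, a i + ∑ i ∈ Finset.range n, b i := by
    rw [add_assoc, ← Finset.sum_add_distrib, Finset.sum_congr rfl fun i _ => hab i,
      Finset.sum_range_sub fun i => f (2 * i)]
    simp
  have h2 := hcauchy n (2 * n) (by lia)
  rw [show f 0 + La + Lb - f n = (La - ∑ i ∈ Finset.range n, a i) +
    (Lb - ∑ i ∈ Finset.range n, b i) + (f (2 * n) - f n) by rw [h1]; ring]
  exact add_mem (add_mem (Ideal.pow_right_mono le_sup_left n (hLa n))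
    (Ideal.pow_right_mono le_sup_right n (hLb n))) h2

lemma mem_mvPowerSeries_span_C_pow {σ W : Type*} [CommRing W] {w : W} {n : ℕ}
    {f : MvPowerSeries σ W} : f ∈ Ideal.span {MvPowerSeries.C w} ^ n ↔
      ∀ e, MvPowerSeries.coeff e f ∈ Ideal.span {w} ^ n := by
  simp only [Ideal.span_singleton_pow, Ideal.mem_span_singleton, ← map_pow]
  constructor
  · rintro ⟨g, rfl⟩ e
    rw [MvPowerSeries.coeff_C_mul]
    exact dvd_mul_right _ _
  · intro h
    choose g hg using h
    let g' : MvPowerSeries σ W := g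
    refine ⟨g', ?_⟩
    ext e
    rw [MvPowerSeries.coeff_C_mul, hg]
    rfl

lemma isPrecomplete_mvPowerSeries {σ W : Type*} [CommRing W] {w : W}
    (h : IsPrecomplete (Ideal.span {w}) W) :
    IsPrecomplete (Ideal.span {(MvPowerSeries.C w : MvPowerSeries σ W)})
      (MvPowerSeries σ W) := by
  rw [isPrecomplete_iff_exists] at h ⊢
  intro f hf
  choose L hL using fun e => h (fun n => MvPowerSeries.coeff e (f n)) fun n => by
    rw [← map_sub]
    exact mem_mvPowerSeries_span_C_pow.1 (hf n) e
  let L' : MvPowerSeries σ W := L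
  exact ⟨L', fun n => mem_mvPowerSeries_span_C_pow.2 fun e => by
    rw [map_sub]
    exact hL e n⟩

lemma isPrecomplete_pi {A ι : Type*} [CommRing A] [Finite ι] {I : Ideal A}
    (h : IsPrecomplete I A) : IsPrecomplete I (ι → A) := by
  have hpi : ∀ n (x : ι → A), x ∈ (I ^ n • ⊤ : Submodule A (ι → A)) ↔ ∀ i, x i ∈ I ^ n := by
    intro n x
    constructor
    · intro hx i
      exact Submodule.smul_induction_on hx
        (fun r hr m _ => Ideal.mul_mem_right (m i) _ hr) fun x y hx hy => add_mem hx hy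
    · intro hx
      classical
      have := Fintype.ofFinite ι
      rw [pi_eq_sum_univ x]
      exact Submodule.sum_mem _ fun i _ => Submodule.smul_mem_smul (hx i) trivial
  refine ⟨fun f hf => ?_⟩
  choose L hL using fun i => h.prec' (fun n => f n i) fun {m n} hmn => by
    have := hf hmn
    rw [SModEq.sub_mem, hpi] at this
    rw [SModEq.sub_mem, smul_eq_mul, Ideal.mul_top]
    exact this i
  refine ⟨L, fun n => ?_⟩
  rw [SModEq.sub_mem, hpi]
  intro i
  have := hL i n
  rwa [SModEq.sub_mem, smul_eq_mul, Ideal.mul_top] at this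

/-- Nakayama's lemma for complete rings: finiteness can be checked modulo the ideal. -/
lemma finite_of_span_sup_eq_top {A S : Type*} [CommRing A] [CommRing S] [Algebra A S]
    {I : Ideal A} (hA : IsPrecomplete I A) [IsHausdorff I S] (F : Finset S)
    (hF : Submodule.span A (F : Set S) ⊔ I • ⊤ = ⊤) : Module.Finite A S := by
  have := isPrecomplete_pi (ι := F) hA
  refine Module.Finite.of_surjective (Fintype.linearCombination A (Subtype.val : F → S))
    (surjective_of_mkQ_comp_surjective (I := I) ?_)
  rw [← LinearMap.range_eq_top, LinearMap.range_comp, Fintype.range_linearCombination,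
    Subtype.range_coe_subtype]
  rw [Submodule.map_mkQ_eq_top, sup_comm]
  simpa using hF

/-- If `A → S ⧸ J` is surjective then `S ⧸ J ^ n` is a finite `A`-module. -/
lemma exists_finset_span_sup_pow {A S : Type*} [CommRing A] [CommRing S] [Algebra A S]
    {J : Ideal S} (hJ : J.FG) (h : ∀ s, ∃ a, s - algebraMap A S a ∈ J) (n : ℕ) :
    ∃ F : Finset S, ∀ s, ∃ t ∈ Submodule.span A (F : Set S), s - t ∈ J ^ n := by
  classical
  induction n with
  | zero => exact ⟨∅, fun s => ⟨0, by simp, by simp⟩⟩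
  | succ n ih =>
    obtain ⟨F, hF⟩ := ih
    obtain ⟨G, hG⟩ := Submodule.FG.pow hJ n
    refine ⟨F ∪ G, fun s => ?_⟩
    have key : ∀ x ∈ J ^ n, ∃ t ∈ Submodule.span A (G : Set S), x - t ∈ J ^ (n + 1) := by
      intro x hx
      rw [← hG] at hx
      induction hx using Submodule.span_induction with
      | mem x hx => exact ⟨x, Submodule.subset_span hx, by simp⟩
      | zero => exact ⟨0, by simp, by simp⟩
      | add x y _ _ hx hy =>
        obtain ⟨t, ht, hxt⟩ := hx
        obtain ⟨u, hu, hyu⟩ := hy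
        exact ⟨t + u, add_mem ht hu, by
          rw [add_sub_add_comm]
          exact add_mem hxt hyu⟩
      | smul c x hxG hx =>
        obtain ⟨t, ht, hxt⟩ := hx
        obtain ⟨a, ha⟩ := h c
        refine ⟨a • t, Submodule.smul_mem _ _ ht, ?_⟩
        have hx' : x ∈ J ^ n := hG ▸ hxG
        rw [show c • x - a • t = (c - algebraMap A S a) * x + algebraMap A S a * (x - t) by
          rw [smul_eq_mul, Algebra.smul_def a t]; ring]
        refine add_mem ?_ (Ideal.mul_mem_left _ _ hxt)
        rw [pow_succ']
        exact Ideal.mul_mem_mul ha hx'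
    obtain ⟨t, ht, hst⟩ := hF s
    obtain ⟨u, hu, hsu⟩ := key _ hst
    refine ⟨t + u, add_mem (Submodule.span_mono (by simp) ht) (Submodule.span_mono (by simp) hu),
      ?_⟩
    rwa [← sub_sub]

end BigCM

namespace BigCM

open Polynomial IsLocalRing

/-- If `K` is a field quotient of `S` and `X ^ p - a` stays irreducible over `K`, then any quotient
of `S[X]` killing `X ^ p - a` has the same property. -/
lemma mem_or_exists_of_forall_pow_ne {R S S' : Type*} [CommRing R] [CommRing S] [CommRing S']
    [Algebra R S] [Algebra R S'] {I : Ideal R} (hS : (I.map (algebraMap R S)).IsMaximal)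
    {p : ℕ} (hp : p.Prime) {a : S} (ha : ∀ b, b ^ p - a ∉ I.map (algebraMap R S))
    (e : S[X] →ₐ[R] S') (he : Function.Surjective e) (hea : e (X ^ p - C a) = 0) (u : S') :
    u ∈ I.map (algebraMap R S') ∨ ∃ v, u * v - 1 ∈ I.map (algebraMap R S') := by
  let J := I.map (algebraMap R S)
  let _ : Field (S ⧸ J) := Ideal.Quotient.field J
  let π := Ideal.Quotient.mk J
  have hπ : Function.Surjective (mapRingHom π) := map_surjective _ Ideal.Quotient.mk_surjective
  have hker : ∀ g : S[X], g.map π = 0 → e g ∈ I.map (algebraMap R S') := fun g hg => by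
    have h1 : g ∈ J.map (C : S →+* S[X]) := Ideal.mem_map_C_iff.2 fun n => by
      have := congrArg (fun f => f.coeff n) hg
      rw [coeff_map, coeff_zero] at this
      exact Ideal.Quotient.eq_zero_iff_mem.1 this
    have h2 := Ideal.mem_map_of_mem e.toRingHom h1
    rw [Ideal.map_map, Ideal.map_map] at h2
    rwa [show (e.toRingHom.comp C).comp (algebraMap R S) = algebraMap R S' from
      RingHom.ext fun r => e.commutes r] at h2
  have hirr : Irreducible (X ^ p - C (π a)) := X_pow_sub_C_irreducible_of_prime hp fun b hb => by
    obtain ⟨b, rfl⟩ := Ideal.Quotient.mk_surjective b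
    rw [← map_pow, Ideal.Quotient.eq] at hb
    exact ha b hb
  have hq : (X ^ p - C a).map π = X ^ p - C (π a) := by simp
  obtain ⟨g, rfl⟩ := he u
  rcases hirr.isCoprime_or_dvd (g.map π) with ⟨s, t, hst⟩ | ⟨h, hh⟩
  · obtain ⟨s, rfl⟩ := hπ s
    obtain ⟨t, rfl⟩ := hπ t
    refine Or.inr ⟨e t, ?_⟩
    have := hker (s * (X ^ p - C a) + t * g - 1) (by
      rw [Polynomial.map_sub, Polynomial.map_add, Polynomial.map_mul, Polynomial.map_mul, hq,
        Polynomial.map_one, sub_eq_zero]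
      exact hst)
    rwa [map_sub, map_add, map_mul, hea, mul_zero, zero_add, map_mul, map_one, mul_comm] at this
  · obtain ⟨h, rfl⟩ := hπ h
    have := hker (g - (X ^ p - C a) * h) (by
      rw [Polynomial.map_sub, Polynomial.map_mul, hq, hh, coe_mapRingHom, sub_self])
    rw [map_sub, map_mul, hea, zero_mul, sub_zero] at this
    exact Or.inl this

lemma map_maximalIdeal_ne_top {R S : Type*} [CommRing R] [IsLocalRing R] [CommRing S]
    [Algebra R S] [Algebra.IsIntegral R S] (hinj : Function.Injective (algebraMap R S)) :
    (maximalIdeal R).map (algebraMap R S) ≠ ⊤ := by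
  obtain ⟨Q, -, hQ, hQm⟩ := Ideal.exists_ideal_over_prime_of_isIntegral (maximalIdeal R)
    (⊥ : Ideal S) (by
      rw [← RingHom.ker_eq_comap_bot, (RingHom.injective_iff_ker_eq_bot _).1 hinj]
      exact bot_le)
  exact fun h => hQ.ne_top (top_le_iff.1 (h ▸ Ideal.map_le_iff_le_comap.2 hQm.ge))

lemma isMaximal_of_forall {S : Type*} [CommRing S] {J : Ideal S} (hJ : J ≠ ⊤)
    (h : ∀ u, u ∈ J ∨ ∃ v, u * v - 1 ∈ J) : J.IsMaximal := by
  refine Ideal.isMaximal_iff.2 ⟨(Ideal.ne_top_iff_one J).1 hJ, fun K u hJK hu hK => ?_⟩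
  obtain ⟨v, hv⟩ := (h u).resolve_left hu
  rw [show (1 : S) = u * v - (u * v - 1) by ring]
  exact sub_mem (Ideal.mul_mem_right _ _ hK) (hJK hv)

/-- A local domain has an integral extension `S` in which the extension of the maximal ideal is
maximal with perfect residue field. -/
lemma exists_perfect_residue {R : Type u} [CommRing R] [IsDomain R] [IsLocalRing R] {p : ℕ}
    (hp : p.Prime) : ∃ (S : Type u) (_ : CommRing S) (_ : Algebra R S),
      Algebra.IsIntegral R S ∧ Function.Injective (algebraMap R S) ∧
      ((maximalIdeal R).map (algebraMap R S)).IsMaximal ∧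
      ∀ a : S, ∃ b, b ^ p - a ∈ (maximalIdeal R).map (algebraMap R S) := by
  let Ω := AlgebraicClosure (FractionRing R)
  let 𝔪 := maximalIdeal R
  have hΩ : Function.Injective (algebraMap R Ω) := by
    rw [IsScalarTower.algebraMap_eq R (FractionRing R) Ω]
    exact (algebraMap (FractionRing R) Ω).injective.comp (IsFractionRing.injective R _)
  let P : Set (Subalgebra R Ω) := {S | S ≤ integralClosure R Ω ∧
    ∀ u : S, u ∈ 𝔪.map (algebraMap R S) ∨ ∃ v, u * v - 1 ∈ 𝔪.map (algebraMap R S)}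
  have hincl : ∀ {S T : Subalgebra R Ω} (h : S ≤ T) {u : S}, u ∈ 𝔪.map (algebraMap R S) →
      Subalgebra.inclusion h u ∈ 𝔪.map (algebraMap R T) := fun {S T} h u hu => by
    have := Ideal.mem_map_of_mem (Subalgebra.inclusion h).toRingHom hu
    rw [Ideal.map_map] at this
    exact this
  have hbot : ⊥ ∈ P := by
    refine ⟨bot_le, fun ⟨u, hu⟩ => ?_⟩
    obtain ⟨r, rfl⟩ := Algebra.mem_bot.1 hu
    by_cases hr : r ∈ 𝔪
    · exact Or.inl (Ideal.mem_map_of_mem (algebraMap R (⊥ : Subalgebra R Ω)) hr)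
    · obtain ⟨s, hs⟩ := (notMem_maximalIdeal.1 hr).exists_right_inv
      refine Or.inr ⟨algebraMap R _ s, ?_⟩
      have : (⟨algebraMap R Ω r, hu⟩ : (⊥ : Subalgebra R Ω)) = algebraMap R _ r := rfl
      rw [this, ← map_mul, hs, map_one, sub_self]
      exact zero_mem _
  obtain ⟨S, -, hS⟩ := zorn_le_nonempty₀ P (fun c hc hchain T hT => by
    have hdir : DirectedOn (· ≤ ·) c := hchain.directedOn
    have hne : c.Nonempty := ⟨T, hT⟩
    refine ⟨sSup c, ⟨sSup_le fun S hS => (hc hS).1, fun ⟨u, hu⟩ => ?_⟩, fun S hS => le_sSup hS⟩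
    have hne' : Nonempty c := hne.to_subtype
    have hu₁ : u ∈ ((⨆ S : c, (S : Subalgebra R Ω) : Subalgebra R Ω) : Set Ω) := by
      rwa [← sSup_eq_iSup']
    rw [Subalgebra.coe_iSup_of_directed hdir.directed_val] at hu₁
    obtain ⟨⟨S, hS⟩, hu'⟩ := Set.mem_iUnion.1 hu₁
    have hle := le_sSup hS
    rcases (hc hS).2 ⟨u, hu'⟩ with h | ⟨v, h⟩
    · exact Or.inl (hincl hle h)
    · exact Or.inr ⟨Subalgebra.inclusion hle v, hincl hle h⟩) ⊥ hbot
  have hint : Algebra.IsIntegral R S := ⟨fun u =>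
    (isIntegral_algHom_iff S.val Subtype.val_injective).1 (hS.prop.1 u.2)⟩
  have hinj : Function.Injective (algebraMap R S) := fun x y h => hΩ (congrArg Subtype.val h)
  have hmax := isMaximal_of_forall (map_maximalIdeal_ne_top hinj) hS.prop.2
  refine ⟨S, inferInstance, inferInstance, hint, hinj, hmax, fun a => ?_⟩
  by_contra! ha
  obtain ⟨y, hy⟩ := IsAlgClosed.exists_pow_nat_eq (a : Ω) hp.pos
  let e : S[X] →ₐ[R] Ω := (aeval y : S[X] →ₐ[S] Ω).restrictScalars R
  have heC : ∀ c : S, e (C c) = c := fun c => aeval_C y c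
  have heX : e X = y := aeval_X y
  have hyint : y ∈ integralClosure R Ω := IsIntegral.of_pow hp.pos (hy ▸ hS.prop.1 a.2)
  have hmem : e.range ∈ P := by
    refine ⟨?_, mem_or_exists_of_forall_pow_ne hmax hp ha e.rangeRestrict
      e.rangeRestrict_surjective (Subtype.ext ?_)⟩
    · rintro _ ⟨g, rfl⟩
      change aeval y g ∈ _
      rw [aeval_eq_sum_range]
      refine sum_mem fun i _ => ?_
      rw [Algebra.smul_def]
      exact mul_mem (hS.prop.1 (g.coeff i).2) (pow_mem hyint i)
    · change e (X ^ p - C a) = 0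
      rw [map_sub, map_pow, heX, heC, hy, sub_self]
  have hle : S ≤ e.range := fun c hc => ⟨C ⟨c, hc⟩, heC _⟩
  have hyS : y ∈ S := hS.le_of_ge hmem hle ⟨X, heX⟩
  refine ha ⟨y, hyS⟩ ?_
  rw [show (⟨y, hyS⟩ : S) ^ p = a from Subtype.ext hy, sub_self]
  exact zero_mem _

end BigCM

namespace BigCM

open IsLocalRing

/-- Krull dimension does not drop along an injective integral extension. -/
lemma ringKrullDim_le_of_isIntegral {R S : Type*} [CommRing R] [CommRing S] [Algebra R S]
    [Algebra.IsIntegral R S] (hinj : Function.Injective (algebraMap R S)) :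
    ringKrullDim R ≤ ringKrullDim S := by
  refine iSup_le fun l => ?_
  obtain ⟨Q, -, hQ, hQl⟩ := Ideal.exists_ideal_over_prime_of_isIntegral l.head.asIdeal
    (⊥ : Ideal S) (by
      rw [← RingHom.ker_eq_comap_bot, (RingHom.injective_iff_ker_eq_bot _).1 hinj]
      exact bot_le)
  have : Q.LiesOver l.head.asIdeal := ⟨hQl.symm⟩
  obtain ⟨L, hL, -⟩ := Ideal.exists_ltSeries_of_hasGoingUp l Q
  rw [← hL]
  exact le_iSup (fun L : LTSeries (PrimeSpectrum S) => ((L.length : ℕ) : WithBot ℕ∞)) L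

/-- A membership in a span only involves finitely many coefficients. -/
lemma exists_finset_mem_span {R S : Type*} [CommRing R] [CommRing S] [Algebra R S] {X : Set S}
    {x : S} (hx : x ∈ Ideal.span X) : ∃ F : Finset S, ∀ R' : Subalgebra R S,
      (F : Set S) ⊆ R' → ∃ x' ∈ Ideal.span (R'.val ⁻¹' X), (x' : S) = x := by
  classical
  induction hx using Submodule.span_induction with
  | mem x hx =>
    refine ⟨{x}, fun R' hR' => ⟨⟨x, hR' (by simp)⟩, Ideal.subset_span hx, rfl⟩⟩
  | zero => exact ⟨∅, fun R' _ => ⟨0, zero_mem _, rfl⟩⟩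
  | add x y _ _ ihx ihy =>
    obtain ⟨F, hF⟩ := ihx
    obtain ⟨G, hG⟩ := ihy
    refine ⟨F ∪ G, fun R' hR' => ?_⟩
    rw [Finset.coe_union, Set.union_subset_iff] at hR'
    obtain ⟨x', hx', rfl⟩ := hF R' hR'.1
    obtain ⟨y', hy', rfl⟩ := hG R' hR'.2
    exact ⟨x' + y', add_mem hx' hy', rfl⟩
  | smul c x _ ih =>
    obtain ⟨F, hF⟩ := ih
    refine ⟨insert c F, fun R' hR' => ?_⟩
    rw [Finset.coe_insert, Set.insert_subset_iff] at hR'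
    obtain ⟨x', hx', rfl⟩ := hF R' hR'.2
    exact ⟨⟨c, hR'.1⟩ * x', Ideal.mul_mem_left _ _ hx', rfl⟩

/-- If the maximal ideal of the Noetherian local ring `R` becomes nilpotent modulo `s` in an
integral extension, up to a term one power higher, then `R` has dimension at most `#s`. -/
lemma ringKrullDim_le_card_of_pow_le {R S : Type*} [CommRing R] [IsNoetherianRing R]
    [IsLocalRing R] [CommRing S] [Algebra R S] [Algebra.IsIntegral R S]
    (hinj : Function.Injective (algebraMap R S)) (s : Finset S)
    (hs : ∀ x ∈ s, x ∈ (maximalIdeal R).map (algebraMap R S)) (N : ℕ)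
    (h : (maximalIdeal R).map (algebraMap R S) ^ N ≤
      Ideal.span (s : Set S) ⊔ (maximalIdeal R).map (algebraMap R S) ^ (N + 1)) :
    ringKrullDim R ≤ s.card := by
  classical
  set 𝔪 := maximalIdeal R
  obtain ⟨G, hG⟩ := (inferInstance : IsNoetherian R R).noetherian (𝔪 ^ N)
  have key : ∀ g : R, ∃ F : Finset S, g ∈ G → ∀ R' : Subalgebra R S, (F : Set S) ⊆ R' →
      algebraMap R R' g ∈ Ideal.span (R'.val ⁻¹' s) ⊔
        𝔪.map (algebraMap R R') • (𝔪 ^ N).map (algebraMap R R') := by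
    intro g
    by_cases hg : g ∈ G
    swap
    · exact ⟨∅, fun h => absurd h hg⟩
    have hgN : g ∈ 𝔪 ^ N := hG ▸ Submodule.subset_span hg
    have h1 : algebraMap R S g ∈
        Ideal.span ((s : Set S) ∪ algebraMap R S '' (𝔪 ^ (N + 1) : Ideal R)) := by
      rw [Ideal.span_union]
      change _ ∈ Ideal.span (s : Set S) ⊔ (𝔪 ^ (N + 1)).map (algebraMap R S)
      rw [Ideal.map_pow]
      refine h ?_
      rw [← Ideal.map_pow]
      exact Ideal.mem_map_of_mem _ hgN
    obtain ⟨F, hF⟩ := exists_finset_mem_span (R := R) h1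
    refine ⟨F, fun _ R' hR' => ?_⟩
    obtain ⟨x', hx', hx⟩ := hF R' hR'
    obtain rfl : x' = algebraMap R R' g := Subtype.ext hx
    refine Ideal.span_le.2 ?_ hx'
    rintro y (hy | ⟨r, hr, hy⟩)
    · exact Ideal.mem_sup_left (Ideal.subset_span hy)
    · obtain rfl : algebraMap R R' r = y := Subtype.ext hy
      refine Ideal.mem_sup_right ?_
      rw [smul_eq_mul, ← Ideal.map_mul, ← pow_succ']
      exact Ideal.mem_map_of_mem _ hr
  choose F hF using key
  let R' : Subalgebra R S := Algebra.adjoin R ((G.biUnion F : Finset S) : Set S)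
  have hfin : Module.Finite R R' := Algebra.finite_adjoin_of_finite_of_isIntegral
    (Finset.finite_toSet _) fun x _ => Algebra.IsIntegral.isIntegral x
  have : IsNoetherianRing R' := IsNoetherianRing.of_finite R R'
  have hFR' : ∀ g ∈ G, (F g : Set S) ⊆ R' := fun g hg x hx =>
    Algebra.subset_adjoin (Finset.mem_coe.2 (Finset.mem_biUnion.2 ⟨g, hg, hx⟩))
  have hinj' : Function.Injective (algebraMap R R') := fun x y h =>
    hinj (congrArg Subtype.val h)
  have hunder : ∀ P : Ideal R', P.IsMaximal → P.comap (algebraMap R R') = 𝔪 := fun P hP =>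
    eq_maximalIdeal (Ideal.isMaximal_comap_of_isIntegral_of_isMaximal P)
  have hjac : 𝔪.map (algebraMap R R') ≤ Ideal.jacobson ⊥ :=
    le_sInf fun P hP => Ideal.map_le_iff_le_comap.2 (hunder P hP.2).ge
  have hle : (𝔪 ^ N).map (algebraMap R R') ≤ Ideal.span (R'.val ⁻¹' s) := by
    refine Submodule.le_of_le_smul_of_le_jacobson_bot (IsNoetherian.noetherian _) hjac ?_
    refine Ideal.map_le_iff_le_comap.2 (hG.ge.trans (Submodule.span_le.2 fun g hg => ?_))
    exact hF g hg R' (hFR' g hg)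
  refine (ringKrullDim_le_of_isIntegral hinj').trans
    ((ringKrullDim_le_iff_isMaximal_height_le _).2 fun P hP => ?_)
  let s' : Finset R' := s.preimage R'.val Subtype.val_injective.injOn
  have hs' : (s' : Set R') = R'.val ⁻¹' s := Finset.coe_preimage _ _
  have hcard : s'.card ≤ s.card := by
    rw [← Finset.card_image_of_injective s' Subtype.val_injective]
    exact Finset.card_le_card fun x hx => by
      obtain ⟨y, hy, rfl⟩ := Finset.mem_image.1 hx
      exact Finset.mem_preimage.1 hy
  refine (WithBot.coe_le_coe.2 (Ideal.height_le_card_of_mem_minimalPrimes_span_finset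
    (s := s') ?_)).trans (by exact_mod_cast hcard)
  rw [hs']
  have hint : Algebra.IsIntegral R' S := Algebra.IsIntegral.tower_top R
  refine ⟨⟨hP.isPrime, Ideal.span_le.2 fun y hy => ?_⟩, fun Q hQ hQP => ?_⟩
  · obtain ⟨Q, -, hQ, hQP⟩ := Ideal.exists_ideal_over_prime_of_isIntegral P (⊥ : Ideal S)
      ((Ideal.comap_bot_of_injective _ Subtype.val_injective).trans_le bot_le)
    rw [SetLike.mem_coe, ← hQP]
    have h𝔪Q : 𝔪.map (algebraMap R S) ≤ Q := Ideal.map_le_iff_le_comap.2 (by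
      rw [← hunder P hP, ← hQP, Ideal.comap_comap]
      exact le_rfl)
    exact h𝔪Q (hs _ hy)
  · have hQ' := hQ.1
    have h𝔪 : Q.comap (algebraMap R R') = 𝔪 := by
      refine le_antisymm ((Ideal.comap_mono hQP).trans (hunder P hP).le) ?_
      have := Ideal.comap_isPrime (algebraMap R R') Q
      exact Ideal.IsPrime.le_of_pow_le (n := N) (Ideal.map_le_iff_le_comap.1 (hle.trans hQ.2))
    have : Q.IsMaximal := Ideal.isMaximal_of_isIntegral_of_isMaximal_comap Q
      (by rw [h𝔪]; exact maximalIdeal.isMaximal R)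
    exact (this.eq_of_le hP.ne_top hQP).ge

/-- If the maximal ideal of `R` becomes nilpotent modulo `y` in the completion of an integral
extension of `R`, then `R` has dimension at most `#y`. -/
lemma ringKrullDim_le_card_of_adicCompletion {R S : Type*} [CommRing R] [IsNoetherianRing R]
    [IsLocalRing R] [CommRing S] [Algebra R S] [Algebra.IsIntegral R S]
    (hinj : Function.Injective (algebraMap R S)) {J : Ideal S}
    (hJ : J = (maximalIdeal R).map (algebraMap R S)) (y : Finset (AdicCompletion J S))
    (hy : ∀ x ∈ y, x ∈ J.map (algebraMap S (AdicCompletion J S))) (N : ℕ)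
    (h : J.map (algebraMap S (AdicCompletion J S)) ^ N ≤
      Ideal.span (y : Set (AdicCompletion J S))) :
    ringKrullDim R ≤ y.card := by
  classical
  let φ := AdicCompletion.evalₐ J (N + 1)
  have hφ : ∀ s : S, φ (algebraMap S _ s) = Ideal.Quotient.mk _ s := fun s => φ.commutes s
  choose f hf using fun x => Ideal.Quotient.mk_surjective (φ x)
  have hφJ : ∀ n, ∀ x ∈ J.map (algebraMap S (AdicCompletion J S)) ^ n, ∀ s,
      Ideal.Quotient.mk _ s = φ x → s ∈ J ^ n ⊔ J ^ (N + 1) := by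
    intro n x hx s hsx
    rw [← Ideal.map_pow] at hx
    have h1 := Ideal.mem_map_of_mem φ.toRingHom hx
    rw [Ideal.map_map, show φ.toRingHom.comp (algebraMap S _) = Ideal.Quotient.mk _ from
      RingHom.ext hφ] at h1
    change φ x ∈ _ at h1
    rw [← hsx] at h1
    rwa [← Ideal.mem_comap, Ideal.comap_map_of_surjective' _ Ideal.Quotient.mk_surjective,
      Ideal.mk_ker] at h1
  refine (ringKrullDim_le_card_of_pow_le hinj (y.image f) ?_ N ?_).trans
    (by exact_mod_cast Finset.card_image_le)
  · intro s hs
    obtain ⟨x, hx, rfl⟩ := Finset.mem_image.1 hs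
    have := hφJ 1 x (by rw [pow_one]; exact hy x hx) _ (hf x)
    rw [pow_one, sup_eq_left.2 (Ideal.pow_le_self (Nat.succ_ne_zero N))] at this
    rwa [← hJ]
  · rw [← hJ]
    intro s hs
    have h1 : algebraMap S (AdicCompletion J S) s ∈ Ideal.span (y : Set _) := by
      refine h ?_
      rw [← Ideal.map_pow]
      exact Ideal.mem_map_of_mem _ hs
    have h2 := Ideal.mem_map_of_mem φ.toRingHom h1
    rw [Ideal.map_span, show φ.toRingHom '' (y : Set _) =
        Ideal.Quotient.mk (J ^ (N + 1)) '' ((y.image f : Finset S) : Set S) by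
      rw [Finset.coe_image, Set.image_image]
      exact Set.image_congr fun x _ => (hf x).symm, ← Ideal.map_span] at h2
    change φ _ ∈ _ at h2
    rwa [hφ, ← Ideal.mem_comap, Ideal.comap_map_of_surjective' _ Ideal.Quotient.mk_surjective,
      Ideal.mk_ker] at h2

end BigCM

namespace BigCM

open IsLocalRing

lemma radical_eq_of_mem_minimalPrimes {R : Type*} [CommRing R] [IsLocalRing R] {I : Ideal R}
    (h : maximalIdeal R ∈ I.minimalPrimes) : I.radical = maximalIdeal R := by
  refine le_antisymm (h.1.1.radical_le_iff.2 h.1.2) ?_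
  rw [← Ideal.sInf_minimalPrimes]
  exact le_sInf fun Q hQ => h.2 hQ.1 (le_maximalIdeal hQ.1.1.ne_top)

/-- A nonzerodivisor in the maximal ideal is part of a system of parameters. -/
lemma exists_radical_ofList_cons_eq {R : Type*} [CommRing R] [IsNoetherianRing R] [IsLocalRing R]
    {a : R} (ha : a ∈ nonZeroDivisors R) (ham : a ∈ maximalIdeal R) :
    ∃ xs : List R, (Ideal.ofList (a :: xs)).radical = maximalIdeal R ∧
      ((xs.length + 1 : ℕ) : WithBot ℕ∞) ≤ ringKrullDim R := by
  let I := Ideal.span {a}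
  let π := Ideal.Quotient.mk I
  have hπ : Function.Surjective π := Ideal.Quotient.mk_surjective
  have hI : I ≤ maximalIdeal R := (Ideal.span_singleton_le_iff_mem _).2 ham
  have : Nontrivial (R ⧸ I) := Ideal.Quotient.nontrivial_iff.2
    (fun h => (maximalIdeal.isMaximal R).ne_top (top_le_iff.1 (h ▸ hI)))
  have : IsLocalRing (R ⧸ I) := IsLocalRing.of_surjective' π hπ
  obtain ⟨s, hs, hcard⟩ :=
    (maximalIdeal (R ⧸ I)).exists_finset_card_eq_height_of_isNoetherianRing
  have hrad := radical_eq_of_mem_minimalPrimes hs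
  choose f hf using id hπ
  refine ⟨s.toList.map f, ?_, ?_⟩
  · have h1 : (Ideal.ofList (s.toList.map f)).map π = Ideal.span (s : Set (R ⧸ I)) := by
      rw [Ideal.map_ofList, List.map_map]
      unfold Ideal.ofList
      congr 1
      ext y
      simp [hf, π]
    have h2 := congrArg (Ideal.comap π) hrad
    rw [← h1, Ideal.comap_radical, Ideal.comap_map_of_surjective' _ hπ, Ideal.mk_ker] at h2
    rw [Ideal.ofList_cons, sup_comm, h2]
    exact (eq_maximalIdeal (Ideal.comap_isMaximal_of_surjective π hπ))
  · rw [List.length_map, Finset.length_toList]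
    refine le_trans ?_ (ringKrullDim_quotient_succ_le_of_nonZeroDivisor ha)
    rw [← maximalIdeal_height_eq_ringKrullDim, ← hcard]
    push_cast
    exact le_rfl

/-- In a Noetherian local ring, a nonzerodivisor in the maximal ideal extends to a full system of
parameters. -/
lemma exists_parameters {R : Type*} [CommRing R] [IsNoetherianRing R] [IsLocalRing R]
    {a : R} (ha : a ∈ nonZeroDivisors R) (ham : a ∈ maximalIdeal R) :
    ∃ (m : ℕ) (x : Fin m → R), (Ideal.ofList (a :: List.ofFn x)).radical = maximalIdeal R ∧
      ringKrullDim R = (m + 1 : ℕ) := by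
  obtain ⟨xs, hxs, hlen⟩ := exists_radical_ofList_cons_eq ha ham
  refine ⟨xs.length, xs.get, ?_, le_antisymm ?_ hlen⟩
  · rwa [List.ofFn_get]
  · rw [← maximalIdeal_height_eq_ringKrullDim]
    refine WithBot.coe_le_coe.2 (height_le_length (xs := a :: xs) ?_)
    refine ⟨⟨(maximalIdeal.isMaximal R).isPrime, hxs ▸ Ideal.le_radical⟩, fun Q hQ _ => ?_⟩
    rw [← hxs]
    exact hQ.1.radical_le_iff.2 hQ.2

end BigCM

namespace BigCM

open IsLocalRing MvPowerSeries

instance {σ W : Type*} [CommRing W] [IsDomain W] : IsDomain (MvPowerSeries σ W) :=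
  NoZeroDivisors.to_isDomain _

lemma mem_span_range_X {σ W : Type*} [Finite σ] [CommRing W] {f : MvPowerSeries σ W}
    (hf : constantCoeff f = 0) :
    f ∈ Ideal.span (Set.range (X : σ → MvPowerSeries σ W)) := by
  classical
  have := Fintype.ofFinite σ
  choose sel hsel using fun e : {e : σ →₀ ℕ // e ≠ 0} => Finsupp.ne_iff.1 e.2
  let c : σ → MvPowerSeries σ W := fun i e =>
    if h : e ≠ 0 then if sel ⟨e, h⟩ = i then coeff e f else 0 else 0
  have hc : ∀ i e, coeff e (c i) =
      if h : e ≠ 0 then if sel ⟨e, h⟩ = i then coeff e f else 0 else 0 := fun i e => rfl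
  have hsum : f = ∑ i, c i := by
    ext e
    rw [map_sum]
    simp_rw [hc]
    by_cases he : e = 0
    · subst he
      simpa using hf
    · simp [he]
  rw [hsum]
  refine Ideal.sum_mem _ fun i _ => ?_
  have : X i ∣ c i := X_dvd_iff.2 fun e he => by
    rw [hc]
    split_ifs with h h'
    · subst h'
      exact absurd he (hsel ⟨e, h⟩)
    · rfl
    · rfl
  exact Ideal.mem_of_dvd _ this (Ideal.subset_span ⟨i, rfl⟩)

variable {p : ℕ} [Fact p.Prime] {k : Type u} [Field k] [CharP k p] {m : ℕ}

lemma ofList_ofFn {R : Type*} [CommRing R] {m : ℕ} (x : Fin m → R) :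
    Ideal.ofList (List.ofFn x) = Ideal.span (Set.range x) := by
  unfold Ideal.ofList
  congr 1
  ext
  simp [List.mem_ofFn]

lemma ofList_base_isMaximal [PerfectRing k p] :
    (Ideal.ofList ((p : MvPowerSeries (Fin m) (WittVector p k)) ::
      List.ofFn fun i => X i)).IsMaximal := by
  let χ : MvPowerSeries (Fin m) (WittVector p k) →+* k :=
    (WittVector.constantCoeff : WittVector p k →+* k).comp constantCoeff
  have hχ : Function.Surjective χ := fun a =>
    ⟨C (WittVector.teichmuller p a), by simp [χ, WittVector.teichmuller_coeff_zero]⟩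
  have : Ideal.ofList ((p : MvPowerSeries (Fin m) (WittVector p k)) ::
      List.ofFn fun i => X i) = RingHom.ker χ := by
    refine le_antisymm (Ideal.span_le.2 ?_) fun f hf => ?_
    · intro y hy
      rcases List.mem_cons.1 hy with rfl | hy
      · change χ _ = 0
        rw [map_natCast, CharP.cast_eq_zero]
      · obtain ⟨i, rfl⟩ := List.mem_ofFn.1 hy
        change χ _ = 0
        simp [χ]
    · rw [Ideal.ofList_cons, ofList_ofFn]
      obtain ⟨d, hd⟩ := Ideal.mem_span_singleton.1
        ((WittVector.mem_span_p_iff_coeff_zero_eq_zero (p := p) (k := k) (constantCoeff f)).2 hf)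
      rw [← sub_add_cancel f (C (constantCoeff f)), add_comm]
      refine Submodule.add_mem_sup ?_ (mem_span_range_X (by simp))
      rw [hd, map_mul, map_natCast]
      exact Ideal.mul_mem_right _ _ (Ideal.mem_span_singleton_self _)
  rw [this]
  exact RingHom.ker_isMaximal_of_surjective χ hχ

lemma isPrecomplete_base [PerfectRing k p] :
    IsPrecomplete (Ideal.ofList ((p : MvPowerSeries (Fin m) (WittVector p k)) ::
      List.ofFn fun i => X i)) (MvPowerSeries (Fin m) (WittVector p k)) := by
  rw [Ideal.ofList_cons, ofList_ofFn]
  refine isPrecomplete_sup ?_ inferInstance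
  rw [← map_natCast (C : WittVector p k →+* _)]
  exact isPrecomplete_mvPowerSeries (WittVector.isAdicCompleteIdealSpanP).toIsPrecomplete

lemma ringKrullDim_le_of_isMaximal_ofList {A : Type*} [CommRing A] [IsNoetherianRing A]
    [IsLocalRing A] {l : List A} (h : (Ideal.ofList l).IsMaximal) :
    ringKrullDim A ≤ l.length := by
  classical
  refine (ringKrullDim_le_spanFinrank_maximalIdeal A).trans ?_
  rw [← eq_maximalIdeal h]
  have : ({y | y ∈ l} : Set A) = (l.toFinset : Set A) := by ext; simp
  have h1 := Submodule.spanFinrank_span_le_ncard_of_finite (R := A) l.toFinset.finite_toSet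
  rw [Set.ncard_coe_finset, ← this] at h1
  exact_mod_cast h1.trans l.toFinset_card_le

end BigCM

namespace BigCM

open IsLocalRing

/-- Module-finiteness of an adically complete algebra can be tested on a residue ring. -/
lemma finite_of_isHausdorff {A S : Type*} [CommRing A] [CommRing S] [Algebra A S] {I : Ideal A}
    (hA : IsPrecomplete I A) {J : Ideal S} [IsHausdorff J S] (hJ : J.FG)
    (hIJ : I.map (algebraMap A S) ≤ J) {N : ℕ} (hN : J ^ N ≤ I.map (algebraMap A S))
    (h : ∀ s, ∃ a, s - algebraMap A S a ∈ J) : Module.Finite A S := by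
  have : IsHausdorff I S := IsHausdorff.of_map hIJ
  obtain ⟨F, hF⟩ := exists_finset_span_sup_pow hJ h N
  refine finite_of_span_sup_eq_top hA F (top_le_iff.1 fun s _ => ?_)
  obtain ⟨t, ht, hst⟩ := hF s
  rw [← sub_add_cancel s t, add_comm]
  refine Submodule.add_mem_sup ht ?_
  rw [Ideal.smul_top_eq_map]
  exact hN hst

/-- A ring map from a Noetherian local domain `A` of dimension at most `dim R` to the completion of
an integral extension of `R` is injective if it takes the maximal ideal of `A` to a primary ideal
for the extension of the maximal ideal of `R`. -/
lemma injective_of_length_le_ringKrullDim {R S A : Type*} [CommRing R] [IsNoetherianRing R]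
    [IsLocalRing R] [CommRing S] [Algebra R S] [Algebra.IsIntegral R S]
    (hinj : Function.Injective (algebraMap R S)) {J : Ideal S}
    (hJ : J = (maximalIdeal R).map (algebraMap R S)) [CommRing A] [IsDomain A]
    [IsNoetherianRing A] [IsLocalRing A] (g : A →+* AdicCompletion J S)
    [Nontrivial (AdicCompletion J S)] {l : List A}
    (hl : (Ideal.ofList l).IsMaximal) (hdim : (l.length : WithBot ℕ∞) ≤ ringKrullDim R)
    (hle : (Ideal.ofList l).map g ≤ J.map (algebraMap S (AdicCompletion J S))) {N : ℕ}
    (hN : J.map (algebraMap S (AdicCompletion J S)) ^ N ≤ (Ideal.ofList l).map g) :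
    Function.Injective g := by
  classical
  rw [injective_iff_map_eq_zero]
  by_contra! h
  obtain ⟨a, ha, ha0⟩ := h
  have ham : a ∈ maximalIdeal A := fun hu => (hu.map g).ne_zero ha
  obtain ⟨xs, hxs, hlen⟩ :=
    exists_radical_ofList_cons_eq (mem_nonZeroDivisors_of_ne_zero ha0) ham
  obtain ⟨n, hn⟩ := (Ideal.ofList (a :: xs)).exists_radical_pow_le_of_fg
    (IsNoetherian.noetherian _)
  rw [hxs, ← eq_maximalIdeal hl] at hn
  let y := (xs.map g).toFinset
  have hy : ∀ z ∈ y, z ∈ J.map (algebraMap S (AdicCompletion J S)) := fun z hz => by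
    obtain ⟨x, hx, rfl⟩ := List.mem_map.1 (List.mem_toFinset.1 hz)
    refine hle (Ideal.mem_map_of_mem g ?_)
    rw [eq_maximalIdeal hl, ← hxs]
    exact Ideal.le_radical (Ideal.subset_span (List.mem_cons_of_mem a hx))
  have hpow : J.map (algebraMap S (AdicCompletion J S)) ^ (N * n) ≤
      Ideal.span (y : Set (AdicCompletion J S)) := by
    rw [pow_mul]
    refine (Ideal.pow_right_mono hN n).trans ?_
    rw [← Ideal.map_pow]
    refine (Ideal.map_mono hn).trans (Ideal.map_le_iff_le_comap.2 (Ideal.span_le.2 ?_))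
    intro x hx
    rcases List.mem_cons.1 hx with rfl | hx
    · change g x ∈ Ideal.span (y : Set (AdicCompletion J S))
      rw [ha]
      exact zero_mem _
    · exact Ideal.subset_span (List.mem_toFinset.2 (List.mem_map_of_mem hx))
  have h1 := ringKrullDim_le_card_of_adicCompletion hinj hJ y hy _ hpow
  have h2 : y.card ≤ xs.length := by
    simpa using (xs.map g).toFinset_card_le
  have h3 := (hlen.trans (ringKrullDim_le_of_isMaximal_ofList hl)).trans (hdim.trans h1)
  have h4 : xs.length + 1 ≤ y.card := by exact_mod_cast h3
  omega

/-- A form of the Cohen structure theorem: after an integral extension and a completion making the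
residue field perfect, a Noetherian local domain of residue characteristic `p` maps to a domain
finite over a power series ring over Witt vectors whose variables are prescribed parameters. -/
theorem exists_finite_over_mvPowerSeries {R : Type u} [CommRing R] [IsDomain R]
    [IsNoetherianRing R] [IsLocalRing R] {p : ℕ} [Fact p.Prime] {m : ℕ} {x : Fin m → R}
    (hx : (Ideal.ofList ((p : R) :: List.ofFn x)).radical = maximalIdeal R)
    (hdim : ringKrullDim R = (m + 1 : ℕ)) :
    ∃ (k : Type u) (_ : Field k) (_ : CharP k p) (_ : PerfectRing k p) (T : Type u)
      (_ : CommRing T) (_ : IsDomain T) (_ : Algebra (MvPowerSeries (Fin m) (WittVector p k)) T)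
      (ψ : R →+* T), Module.Finite (MvPowerSeries (Fin m) (WittVector p k)) T ∧
      Function.Injective (algebraMap (MvPowerSeries (Fin m) (WittVector p k)) T) ∧
      ∀ i, algebraMap (MvPowerSeries (Fin m) (WittVector p k)) T (MvPowerSeries.X i) = ψ (x i) := by
  obtain ⟨S, _, _, hint, hinj, hmax, hperf⟩ :=
    exists_perfect_residue (R := R) (p := p) Fact.out
  obtain ⟨J, hJ⟩ : ∃ J, J = (maximalIdeal R).map (algebraMap R S) := ⟨_, rfl⟩
  rw [← hJ] at hmax
  simp_rw [← hJ] at hperf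
  have hfg : J.FG := hJ ▸ (maximalIdeal R).fg_of_isNoetherianRing.map _
  let S₁ := AdicCompletion J S
  let K := J.map (algebraMap S S₁)
  let ρ : R →+* S₁ := (algebraMap S S₁).comp (algebraMap R S)
  have hK : K = (maximalIdeal R).map ρ := by
    rw [← Ideal.map_map, ← hJ]
  have hmem : ∀ y ∈ (p : R) :: List.ofFn x, y ∈ maximalIdeal R := fun y hy =>
    hx ▸ Ideal.le_radical (Ideal.subset_span hy)
  obtain ⟨k, _, _, _, π, hπ, hker⟩ : ∃ (k : Type u) (_ : Field k) (_ : CharP k p)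
      (_ : PerfectRing k p) (π : S₁ →+* k), Function.Surjective π ∧ RingHom.ker π = K := by
    let _ : Field (S ⧸ J) := Ideal.Quotient.field J
    have hchar : CharP (S ⧸ J) p := charP_of_natCast_eq_zero (by
      rw [← map_natCast (Ideal.Quotient.mk J), Ideal.Quotient.eq_zero_iff_mem, hJ,
        ← map_natCast (algebraMap R S)]
      exact Ideal.mem_map_of_mem _ (hmem _ List.mem_cons_self))
    have : ExpChar (S ⧸ J) p := ExpChar.prime Fact.out
    refine ⟨S ⧸ J, inferInstance, hchar, PerfectRing.ofSurjective _ p fun a => ?_,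
      (AdicCompletion.evalOneₐ J).toRingHom, AdicCompletion.evalOneₐ_surjective J,
      AdicCompletion.ker_evalOneₐ_eq_map J hfg⟩
    obtain ⟨a, rfl⟩ := Ideal.Quotient.mk_surjective a
    obtain ⟨b, hb⟩ := hperf a
    exact ⟨Ideal.Quotient.mk J b, by rwa [frobenius_def, ← map_pow, Ideal.Quotient.eq]⟩
  have hcomplete : IsAdicComplete K S₁ := AdicCompletion.isAdicComplete_self J hfg
  have : IsAdicComplete (RingHom.ker π) S₁ := hker ▸ hcomplete
  obtain ⟨θ, hθ⟩ := exists_wittVector_hom (p := p) π hπ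
  obtain ⟨g, hgC, hgX⟩ := exists_mvPowerSeries_hom K θ (fun i => ρ (x i)) fun i => by
    rw [hK]
    exact Ideal.mem_map_of_mem _ (hmem _ (List.mem_cons_of_mem _ (List.mem_ofFn.2 ⟨i, rfl⟩)))
  let A := MvPowerSeries (Fin m) (WittVector p k)
  let l : List A := (p : A) :: List.ofFn fun i => MvPowerSeries.X i
  have hmap : (Ideal.ofList l).map g = (Ideal.ofList ((p : R) :: List.ofFn x)).map ρ := by
    rw [Ideal.map_ofList, Ideal.map_ofList, List.map_cons, List.map_cons, map_natCast,
      map_natCast, List.map_ofFn, List.map_ofFn]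
    exact congrArg (fun f => Ideal.ofList (_ :: List.ofFn f)) (funext hgX)
  have hle : (Ideal.ofList l).map g ≤ K := by
    rw [hmap, hK]
    exact Ideal.map_mono (Ideal.span_le.2 hmem)
  obtain ⟨N, hN⟩ := (Ideal.ofList ((p : R) :: List.ofFn x)).exists_radical_pow_le_of_fg
    (IsNoetherian.noetherian _)
  have hN' : K ^ N ≤ (Ideal.ofList l).map g := by
    rw [hmap, hK, ← Ideal.map_pow]
    exact Ideal.map_mono (hx ▸ hN)
  have hnt : Nontrivial S₁ := π.domain_nontrivial
  have hgi : Function.Injective g := injective_of_length_le_ringKrullDim hinj hJ g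
    ofList_base_isMaximal (by rw [hdim]; simp) hle hN'
  let _ : Algebra A S₁ := g.toAlgebra
  have hfin : Module.Finite A S₁ := finite_of_isHausdorff isPrecomplete_base (hfg.map _) hle hN'
    fun s => ⟨MvPowerSeries.C (WittVector.teichmuller p (π s)), by
      change s - g _ ∈ K
      rw [hgC, ← hker, RingHom.mem_ker, map_sub, hθ, WittVector.teichmuller_coeff_zero, sub_self]⟩
  obtain ⟨Q, -, hQ, hQA⟩ := Ideal.exists_ideal_over_prime_of_isIntegral (⊥ : Ideal A)
    (⊥ : Ideal S₁) (Ideal.comap_bot_of_injective _ hgi).le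
  refine ⟨k, inferInstance, inferInstance, inferInstance, S₁ ⧸ Q,
    inferInstance, inferInstance, inferInstance, (Ideal.Quotient.mk Q).comp ρ, inferInstance, ?_,
    fun i => ?_⟩
  · rw [RingHom.injective_iff_ker_eq_bot, ← hQA]
    ext a
    exact Ideal.Quotient.eq_zero_iff_mem
  · exact congrArg (Ideal.Quotient.mk Q) (hgX i)

end BigCM

namespace BigCM

open IsLocalRing

/-- An algebra on which one system of parameters is weakly regular, and which is derived complete
with respect to those parameters, is balanced big Cohen-Macaulay. -/
theorem isBalancedBigCM_of_isDC {R M : Type*} [CommRing R] [IsNoetherianRing R] [IsLocalRing R]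
    [CommRing M] [Algebra R M] {l : List R} (hl : (Ideal.ofList l).radical = maximalIdeal R)
    (hdim : (l.length : WithBot ℕ∞) = ringKrullDim R)
    (hreg : WR ⊥ (l.map (algebraMap R M))) (htop : Ideal.ofList (l.map (algebraMap R M)) ≠ ⊤)
    (hdc : ∀ a ∈ l, IsDC (algebraMap R M a) M) : IsBalancedBigCM R M := by
  refine ⟨fun h => htop ?_, fun xs hxs => ?_⟩
  · obtain ⟨N, hN⟩ := (Ideal.ofList l).exists_radical_pow_le_of_fg (IsNoetherian.noetherian _)
    rw [hl] at hN
    rw [← Ideal.map_ofList, ← top_le_iff, ← Ideal.top_pow M N, ← h, ← Ideal.map_pow]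
    exact Ideal.map_mono hN
  · have hht : (l.length : ℕ∞) = (maximalIdeal R).height := by
      rw [← maximalIdeal_height_eq_ringKrullDim] at hdim
      exact_mod_cast hdim
    have hlen : xs.length = l.length := by
      exact_mod_cast hxs.2.1.trans hdim.symm
    refine isWeaklyRegular_of_isSOP l.length (fun a ha => ?_) hht.le rfl hlen hl hxs.2.2
      ((RingTheory.Sequence.isWeaklyRegular_map_algebraMap_iff M M l).1
        (WR.bot_iff_isWeaklyRegular.1 hreg))
    refine isDC_of_mem_radical l (fun b hb => (hdc b hb).congr fun x => ?_) (hl ▸ ha)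
    exact algebraMap_smul M b x

end BigCM

open BigCM

/-- Every complete Noetherian local domain of mixed characteristic admits a balanced big
Cohen-Macaulay algebra. -/
theorem exists_balanced_bigCM_of_mixedChar (R : Type u) [CommRing R] [IsDomain R]
    [IsNoetherianRing R] [IsLocalRing R]
    (hcomplete : IsAdicComplete (IsLocalRing.maximalIdeal R) R)
    (hmixed : MixedCharLocal R) :
    ∃ (B : Type u) (_ : CommRing B) (_ : Algebra R B), IsBalancedBigCM R B := by
  obtain ⟨_, p, hp, hchar⟩ := hmixed
  have : Fact p.Prime := ⟨(CharP.char_is_prime_or_zero (IsLocalRing.ResidueField R) p).resolve_right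
    hp.ne'⟩
  have hpm : (p : R) ∈ IsLocalRing.maximalIdeal R := by
    rw [← IsLocalRing.residue_eq_zero_iff, map_natCast, CharP.cast_eq_zero]
  obtain ⟨m, x, hx, hdim⟩ := exists_parameters
    (mem_nonZeroDivisors_of_ne_zero (Nat.cast_ne_zero.2 hp.ne')) hpm
  obtain ⟨k, _, _, _, T, _, _, _, ψ, _, hinj, hψ⟩ := exists_finite_over_mvPowerSeries hx hdim
  obtain ⟨C, _, φ, hC⟩ := exists_perfdGood_base (p := p) k m
  obtain ⟨B, _, τ, hreg, htop, hdc⟩ := exists_isDC_of_finite φ ofList_base_isMaximal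
    (by rwa [List.map_ofFn]) hinj
  let _ : Algebra R B := (τ.comp ψ).toAlgebra
  have hX : (τ.comp (algebraMap (MvPowerSeries (Fin m) (WittVector p k)) T)) ∘
      (fun i => MvPowerSeries.X i) = algebraMap R B ∘ x :=
    funext fun i => congrArg τ (hψ i)
  have hl : ((p : R) :: List.ofFn x).map (algebraMap R B) =
      ((p : MvPowerSeries (Fin m) (WittVector p k)) ::
        List.ofFn fun i => MvPowerSeries.X i).map (τ.comp (algebraMap _ T)) := by
    rw [List.map_cons, List.map_cons, List.map_ofFn, List.map_ofFn, hX, map_natCast, map_natCast]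
  refine ⟨B, inferInstance, inferInstance, isBalancedBigCM_of_isDC hx (by simp [hdim])
    (hl ▸ hreg) (hl ▸ htop) fun a ha => ?_⟩
  have ha' := List.mem_map_of_mem (f := algebraMap R B) ha
  rw [hl, List.mem_map] at ha'
  obtain ⟨b, hb, hba⟩ := ha'
  exact hba ▸ hdc b hb
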